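/- arXiv:1401.5454 — 6 statements merged into one kernel-verified Lean document; each statement's English description precedes it below -/
import Mathlib

section
/- Let n ≥ 3, α ∈ (0,n), σ₁, σ₂ ∈ [0,α) and p, q > 0 with pq > 1. If max{ (α(q+1) − (σ₁ + σ₂q))/(pq−1) , (α(p+1) − (σ₂ + σ₁p))/(pq−1) } < n − α, then there exist double bounded functions c₁, c₂ on ℝⁿ and a pair of positive continuous functions (u, v) on ℝⁿ which is a positive solution of the Hardy–Sobolev integral system with coefficients c₁, c₂. -/
open MeasureTheory

noncomputable section

/-- A function `c : ℝⁿ → ℝ` is double bounded if there is `C > 0`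
with `1/C ≤ c x ≤ C` for all `x`. -/
def DoubleBounded {n : ℕ} (c : EuclideanSpace ℝ (Fin n) → ℝ) : Prop :=
  ∃ C : ℝ, 0 < C ∧ ∀ x, 1 / C ≤ c x ∧ c x ≤ C

theorem rpow_neg_le_of_le_mul {k r s ρ : ℝ} (hk : 0 < k) (hρ : 0 < ρ) (h : ρ ≤ k * r)
    (hs : 0 ≤ s) : r ^ (-s) ≤ k ^ s * ρ ^ (-s) := by
  have h1 : k⁻¹ * ρ ≤ r := by rwa [inv_mul_le_iff₀ hk]
  have h2 := Real.rpow_le_rpow_of_nonpos (by positivity) h1 (by linarith : -s ≤ 0)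
  rwa [Real.mul_rpow (by positivity) hρ.le, Real.inv_rpow hk.le, Real.rpow_neg hk.le,
    inv_inv] at h2

/-- The radial weight `(ρ + ‖y‖)^(-β) ‖y‖^(-γ)` on `ℝⁿ`. -/
def radialWeight {n : ℕ} (ρ β γ : ℝ) (y : EuclideanSpace ℝ (Fin n)) : ℝ :=
  (ρ + ‖y‖) ^ (-β) * ‖y‖ ^ (-γ)

theorem radialWeight_nonneg {n : ℕ} {ρ : ℝ} (hρ : 0 ≤ ρ) (β γ : ℝ)
    (y : EuclideanSpace ℝ (Fin n)) : 0 ≤ radialWeight ρ β γ y := by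
  unfold radialWeight
  positivity

theorem integrable_radialWeight_one {n : ℕ} (hn : 0 < n) {β γ : ℝ}
    (hγ : γ < n) (hβγ : (n : ℝ) < β + γ) :
    Integrable (radialWeight (n := n) 1 β γ) := by
  have : Nonempty (Fin n) := ⟨⟨0, hn⟩⟩
  have key := integrable_fun_norm_addHaar (volume : Measure (EuclideanSpace ℝ (Fin n)))
    (f := fun r : ℝ => (1 + r) ^ (-β) * r ^ (-γ))
  refine key.2 ?_
  rw [finrank_euclideanSpace_fin]
  have hmeas : Measurable fun y : ℝ => y ^ (n - 1) • ((1 + y) ^ (-β) * y ^ (-γ)) := by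
    simp only [smul_eq_mul]
    fun_prop
  have hpow : ∀ y : ℝ, 0 < y → ‖y ^ (n - 1) • ((1 + y) ^ (-β) * y ^ (-γ))‖
      = (1 + y) ^ (-β) * y ^ ((n : ℝ) - 1 - γ) := by
    intro y hy
    rw [Real.norm_of_nonneg (by simp only [smul_eq_mul]; positivity), smul_eq_mul,
      ← Real.rpow_natCast, Nat.cast_sub hn, Nat.cast_one, sub_eq_add_neg ((n : ℝ) - 1),
      Real.rpow_add hy]
    ring
  rw [← Set.Ioc_union_Ioi_eq_Ioi (zero_le_one' ℝ)]
  refine IntegrableOn.union ?_ ?_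
  · have h1 : IntegrableOn (fun y : ℝ => y ^ ((n : ℝ) - 1 - γ)) (Set.Ioc 0 1) := by
      rw [← intervalIntegrable_iff_integrableOn_Ioc_of_le zero_le_one]
      exact intervalIntegral.intervalIntegrable_rpow' (by linarith)
    refine Integrable.mono' h1 hmeas.aestronglyMeasurable ?_
    filter_upwards [ae_restrict_mem measurableSet_Ioc] with y hy
    rw [hpow y hy.1]
    refine mul_le_of_le_one_left (by have := hy.1; positivity) ?_
    exact Real.rpow_le_one_of_one_le_of_nonpos (by linarith [hy.1]) (by linarith)
  · have h1 : IntegrableOn (fun y : ℝ => y ^ ((n : ℝ) - 1 - γ - β)) (Set.Ioi 1) :=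
      integrableOn_Ioi_rpow_of_lt (by linarith) one_pos
    refine Integrable.mono' h1 hmeas.aestronglyMeasurable ?_
    filter_upwards [ae_restrict_mem measurableSet_Ioi] with y hy
    have hy0 : 0 < y := one_pos.trans hy
    rw [hpow y hy0, sub_eq_add_neg _ β, Real.rpow_add hy0, mul_comm]
    gcongr ?_ * ?_
    exact Real.rpow_le_rpow_of_nonpos hy0 (by linarith) (by linarith)

theorem radialWeight_eq_smul {n : ℕ} {ρ : ℝ} (hρ : 0 < ρ) (β γ : ℝ) :
    radialWeight (n := n) ρ β γ =
      fun y => ρ ^ (-β - γ) * radialWeight 1 β γ (ρ⁻¹ • y) := by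
  funext y
  unfold radialWeight
  have h1 : ρ + ‖y‖ = ρ * (1 + ρ⁻¹ * ‖y‖) := by field_simp
  have h2 : ‖y‖ = ρ * (ρ⁻¹ * ‖y‖) := by field_simp
  have h3 : ‖ρ⁻¹ • y‖ = ρ⁻¹ * ‖y‖ := by
    rw [norm_smul, Real.norm_of_nonneg (by positivity)]
  rw [h3, h1, Real.mul_rpow hρ.le (by positivity)]
  nth_rw 2 [h2]
  rw [Real.mul_rpow hρ.le (by positivity), sub_eq_add_neg, Real.rpow_add hρ]
  ring

theorem integrable_radialWeight {n : ℕ} (hn : 0 < n) {ρ β γ : ℝ} (hρ : 0 < ρ)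
    (hγ : γ < n) (hβγ : (n : ℝ) < β + γ) :
    Integrable (radialWeight (n := n) ρ β γ) := by
  rw [radialWeight_eq_smul hρ]
  exact ((integrable_radialWeight_one hn hγ hβγ).comp_smul (inv_ne_zero hρ.ne')).const_mul _

theorem integral_radialWeight {n : ℕ} {ρ : ℝ} (hρ : 0 < ρ) (β γ : ℝ) :
    ∫ y, radialWeight (n := n) ρ β γ y =
      ρ ^ ((n : ℝ) - β - γ) * ∫ y, radialWeight (n := n) 1 β γ y := by
  rw [radialWeight_eq_smul hρ, integral_const_mul, Measure.integral_comp_smul,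
    finrank_euclideanSpace_fin, smul_eq_mul, ← mul_assoc]
  congr 1
  rw [inv_pow, inv_inv, abs_of_pos (by positivity), ← Real.rpow_natCast, ← Real.rpow_add hρ]
  congr 1
  ring

theorem integral_radialWeight_nonneg {n : ℕ} {ρ : ℝ} (hρ : 0 ≤ ρ) (β γ : ℝ) :
    0 ≤ ∫ y, radialWeight (n := n) ρ β γ y :=
  integral_nonneg fun y => radialWeight_nonneg hρ β γ y

theorem integral_radialWeight_one_pos {n : ℕ} (hn : 0 < n) {β : ℝ} (hβ : (n : ℝ) < β) :
    0 < ∫ y, radialWeight (n := n) 1 β 0 y := by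
  have hn' : (0 : ℝ) < n := Nat.cast_pos.2 hn
  have hint := integrable_radialWeight_one hn (β := β) (γ := 0) hn' (by linarith)
  rw [integral_pos_iff_support_of_nonneg (fun y => radialWeight_nonneg zero_le_one β 0 y) hint]
  have : Function.support (radialWeight (n := n) 1 β 0) = Set.univ := by
    ext y
    have : radialWeight 1 β 0 y ≠ 0 := by
      unfold radialWeight
      rw [neg_zero, Real.rpow_zero, mul_one]
      positivity
    simpa using this
  rw [this]
  exact isOpen_univ.measure_pos _ Set.univ_nonempty

/-- The integrand of the Riesz potential of order `α` of `(1 + ‖y‖)^(-t) ‖y‖^(-σ)` at `x`. -/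
def rieszIntegrand {n : ℕ} (α σ t : ℝ) (x y : EuclideanSpace ℝ (Fin n)) : ℝ :=
  (1 + ‖y‖) ^ (-t) * ‖x - y‖ ^ (α - (n : ℝ)) * ‖y‖ ^ (-σ)

section Riesz

variable {n : ℕ} {α σ t : ℝ}

theorem rieszIntegrand_nonneg (x y : EuclideanSpace ℝ (Fin n)) :
    0 ≤ rieszIntegrand α σ t x y := by
  unfold rieszIntegrand
  positivity

theorem measurable_rieszIntegrand (x : EuclideanSpace ℝ (Fin n)) :
    Measurable (rieszIntegrand α σ t x) := by
  unfold rieszIntegrand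
  fun_prop

theorem rieszIntegrand_le_of_norm_le_one (hαn : α < n) (hσ : 0 ≤ σ) (ht : 0 ≤ t)
    {x y : EuclideanSpace ℝ (Fin n)} (hx : ‖x‖ ≤ 1) (hy : y ≠ 0) (hxy : x ≠ y) :
    rieszIntegrand α σ t x y ≤ radialWeight 1 t (σ + n - α) y +
      2 ^ t * radialWeight 1 t (σ + n - α) (x - y) := by
  have hr : 0 < ‖y‖ := norm_pos_iff.2 hy
  have hd : 0 < ‖x - y‖ := norm_pos_iff.2 (sub_ne_zero.2 hxy)
  have htri : ‖x - y‖ ≤ ‖x‖ + ‖y‖ := norm_sub_le x y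
  have hsplit : ∀ r : ℝ, 0 < r → r ^ (-(σ + n - α)) = r ^ (α - (n : ℝ)) * r ^ (-σ) := by
    intro r hr
    rw [← Real.rpow_add hr]
    congr 1
    ring
  rcases le_total ‖y‖ ‖x - y‖ with h | h
  · refine le_add_of_le_of_nonneg ?_
      (mul_nonneg (by positivity) (radialWeight_nonneg zero_le_one _ _ _))
    unfold rieszIntegrand radialWeight
    rw [hsplit _ hr, ← mul_assoc]
    have := Real.rpow_le_rpow_of_nonpos hr h (by linarith : α - (n : ℝ) ≤ 0)
    gcongr
  · refine le_add_of_nonneg_of_le (radialWeight_nonneg zero_le_one _ _ _) ?_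
    unfold rieszIntegrand radialWeight
    rw [hsplit _ hd, ← mul_assoc, ← mul_assoc]
    have h1 := Real.rpow_le_rpow_of_nonpos hd h (by linarith : -σ ≤ 0)
    have h2 : (1 + ‖y‖) ^ (-t) ≤ 2 ^ t * (1 + ‖x - y‖) ^ (-t) :=
      rpow_neg_le_of_le_mul two_pos (by positivity) (by linarith) ht
    gcongr

theorem rieszIntegrand_le_of_norm_pos (hαn : α < n) (hσ : 0 ≤ σ) (ht : 0 ≤ t)
    {x y : EuclideanSpace ℝ (Fin n)} (hx : 0 < ‖x‖) (hy : y ≠ 0) :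
    rieszIntegrand α σ t x y ≤ 4 ^ (n - α) * radialWeight ‖x‖ (n - α) (t + σ) y +
      4 ^ (t + σ) * radialWeight ‖x‖ (t + σ) (n - α) (x - y) := by
  have hr : 0 < ‖y‖ := norm_pos_iff.2 hy
  have htri : ‖x‖ ≤ ‖x - y‖ + ‖y‖ := by simpa using norm_add_le (x - y) y
  have hle : rieszIntegrand α σ t x y ≤ ‖x - y‖ ^ (-(n - α)) * ‖y‖ ^ (-(t + σ)) := by
    unfold rieszIntegrand
    rw [neg_add, Real.rpow_add hr, neg_sub, ← mul_assoc, mul_comm (‖x - y‖ ^ _)]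
    have := Real.rpow_le_rpow_of_nonpos hr (by linarith : ‖y‖ ≤ 1 + ‖y‖)
      (by linarith : -t ≤ 0)
    gcongr
  refine hle.trans ?_
  rcases le_total ‖y‖ ‖x - y‖ with h | h
  · refine le_add_of_le_of_nonneg ?_
      (mul_nonneg (by positivity) (radialWeight_nonneg hx.le _ _ _))
    have := rpow_neg_le_of_le_mul four_pos (by positivity : 0 < ‖x‖ + ‖y‖)
      (by linarith : ‖x‖ + ‖y‖ ≤ 4 * ‖x - y‖) (by linarith : 0 ≤ (n : ℝ) - α)
    unfold radialWeight
    rw [← mul_assoc]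
    gcongr
  · refine le_add_of_nonneg_of_le
      (mul_nonneg (by positivity) (radialWeight_nonneg hx.le _ _ _)) ?_
    have := rpow_neg_le_of_le_mul four_pos (by positivity : 0 < ‖x‖ + ‖x - y‖)
      (by linarith : ‖x‖ + ‖x - y‖ ≤ 4 * ‖y‖) (by linarith : 0 ≤ t + σ)
    unfold radialWeight
    rw [← mul_assoc, mul_comm]
    gcongr

theorem radialWeight_le_rieszIntegrand (hαn : α < n) (hσ : 0 ≤ σ) (ht : 0 ≤ t)
    {x y : EuclideanSpace ℝ (Fin n)} (hy : y ≠ 0) (hxy : x ≠ y) :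
    radialWeight (1 + ‖x‖) (t + σ + n - α) 0 y ≤ rieszIntegrand α σ t x y := by
  have hr : 0 < ‖y‖ := norm_pos_iff.2 hy
  have hd : 0 < ‖x - y‖ := norm_pos_iff.2 (sub_ne_zero.2 hxy)
  have htri : ‖x - y‖ ≤ ‖x‖ + ‖y‖ := norm_sub_le x y
  have hx := norm_nonneg x
  unfold radialWeight rieszIntegrand
  have hexp : -(t + σ + n - α) = -t + (α - n) + -σ := by ring
  rw [neg_zero, Real.rpow_zero, mul_one, hexp, Real.rpow_add (by positivity),
    Real.rpow_add (by positivity)]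
  gcongr ?_ * ?_ * ?_
  · exact Real.rpow_le_rpow_of_nonpos (by positivity) (by linarith) (by linarith)
  · exact Real.rpow_le_rpow_of_nonpos hd (by linarith) (by linarith)
  · exact Real.rpow_le_rpow_of_nonpos hr (by linarith) (by linarith)

theorem ae_ne_zero_and_ne (hn : 0 < n) (x : EuclideanSpace ℝ (Fin n)) :
    ∀ᵐ y : EuclideanSpace ℝ (Fin n), y ≠ 0 ∧ x ≠ y := by
  have : Nonempty (Fin n) := ⟨⟨0, hn⟩⟩
  filter_upwards [Measure.ae_ne volume (0 : EuclideanSpace ℝ (Fin n)),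
    Measure.ae_ne volume x] with y h0 hx
  exact ⟨h0, hx.symm⟩

/-- An integrand dominated by a combination of a radial weight centred at `0` and one centred at
`x` is integrable, with the corresponding bound on its integral. -/
theorem integrable_rieszIntegrand_and_integral_le {A B : ℝ}
    {f g : EuclideanSpace ℝ (Fin n) → ℝ} (hf : Integrable f) (hg : Integrable g)
    (x : EuclideanSpace ℝ (Fin n))
    (h : ∀ᵐ y, rieszIntegrand α σ t x y ≤ A * f y + B * g (x - y)) :
    Integrable (rieszIntegrand α σ t x) ∧
      ∫ y, rieszIntegrand α σ t x y ≤ A * (∫ y, f y) + B * ∫ y, g y := by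
  have hf' := hf.const_mul A
  have hg' := (hg.comp_sub_left x).const_mul B
  have hint : Integrable (rieszIntegrand α σ t x) := by
    refine (hf'.add hg').mono' (measurable_rieszIntegrand x).aestronglyMeasurable ?_
    filter_upwards [h] with y hy
    rwa [Real.norm_of_nonneg (rieszIntegrand_nonneg x y)]
  refine ⟨hint, (integral_mono_ae hint (hf'.add hg') h).trans_eq ?_⟩
  simp only [Pi.add_apply]
  rw [integral_add hf' hg', integral_const_mul, integral_const_mul, integral_sub_left_eq_self]

/-- If `0 ≤ σ < α < t + σ < n`, the Riesz potential of order `α` of `(1 + ‖y‖)^(-t) ‖y‖^(-σ)`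
is comparable with `(1 + ‖x‖)^(-(t + σ - α))`. -/
theorem exists_rieszIntegrand_bounds (hn : 0 < n) (hα : 0 < α) (hαn : α < n) (hσ : 0 ≤ σ)
    (hσα : σ < α) (ht : 0 ≤ t) (hα_lt : α < t + σ) (hlt_n : t + σ < n) :
    ∃ C : ℝ, 0 < C ∧ ∀ x : EuclideanSpace ℝ (Fin n),
      Integrable (rieszIntegrand α σ t x) ∧
      (1 + ‖x‖) ^ (-(t + σ - α)) ≤ C * ∫ y, rieszIntegrand α σ t x y ∧
      ∫ y, rieszIntegrand α σ t x y ≤ C * (1 + ‖x‖) ^ (-(t + σ - α)) := by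
  set L := ∫ y, radialWeight (n := n) 1 (t + σ + n - α) 0 y with hL
  set M₀ := ∫ y, radialWeight (n := n) 1 t (σ + n - α) y with hM₀
  set M₁ := ∫ y, radialWeight (n := n) 1 (n - α) (t + σ) y with hM₁
  set M₂ := ∫ y, radialWeight (n := n) 1 (t + σ) (n - α) y with hM₂
  have hLpos : 0 < L := integral_radialWeight_one_pos hn (by linarith)
  have hM₀pos : 0 ≤ M₀ := integral_radialWeight_nonneg zero_le_one _ _
  have hM₁pos : 0 ≤ M₁ := integral_radialWeight_nonneg zero_le_one _ _
  have hM₂pos : 0 ≤ M₂ := integral_radialWeight_nonneg zero_le_one _ _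
  have hn' : (0 : ℝ) < n := Nat.cast_pos.2 hn
  set e := t + σ - α with he
  have hepos : 0 < e := by linarith
  set D₀ := M₀ + 2 ^ t * M₀ with hD₀
  set D₁ := 4 ^ (n - α) * M₁ + 4 ^ (t + σ) * M₂ with hD₁
  have hD₀pos : 0 ≤ D₀ := by positivity
  have hD₁pos : 0 ≤ D₁ := by positivity
  have hupper : ∀ x : EuclideanSpace ℝ (Fin n), Integrable (rieszIntegrand α σ t x) ∧
      ∫ y, rieszIntegrand α σ t x y ≤ 2 ^ e * (D₀ + D₁) * (1 + ‖x‖) ^ (-e) := by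
    intro x
    have hhalf : ∀ ρ : ℝ, 0 < ρ → 1 + ‖x‖ ≤ 2 * ρ → ρ ^ (-e) ≤ 2 ^ e * (1 + ‖x‖) ^ (-e) :=
      fun ρ _ hle => rpow_neg_le_of_le_mul two_pos (by positivity) hle hepos.le
    rcases le_total ‖x‖ 1 with hx | hx
    · have hg := integrable_radialWeight (n := n) hn one_pos
        (by linarith : σ + n - α < n) (by linarith : (n : ℝ) < t + (σ + n - α))
      obtain ⟨hi, hb⟩ := integrable_rieszIntegrand_and_integral_le (α := α) (σ := σ) (t := t)
        (A := 1) (B := 2 ^ t) hg hg x (by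
          filter_upwards [ae_ne_zero_and_ne hn x] with y hy
          rw [one_mul]
          exact rieszIntegrand_le_of_norm_le_one hαn hσ ht hx hy.1 hy.2)
      refine ⟨hi, hb.trans ?_⟩
      have h1 := hhalf 1 one_pos (by linarith)
      rw [Real.one_rpow] at h1
      rw [one_mul]
      calc D₀ ≤ (D₀ + D₁) * 1 := by linarith
        _ ≤ (D₀ + D₁) * (2 ^ e * (1 + ‖x‖) ^ (-e)) := by gcongr
        _ = _ := by ring
    · have hx0 : 0 < ‖x‖ := by linarith
      have hf := integrable_radialWeight (n := n) hn hx0 hlt_n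
        (by linarith : (n : ℝ) < n - α + (t + σ))
      have hg := integrable_radialWeight (n := n) hn hx0
        (by linarith : (n : ℝ) - α < n) (by linarith : (n : ℝ) < t + σ + (n - α))
      obtain ⟨hi, hb⟩ := integrable_rieszIntegrand_and_integral_le (α := α) (σ := σ) (t := t)
        (A := 4 ^ (n - α)) (B := 4 ^ (t + σ)) hf hg x (by
          filter_upwards [ae_ne_zero_and_ne hn x] with y hy
          exact rieszIntegrand_le_of_norm_pos hαn hσ ht hx0 hy.1)
      refine ⟨hi, hb.trans ?_⟩
      rw [integral_radialWeight hx0, integral_radialWeight hx0, ← hM₁, ← hM₂,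
        show (n : ℝ) - (n - α) - (t + σ) = -e by rw [he]; ring,
        show (n : ℝ) - (t + σ) - (n - α) = -e by rw [he]; ring]
      have h1 := hhalf ‖x‖ hx0 (by linarith)
      calc _ = D₁ * ‖x‖ ^ (-e) := by rw [hD₁]; ring
        _ ≤ (D₀ + D₁) * (2 ^ e * (1 + ‖x‖) ^ (-e)) := by gcongr; linarith
        _ = _ := by ring
  refine ⟨2 ^ e * (D₀ + D₁) + L⁻¹, by positivity, fun x => ⟨(hupper x).1, ?_, ?_⟩⟩
  · have hlow : (1 + ‖x‖) ^ (-e) * L ≤ ∫ y, rieszIntegrand α σ t x y := by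
      have hx : 0 < 1 + ‖x‖ := by positivity
      have h1 := integral_radialWeight (n := n) hx (t + σ + n - α) 0
      rw [show (n : ℝ) - (t + σ + n - α) - 0 = -e by rw [he]; ring, ← hL] at h1
      rw [← h1]
      refine integral_mono_ae (integrable_radialWeight hn hx hn' (by linarith))
        (hupper x).1 ?_
      filter_upwards [ae_ne_zero_and_ne hn x] with y hy
      exact radialWeight_le_rieszIntegrand hαn hσ ht hy.1 hy.2
    have hI : 0 ≤ ∫ y, rieszIntegrand α σ t x y :=
      integral_nonneg fun y => rieszIntegrand_nonneg x y
    calc (1 + ‖x‖) ^ (-e) = L⁻¹ * ((1 + ‖x‖) ^ (-e) * L) := by field_simp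
      _ ≤ L⁻¹ * ∫ y, rieszIntegrand α σ t x y := by gcongr
      _ ≤ _ := by gcongr; linarith [show 0 ≤ 2 ^ e * (D₀ + D₁) by positivity]
  · refine (hupper x).2.trans ?_
    gcongr
    linarith [inv_pos.2 hLpos]

/-- A decaying power solves one equation of the system up to a double bounded coefficient. -/
theorem exists_doubleBounded_eq_mul_integral (hn : 0 < n) {a b q : ℝ} (hα : 0 < α)
    (hαn : α < n) (hσ : 0 ≤ σ) (hσα : σ < α) (ha : 0 < a) (han : a < n - α) (hbq : 0 ≤ b * q)
    (hab : b * q + σ = a + α) :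
    ∃ c : EuclideanSpace ℝ (Fin n) → ℝ, DoubleBounded c ∧ ∀ x,
      Integrable (fun y : EuclideanSpace ℝ (Fin n) =>
        ((1 + ‖y‖) ^ (-b)) ^ q * ‖x - y‖ ^ (α - (n : ℝ)) * ‖y‖ ^ (-σ)) ∧
      (1 + ‖x‖) ^ (-a) = c x * ∫ y : EuclideanSpace ℝ (Fin n),
        ((1 + ‖y‖) ^ (-b)) ^ q * ‖x - y‖ ^ (α - (n : ℝ)) * ‖y‖ ^ (-σ) := by
  obtain ⟨C, hC, h⟩ := exists_rieszIntegrand_bounds (n := n) hn hα hαn hσ hσα hbq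
    (by linarith) (by linarith)
  rw [show b * q + σ - α = a by linarith] at h
  have heq : ∀ x : EuclideanSpace ℝ (Fin n), (fun y : EuclideanSpace ℝ (Fin n) =>
      ((1 + ‖y‖) ^ (-b)) ^ q * ‖x - y‖ ^ (α - (n : ℝ)) * ‖y‖ ^ (-σ)) =
      rieszIntegrand α σ (b * q) x := by
    intro x
    funext y
    rw [rieszIntegrand, ← Real.rpow_mul (by positivity), neg_mul]
  have hu : ∀ x : EuclideanSpace ℝ (Fin n), 0 < (1 + ‖x‖) ^ (-a) := fun x => by positivity
  have hI : ∀ x : EuclideanSpace ℝ (Fin n), 0 < ∫ y, rieszIntegrand α σ (b * q) x y :=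
    fun x => pos_of_mul_pos_right ((hu x).trans_le (h x).2.1) hC.le
  refine ⟨fun x => (1 + ‖x‖) ^ (-a) / ∫ y, rieszIntegrand α σ (b * q) x y,
    ⟨C, hC, fun x => ⟨?_, ?_⟩⟩, fun x => ⟨?_, ?_⟩⟩
  · rw [div_le_div_iff₀ hC (hI x), one_mul, mul_comm _ C]
    exact (h x).2.2
  · rw [div_le_iff₀ (hI x)]
    exact (h x).2.1
  · rw [heq]
    exact (h x).1
  · rw [heq, div_mul_cancel₀ _ (hI x).ne']

end Riesz

theorem stmt_0 (n : ℕ) (hn : 3 ≤ n) (α σ₁ σ₂ p q : ℝ)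
    (hα₀ : 0 < α) (hαn : α < n)
    (hσ₁0 : 0 ≤ σ₁) (hσ₁α : σ₁ < α) (hσ₂0 : 0 ≤ σ₂) (hσ₂α : σ₂ < α)
    (hp : 0 < p) (hq : 0 < q) (hpq : 1 < p * q)
    (hcrit : max ((α * (q + 1) - (σ₁ + σ₂ * q)) / (p * q - 1))
               ((α * (p + 1) - (σ₂ + σ₁ * p)) / (p * q - 1)) < (n : ℝ) - α) :
    ∃ c₁ c₂ u v : EuclideanSpace ℝ (Fin n) → ℝ,
      DoubleBounded c₁ ∧ DoubleBounded c₂ ∧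
      Continuous u ∧ Continuous v ∧ (∀ x, 0 < u x) ∧ (∀ x, 0 < v x) ∧
      ∀ x : EuclideanSpace ℝ (Fin n),
        Integrable (fun y => v y ^ q * ‖x - y‖ ^ (α - (n : ℝ)) * ‖y‖ ^ (-σ₁)) ∧
        Integrable (fun y => u y ^ p * ‖x - y‖ ^ (α - (n : ℝ)) * ‖y‖ ^ (-σ₂)) ∧
        u x = c₁ x * (∫ y, v y ^ q * ‖x - y‖ ^ (α - (n : ℝ)) * ‖y‖ ^ (-σ₁)) ∧
        v x = c₂ x * (∫ y, u y ^ p * ‖x - y‖ ^ (α - (n : ℝ)) * ‖y‖ ^ (-σ₂)) := by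
  have hn0 : 0 < n := by omega
  have hD : 0 < p * q - 1 := by linarith
  obtain ⟨han, hbn⟩ := max_lt_iff.1 hcrit
  set a := (α * (q + 1) - (σ₁ + σ₂ * q)) / (p * q - 1) with ha
  set b := (α * (p + 1) - (σ₂ + σ₁ * p)) / (p * q - 1) with hb
  have hapos : 0 < a := div_pos (by nlinarith) hD
  have hbpos : 0 < b := div_pos (by nlinarith) hD
  have hbq : b * q + σ₁ = a + α := by
    rw [ha, hb, div_mul_eq_mul_div, div_add' _ _ _ hD.ne', div_add' _ _ _ hD.ne']
    congr 1
    ring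
  have hap : a * p + σ₂ = b + α := by
    rw [ha, hb, div_mul_eq_mul_div, div_add' _ _ _ hD.ne', div_add' _ _ _ hD.ne']
    congr 1
    ring
  obtain ⟨c₁, hc₁, h₁⟩ := exists_doubleBounded_eq_mul_integral hn0 hα₀ hαn hσ₁0 hσ₁α hapos han
    (mul_pos hbpos hq).le hbq
  obtain ⟨c₂, hc₂, h₂⟩ := exists_doubleBounded_eq_mul_integral hn0 hα₀ hαn hσ₂0 hσ₂α hbpos hbn
    (mul_pos hapos hp).le hap
  have hcont : ∀ s : ℝ, Continuous fun x : EuclideanSpace ℝ (Fin n) => (1 + ‖x‖) ^ (-s) :=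
    fun s => (continuous_const.add continuous_norm).rpow_const fun x =>
      Or.inl (by positivity : 0 < 1 + ‖x‖).ne'
  exact ⟨c₁, c₂, fun x => (1 + ‖x‖) ^ (-a), fun x => (1 + ‖x‖) ^ (-b), hc₁, hc₂, hcont a,
    hcont b, fun x => Real.rpow_pos_of_pos (by positivity) _,
    fun x => Real.rpow_pos_of_pos (by positivity) _,
    fun x => ⟨(h₁ x).1, (h₂ x).1, (h₁ x).2, (h₂ x).2⟩⟩
end
end

section
/- Let n ≥ 3, α ∈ (0,n), σ₁, σ₂ ∈ [0,α) and p, q > 0. Suppose that either pq ≤ 1, or pq > 1 and max{ (α(q+1) − (σ₁ + σ₂q))/(pq−1) , (α(p+1) − (σ₂ + σ₁p))/(pq−1) } ≥ n − α. Then for every pair of double bounded functions c₁, c₂ on ℝⁿ there is no positive solution (u, v) of the Hardy–Sobolev integral system with coefficients c₁, c₂. -/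
open MeasureTheory

noncomputable section

/-- The annulus `{y | R < ‖y‖ ≤ 2 R}`. -/
def annulus (n : ℕ) (R : ℝ) : Set (EuclideanSpace ℝ (Fin n)) :=
  Metric.closedBall 0 (2 * R) \ Metric.closedBall 0 R

lemma measurableSet_annulus (n : ℕ) (R : ℝ) : MeasurableSet (annulus n R) :=
  Metric.isClosed_closedBall.measurableSet.diff Metric.isClosed_closedBall.measurableSet

lemma volume_real_annulus_ge {n : ℕ} (hn : 1 ≤ n) {R : ℝ} (hR : 0 < R) :
    R ^ n * volume.real (Metric.ball (0 : EuclideanSpace ℝ (Fin n)) 1)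
      ≤ volume.real (annulus n R) := by
  have hsub : Metric.closedBall (0 : EuclideanSpace ℝ (Fin n)) R
      ⊆ Metric.closedBall 0 (2 * R) := Metric.closedBall_subset_closedBall (by linarith)
  rw [annulus, measureReal_sdiff hsub Metric.isClosed_closedBall.measurableSet
      measure_closedBall_lt_top.ne,
    Measure.addHaar_real_closedBall _ _ hR.le,
    Measure.addHaar_real_closedBall _ _ (by positivity : 0 ≤ 2 * R), finrank_euclideanSpace_fin]
  have h2 : (2 : ℝ) ≤ 2 ^ n := by
    calc (2 : ℝ) = 2 ^ 1 := by norm_num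
      _ ≤ 2 ^ n := pow_le_pow_right₀ (by norm_num) hn
  have h0 : 0 ≤ R ^ n * volume.real (Metric.ball (0 : EuclideanSpace ℝ (Fin n)) 1) := by
    positivity
  rw [mul_pow]
  nlinarith

/-- A potential evaluated at a point of the ball of radius `2 R` dominates the mass of its density
in that ball, up to the factor `(4 R) ^ (α - n)`. -/
lemma potential_ge {n : ℕ} {α s R : ℝ} (hn : 1 ≤ n) (hαn : α < n) (hR : 0 < R)
    {w : EuclideanSpace ℝ (Fin n) → ℝ} (hw : Continuous w) (hw0 : ∀ y, 0 ≤ w y)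
    {x : EuclideanSpace ℝ (Fin n)} (hx : ‖x‖ ≤ 2 * R)
    (hint : Integrable (fun y => w y * ‖x - y‖ ^ (α - (n : ℝ)) * ‖y‖ ^ (-s)))
    {S : Set (EuclideanSpace ℝ (Fin n))} (hS : MeasurableSet S)
    (hSR : S ⊆ Metric.closedBall 0 (2 * R)) :
    IntegrableOn (fun y => w y * ‖y‖ ^ (-s)) S ∧
      (4 * R) ^ (α - (n : ℝ)) * ∫ y in S, w y * ‖y‖ ^ (-s)
        ≤ ∫ y, w y * ‖x - y‖ ^ (α - (n : ℝ)) * ‖y‖ ^ (-s) := by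
  have : Nonempty (Fin n) := ⟨⟨0, hn⟩⟩
  have hpos : 0 < (4 * R) ^ (α - (n : ℝ)) := by positivity
  have key : ∀ᵐ y ∂(volume.restrict S), (4 * R) ^ (α - (n : ℝ)) * (w y * ‖y‖ ^ (-s))
      ≤ w y * ‖x - y‖ ^ (α - (n : ℝ)) * ‖y‖ ^ (-s) := by
    have hne : ∀ᵐ y ∂(volume.restrict S), y ≠ x :=
      ae_restrict_of_ae (Measure.ae_ne volume x)
    filter_upwards [hne, ae_restrict_mem hS] with y hyx hyS
    have hy : ‖y‖ ≤ 2 * R := by simpa using hSR hyS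
    have h1 : ‖x - y‖ ≤ 4 * R := (norm_sub_le x y).trans (by linarith)
    have h2 : 0 < ‖x - y‖ := norm_pos_iff.mpr (sub_ne_zero.mpr hyx.symm)
    have h3 : (4 * R) ^ (α - (n : ℝ)) ≤ ‖x - y‖ ^ (α - (n : ℝ)) :=
      Real.rpow_le_rpow_of_nonpos h2 h1 (by linarith)
    have h4 : 0 ≤ w y * ‖y‖ ^ (-s) := mul_nonneg (hw0 y) (by positivity)
    calc _ ≤ ‖x - y‖ ^ (α - (n : ℝ)) * (w y * ‖y‖ ^ (-s)) :=
          mul_le_mul_of_nonneg_right h3 h4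
      _ = _ := by ring
  have hmeas : AEStronglyMeasurable (fun y => w y * ‖y‖ ^ (-s)) (volume.restrict S) := by
    have : Measurable w := hw.measurable
    exact (by fun_prop : Measurable fun y => w y * ‖y‖ ^ (-s)).aestronglyMeasurable
  have hI : IntegrableOn (fun y => w y * ‖y‖ ^ (-s)) S := by
    refine Integrable.mono' (hint.integrableOn.const_mul ((4 * R) ^ (α - (n : ℝ)))⁻¹) hmeas ?_
    filter_upwards [key] with y hy
    rw [Real.norm_of_nonneg (mul_nonneg (hw0 y) (by positivity)), inv_mul_eq_div,
      le_div_iff₀ hpos, mul_comm]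
    exact hy
  refine ⟨hI, ?_⟩
  rw [← integral_const_mul]
  calc _ ≤ ∫ y in S, w y * ‖x - y‖ ^ (α - (n : ℝ)) * ‖y‖ ^ (-s) :=
        integral_mono_ae (hI.const_mul _) hint.integrableOn key
    _ ≤ _ := setIntegral_le_integral hint (Filter.Eventually.of_forall fun y =>
        mul_nonneg (mul_nonneg (hw0 y) (by positivity)) (by positivity))

lemma setIntegral_annulus_ge {n : ℕ} {s R t : ℝ} (hn : 1 ≤ n) (hs : 0 ≤ s) (hR : 0 < R)
    (ht : 0 ≤ t) {w : EuclideanSpace ℝ (Fin n) → ℝ} (hw : ∀ y, ‖y‖ ≤ 2 * R → t ≤ w y)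
    (hint : IntegrableOn (fun y => w y * ‖y‖ ^ (-s)) (annulus n R)) :
    t * (2 * R) ^ (-s) * (R ^ n * volume.real (Metric.ball (0 : EuclideanSpace ℝ (Fin n)) 1))
      ≤ ∫ y in annulus n R, w y * ‖y‖ ^ (-s) := by
  have hfin : volume (annulus n R) ≠ ⊤ :=
    ((measure_mono Set.sdiff_subset).trans_lt measure_closedBall_lt_top).ne
  calc _ ≤ t * (2 * R) ^ (-s) * volume.real (annulus n R) := by
        gcongr
        exact volume_real_annulus_ge hn hR
    _ = ∫ _ in annulus n R, t * (2 * R) ^ (-s) := by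
        rw [setIntegral_const, smul_eq_mul, mul_comm]
    _ ≤ _ := by
        refine setIntegral_mono_on (integrableOn_const hfin) hint
          (measurableSet_annulus n R) fun y hy => ?_
        have h1 : ‖y‖ ≤ 2 * R := by simpa using hy.1
        have h2 : R < ‖y‖ := by simpa using hy.2
        exact mul_le_mul (hw y h1)
          (Real.rpow_le_rpow_of_nonpos (hR.trans h2) h1 (by linarith)) (by positivity)
          (ht.trans (hw y h1))

/-- A positive sequence with `m k + c (2 ^ k) ^ (A + (1 - s) b) (m k) ^ s ≤ m (k + 1)` grows at
least like `(2 ^ k) ^ b` in the subcritical and critical ranges. -/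
lemma eventually_ge_of_recursion {m : ℕ → ℝ} {c A s b : ℝ} (hm : ∀ k, 0 < m k) (hc : 0 < c)
    (hA : 0 < A)
    (hs : s ≤ 1 ∨ (1 < s ∧ 0 ≤ A + (1 - s) * b)) (hs0 : 0 < s)
    (hrec : ∀ k, m k + c * ((2 : ℝ) ^ k) ^ (A + (1 - s) * b) * m k ^ s ≤ m (k + 1)) :
    ∃ κ > 0, ∃ k₀, ∀ k ≥ k₀, κ * ((2 : ℝ) ^ k) ^ b ≤ m k := by
  have htwo : ∀ k, ((2 : ℝ) ^ (k + 1)) ^ b = 2 ^ b * ((2 : ℝ) ^ k) ^ b := fun k => by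
    rw [pow_succ, Real.mul_rpow (by positivity) (by norm_num), mul_comm]
  suffices h : ∃ κ > 0, ∃ k₀, κ * ((2 : ℝ) ^ k₀) ^ b ≤ m k₀ ∧
      ∀ k ≥ k₀, κ * ((2 : ℝ) ^ k) ^ b ≤ m k → κ * ((2 : ℝ) ^ (k + 1)) ^ b ≤ m (k + 1) by
    obtain ⟨κ, hκ, k₀, h0, h⟩ := h
    exact ⟨κ, hκ, k₀, fun k hk => Nat.le_induction h0 h k hk⟩
  rcases hs with hs | ⟨hs, hE⟩
  · have hlim : Filter.Tendsto (fun k : ℕ => c * ((2 : ℝ) ^ k) ^ A) Filter.atTop Filter.atTop :=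
      ((tendsto_rpow_atTop hA).comp (tendsto_pow_atTop_atTop_of_one_lt one_lt_two)).const_mul_atTop
        hc
    obtain ⟨k₀, hk₀⟩ := Filter.eventually_atTop.mp (hlim.eventually_ge_atTop ((2 : ℝ) ^ b))
    have hpos : 0 < m k₀ / ((2 : ℝ) ^ k₀) ^ b := div_pos (hm _) (by positivity)
    refine ⟨min 1 (m k₀ / ((2 : ℝ) ^ k₀) ^ b), lt_min one_pos hpos, k₀, ?_, fun k hk hmk => ?_⟩
    · rw [← le_div_iff₀ (by positivity)]
      exact min_le_right _ _
    · set κ := min 1 (m k₀ / ((2 : ℝ) ^ k₀) ^ b) with hκdef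
      have hκ : 0 < κ := lt_min one_pos hpos
      have hκs : κ ≤ κ ^ s := by
        simpa using Real.rpow_le_rpow_of_exponent_ge hκ (min_le_left _ _) hs
      have h1 : (κ * ((2 : ℝ) ^ k) ^ b) ^ s ≤ m k ^ s :=
        Real.rpow_le_rpow (by positivity) hmk hs0.le
      have h2 : ((2 : ℝ) ^ k) ^ (A + (1 - s) * b) * (κ * ((2 : ℝ) ^ k) ^ b) ^ s
          = κ ^ s * (((2 : ℝ) ^ k) ^ A * ((2 : ℝ) ^ k) ^ b) := by
        rw [Real.mul_rpow hκ.le (by positivity), ← Real.rpow_mul (by positivity : (0:ℝ) ≤ 2 ^ k),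
          mul_left_comm, ← Real.rpow_add (by positivity), ← Real.rpow_add (by positivity)]
        congr 2
        ring
      calc κ * ((2 : ℝ) ^ (k + 1)) ^ b = κ * 2 ^ b * ((2 : ℝ) ^ k) ^ b := by rw [htwo]; ring
        _ ≤ κ ^ s * (c * ((2 : ℝ) ^ k) ^ A) * ((2 : ℝ) ^ k) ^ b := by
            gcongr
            exact hk₀ k hk
        _ = c * (((2 : ℝ) ^ k) ^ (A + (1 - s) * b) * (κ * ((2 : ℝ) ^ k) ^ b) ^ s) := by
            rw [h2]; ring
        _ ≤ c * (((2 : ℝ) ^ k) ^ (A + (1 - s) * b) * m k ^ s) := by gcongr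
        _ ≤ m (k + 1) := by linarith [hrec k, hm k]
  · have hrec' : ∀ k, m k + c * m k ^ s ≤ m (k + 1) := fun k => by
      refine le_trans ?_ (hrec k)
      have h1 : 1 ≤ ((2 : ℝ) ^ k) ^ (A + (1 - s) * b) :=
        Real.one_le_rpow (one_le_pow₀ one_le_two) hE
      have h2 : 0 < m k ^ s := Real.rpow_pos_of_pos (hm k) s
      gcongr
      nlinarith
    have hlin : ∀ k : ℕ, m 0 + c * m 0 ^ s * k ≤ m k := fun k => by
      induction k with
      | zero => simp
      | succ k ih =>
        have h0 : 0 < m 0 ^ s := Real.rpow_pos_of_pos (hm 0) s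
        have h1 : m 0 ≤ m k := le_trans (by simp; positivity) ih
        have h2 : m 0 ^ s ≤ m k ^ s := Real.rpow_le_rpow (hm 0).le h1 hs0.le
        have h3 : c * m 0 ^ s ≤ c * m k ^ s := by gcongr
        push_cast
        linarith [hrec' k]
    have hlim : Filter.Tendsto m Filter.atTop Filter.atTop := by
      refine Filter.tendsto_atTop_mono hlin (Filter.tendsto_atTop_add_const_left _ _ ?_)
      exact tendsto_natCast_atTop_atTop.const_mul_atTop
        (mul_pos hc (Real.rpow_pos_of_pos (hm 0) s))
    have hlim' : Filter.Tendsto (fun k => c * m k ^ (s - 1)) Filter.atTop Filter.atTop :=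
      ((tendsto_rpow_atTop (by linarith)).comp hlim).const_mul_atTop hc
    obtain ⟨k₀, hk₀⟩ := Filter.eventually_atTop.mp (hlim'.eventually_ge_atTop ((2 : ℝ) ^ b))
    refine ⟨m k₀ / ((2 : ℝ) ^ k₀) ^ b, div_pos (hm _) (by positivity), k₀, ?_, fun k hk hmk => ?_⟩
    · rw [div_mul_cancel₀ _ (by positivity)]
    · have h1 : m k ^ s = m k ^ (s - 1) * m k := by
        rw [← Real.rpow_add_one (hm k).ne']
        congr 1
        ring
      calc _ = 2 ^ b * (m k₀ / ((2 : ℝ) ^ k₀) ^ b * ((2 : ℝ) ^ k) ^ b) := by rw [htwo]; ring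
        _ ≤ 2 ^ b * m k := by gcongr
        _ ≤ c * m k ^ (s - 1) * m k := by
            gcongr
            · exact (hm k).le
            · exact hk₀ k hk
        _ = c * m k ^ s := by rw [h1]; ring
        _ ≤ m (k + 1) := by linarith [hrec' k, hm k]

lemma DoubleBounded.exists_pos_le {n : ℕ} {c : EuclideanSpace ℝ (Fin n) → ℝ}
    (hc : DoubleBounded c) : ∃ d > 0, ∀ x, d ≤ c x := by
  obtain ⟨C, hC, h⟩ := hc
  exact ⟨1 / C, by positivity, fun x => (h x).1⟩

/-- Nonexistence for the system of integral inequalities, when the decay exponent of `v` is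
subcritical or critical. -/
lemma no_positive_supersolution {n : ℕ} (hn : 1 ≤ n) {α σ₁ σ₂ p q d : ℝ}
    (hαn : α < n) (hσ₁0 : 0 ≤ σ₁) (hσ₁α : σ₁ < α) (hσ₂0 : 0 ≤ σ₂) (hσ₂α : σ₂ < α)
    (hp : 0 < p) (hq : 0 < q)
    (hcond : p * q ≤ 1 ∨ (1 < p * q ∧
      ((n : ℝ) - α) * (p * q - 1) ≤ α * (p + 1) - (σ₂ + σ₁ * p)))
    (hd : 0 < d) {u v : EuclideanSpace ℝ (Fin n) → ℝ} (hu : Continuous u) (hv : Continuous v)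
    (hu0 : ∀ x, 0 < u x) (hv0 : ∀ x, 0 < v x)
    (hiv : ∀ x, Integrable (fun y => v y ^ q * ‖x - y‖ ^ (α - (n : ℝ)) * ‖y‖ ^ (-σ₁)))
    (hiu : ∀ x, Integrable (fun y => u y ^ p * ‖x - y‖ ^ (α - (n : ℝ)) * ‖y‖ ^ (-σ₂)))
    (hub : ∀ x, d * (∫ y, v y ^ q * ‖x - y‖ ^ (α - (n : ℝ)) * ‖y‖ ^ (-σ₁)) ≤ u x)
    (hvb : ∀ x, d * (∫ y, u y ^ p * ‖x - y‖ ^ (α - (n : ℝ)) * ‖y‖ ^ (-σ₂)) ≤ v x) :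
    False := by
  set ω := volume.real (Metric.ball (0 : EuclideanSpace ℝ (Fin n)) 1) with hω
  have hω0 : 0 < ω := ENNReal.toReal_pos (Metric.measure_ball_pos _ _ one_pos).ne'
    measure_ball_lt_top.ne
  have hup : Continuous fun y => u y ^ p := hu.rpow_const fun y => Or.inl (hu0 y).ne'
  have hvq : Continuous fun y => v y ^ q := hv.rpow_const fun y => Or.inl (hv0 y).ne'
  have hup0 : ∀ y, 0 < u y ^ p := fun y => Real.rpow_pos_of_pos (hu0 y) p
  have hvq0 : ∀ y, 0 < v y ^ q := fun y => Real.rpow_pos_of_pos (hv0 y) q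
  set M : ℝ → ℝ := fun R => ∫ y in Metric.closedBall (0 : EuclideanSpace ℝ (Fin n)) R,
    u y ^ p * ‖y‖ ^ (-σ₂) with hM
  have hR2 : ∀ {R : ℝ}, 0 < R → ∀ {x : EuclideanSpace ℝ (Fin n)}, ‖x‖ ≤ 2 * R →
      d * ((4 * R) ^ (α - (n : ℝ)) * M R) ≤ v x := fun {R} hR {x} hx =>
    (mul_le_mul_of_nonneg_left (potential_ge hn hαn hR hup (fun y => (hup0 y).le) hx (hiu x)
      Metric.isClosed_closedBall.measurableSet
      (Metric.closedBall_subset_closedBall (by linarith))).2 hd.le).trans (hvb x)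
  have hM0 : ∀ {R : ℝ}, 0 ≤ M R := fun {R} => integral_nonneg fun y =>
    mul_nonneg (hup0 y).le (by positivity)
  have hann : ∀ {R : ℝ}, annulus n R ⊆ Metric.closedBall 0 (2 * R) :=
    fun {_} => Set.sdiff_subset
  -- lower bound for `u` on the ball of radius `2 R`
  have hu2 : ∃ c₁ > 0, ∀ {R : ℝ}, 0 < R → ∀ {x : EuclideanSpace ℝ (Fin n)}, ‖x‖ ≤ 2 * R →
      c₁ * (R ^ (α - σ₁) * (R ^ (α - (n : ℝ)) * M R) ^ q) ≤ u x := by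
    refine ⟨d * 4 ^ (α - (n : ℝ)) * (d * 4 ^ (α - (n : ℝ))) ^ q * 2 ^ (-σ₁) * ω, by positivity,
      fun {R} hR {x} hx => ?_⟩
    have hP := potential_ge hn hαn hR hvq (fun y => (hvq0 y).le) hx (hiv x)
      (measurableSet_annulus n R) hann
    have ht0 : 0 ≤ d * ((4 * R) ^ (α - (n : ℝ)) * M R) :=
      mul_nonneg hd.le (mul_nonneg (by positivity) hM0)
    have hA := setIntegral_annulus_ge hn hσ₁0 hR (Real.rpow_nonneg ht0 q)
      (fun y hy => Real.rpow_le_rpow ht0 (hR2 hR hy) hq.le) hP.1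
    refine le_trans (le_of_eq ?_) ((mul_le_mul_of_nonneg_left
      ((mul_le_mul_of_nonneg_left hA (by positivity)).trans hP.2) hd.le).trans (hub x))
    have e1 : d * ((4 * R) ^ (α - (n : ℝ)) * M R)
        = (d * 4 ^ (α - (n : ℝ))) * (R ^ (α - (n : ℝ)) * M R) := by
      rw [Real.mul_rpow (by norm_num) hR.le]; ring
    have e2 : R ^ (α - σ₁) = R ^ (α - (n : ℝ)) * R ^ (-σ₁) * R ^ n := by
      rw [← Real.rpow_natCast, ← Real.rpow_add hR, ← Real.rpow_add hR]
      congr 1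
      ring
    rw [e1, Real.mul_rpow (by positivity) (mul_nonneg (by positivity) hM0),
      Real.mul_rpow (by norm_num) hR.le, Real.mul_rpow (by norm_num) hR.le, e2]
    ring
  obtain ⟨c₁, hc₁, hu2⟩ := hu2
  have hIu : ∀ {R : ℝ}, 0 < R → ∀ {S : Set (EuclideanSpace ℝ (Fin n))}, MeasurableSet S →
      S ⊆ Metric.closedBall 0 (2 * R) → IntegrableOn (fun y => u y ^ p * ‖y‖ ^ (-σ₂)) S :=
    fun {R} hR {S} hS hSR => (potential_ge hn hαn hR hup (fun y => (hup0 y).le)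
      (x := 0) (by simpa using hR.le) (hiu 0) hS hSR).1
  have hMsplit : ∀ {R : ℝ}, 0 < R →
      M (2 * R) = M R + ∫ y in annulus n R, u y ^ p * ‖y‖ ^ (-σ₂) := fun {R} hR => by
    have hsub : Metric.closedBall (0 : EuclideanSpace ℝ (Fin n)) R
        ⊆ Metric.closedBall 0 (2 * R) := Metric.closedBall_subset_closedBall (by linarith)
    rw [annulus, setIntegral_sdiff Metric.isClosed_closedBall.measurableSet
      (hIu hR Metric.isClosed_closedBall.measurableSet subset_rfl) hsub]
    simp only [hM]
    ring
  have hMpos : ∀ {R : ℝ}, 0 < R → 0 < M R := fun {R} hR => by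
    obtain ⟨z, -, hz⟩ := (isCompact_closedBall (0 : EuclideanSpace ℝ (Fin n)) R).exists_isMinOn
      ⟨0, by simpa using hR.le⟩ hup.continuousOn
    have hR' : 0 < R / 2 := by positivity
    have e : 2 * (R / 2) = R := by ring
    have h1 := setIntegral_annulus_ge (w := fun y => u y ^ p) hn hσ₂0 hR' (hup0 z).le
      (fun y hy => hz (by simpa [e] using hy)) (hIu hR' (measurableSet_annulus n _) hann)
    have h2 := hMsplit hR'
    have h3 : 0 < u z ^ p * (2 * (R / 2)) ^ (-σ₂) * ((R / 2) ^ n * ω) := by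
      have := hup0 z
      positivity
    rw [e] at h2
    have h4 : 0 ≤ M (R / 2) := hM0
    linarith
  have hrec : ∃ c₂ > 0, ∀ {R : ℝ}, 0 < R →
      M R + c₂ * R ^ ((α * (p + 1) - (σ₂ + σ₁ * p)) + (1 - p * q) * ((n : ℝ) - α))
        * M R ^ (p * q) ≤ M (2 * R) := by
    refine ⟨c₁ ^ p * 2 ^ (-σ₂) * ω, by positivity, fun {R} hR => ?_⟩
    have hMR := hMpos hR
    have ht0 : 0 ≤ c₁ * (R ^ (α - σ₁) * (R ^ (α - (n : ℝ)) * M R) ^ q) := by positivity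
    have hA := setIntegral_annulus_ge (w := fun y => u y ^ p) hn hσ₂0 hR (Real.rpow_nonneg ht0 p)
      (fun y hy => Real.rpow_le_rpow ht0 (hu2 hR hy) hp.le)
      (hIu hR (measurableSet_annulus n R) hann)
    rw [hMsplit hR]
    refine add_le_add le_rfl (le_trans (le_of_eq ?_) hA)
    have e : R ^ ((α * (p + 1) - (σ₂ + σ₁ * p)) + (1 - p * q) * ((n : ℝ) - α))
        = R ^ ((α - σ₁) * p) * R ^ ((α - (n : ℝ)) * (q * p)) * R ^ (-σ₂) * R ^ n := by
      rw [← Real.rpow_natCast, ← Real.rpow_add hR, ← Real.rpow_add hR, ← Real.rpow_add hR]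
      congr 1
      ring
    rw [Real.mul_rpow hc₁.le (by positivity), Real.mul_rpow (by positivity) (by positivity),
      ← Real.rpow_mul hR.le, ← Real.rpow_mul (by positivity),
      Real.mul_rpow (by positivity) hMR.le, ← Real.rpow_mul hR.le,
      Real.mul_rpow (by norm_num) hR.le, e, mul_comm p q]
    ring
  obtain ⟨c₂, hc₂, hrec⟩ := hrec
  obtain ⟨κ, hκ, k₀, hgrow⟩ := eventually_ge_of_recursion (m := fun k => M (2 ^ k))
    (A := α * (p + 1) - (σ₂ + σ₁ * p)) (b := (n : ℝ) - α) (s := p * q)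
    (fun k => hMpos (by positivity)) hc₂ (by nlinarith)
    (hcond.imp id fun h => ⟨h.1, by linarith [h.2]⟩) (by positivity)
    (fun k => by
      rw [pow_succ']
      exact hrec (by positivity))
  have hlim : Filter.Tendsto (fun k : ℕ => c₁ * κ ^ q * ((2 : ℝ) ^ k) ^ (α - σ₁))
      Filter.atTop Filter.atTop :=
    ((tendsto_rpow_atTop (by linarith)).comp
      (tendsto_pow_atTop_atTop_of_one_lt one_lt_two)).const_mul_atTop (by positivity)
  obtain ⟨k, hk, hk0⟩ :=
    ((hlim.eventually_gt_atTop (u 0)).and (Filter.eventually_ge_atTop k₀)).exists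
  have hRk : (0 : ℝ) < 2 ^ k := by positivity
  have h1 : κ ≤ ((2 : ℝ) ^ k) ^ (α - (n : ℝ)) * M (2 ^ k) := by
    calc κ = ((2 : ℝ) ^ k) ^ (α - (n : ℝ)) * (κ * ((2 : ℝ) ^ k) ^ ((n : ℝ) - α)) := by
          rw [mul_left_comm, ← Real.rpow_add hRk]
          simp
      _ ≤ _ := mul_le_mul_of_nonneg_left (hgrow k hk0) (by positivity)
  have h2 := hu2 hRk (x := 0) (by simp)
  have h3 : κ ^ q ≤ (((2 : ℝ) ^ k) ^ (α - (n : ℝ)) * M (2 ^ k)) ^ q :=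
    Real.rpow_le_rpow hκ.le h1 hq.le
  have h4 : c₁ * κ ^ q * ((2 : ℝ) ^ k) ^ (α - σ₁)
      ≤ c₁ * (((2 : ℝ) ^ k) ^ (α - σ₁) * (((2 : ℝ) ^ k) ^ (α - (n : ℝ)) * M (2 ^ k)) ^ q) := by
    calc _ = c₁ * (((2 : ℝ) ^ k) ^ (α - σ₁) * κ ^ q) := by ring
      _ ≤ _ := by gcongr
  linarith

theorem stmt_1 (n : ℕ) (hn : 3 ≤ n) (α σ₁ σ₂ p q : ℝ)
    (hα₀ : 0 < α) (hαn : α < n)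
    (hσ₁0 : 0 ≤ σ₁) (hσ₁α : σ₁ < α) (hσ₂0 : 0 ≤ σ₂) (hσ₂α : σ₂ < α)
    (hp : 0 < p) (hq : 0 < q)
    (hcond : p * q ≤ 1 ∨
      (1 < p * q ∧
        (n : ℝ) - α ≤ max ((α * (q + 1) - (σ₁ + σ₂ * q)) / (p * q - 1))
                        ((α * (p + 1) - (σ₂ + σ₁ * p)) / (p * q - 1))))
    (c₁ c₂ : EuclideanSpace ℝ (Fin n) → ℝ)
    (hc₁ : DoubleBounded c₁) (hc₂ : DoubleBounded c₂) :
    ¬ ∃ u v : EuclideanSpace ℝ (Fin n) → ℝ,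
      Continuous u ∧ Continuous v ∧ (∀ x, 0 < u x) ∧ (∀ x, 0 < v x) ∧
      ∀ x : EuclideanSpace ℝ (Fin n),
        Integrable (fun y => v y ^ q * ‖x - y‖ ^ (α - (n : ℝ)) * ‖y‖ ^ (-σ₁)) ∧
        Integrable (fun y => u y ^ p * ‖x - y‖ ^ (α - (n : ℝ)) * ‖y‖ ^ (-σ₂)) ∧
        u x = c₁ x * (∫ y, v y ^ q * ‖x - y‖ ^ (α - (n : ℝ)) * ‖y‖ ^ (-σ₁)) ∧
        v x = c₂ x * (∫ y, u y ^ p * ‖x - y‖ ^ (α - (n : ℝ)) * ‖y‖ ^ (-σ₂)) := by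
  rintro ⟨u, v, hu, hv, hu0, hv0, h⟩
  obtain ⟨d₁, hd₁, hb₁⟩ := hc₁.exists_pos_le
  obtain ⟨d₂, hd₂, hb₂⟩ := hc₂.exists_pos_le
  have hn1 : 1 ≤ n := by omega
  have hd : 0 < min d₁ d₂ := lt_min hd₁ hd₂
  have hub : ∀ x, min d₁ d₂ * (∫ y, v y ^ q * ‖x - y‖ ^ (α - (n : ℝ)) * ‖y‖ ^ (-σ₁)) ≤ u x :=
    fun x => by
      rw [(h x).2.2.1]
      exact mul_le_mul_of_nonneg_right ((min_le_left _ _).trans (hb₁ x)) (integral_nonneg fun y =>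
        mul_nonneg (mul_nonneg (Real.rpow_nonneg (hv0 y).le q) (by positivity)) (by positivity))
  have hvb : ∀ x, min d₁ d₂ * (∫ y, u y ^ p * ‖x - y‖ ^ (α - (n : ℝ)) * ‖y‖ ^ (-σ₂)) ≤ v x :=
    fun x => by
      rw [(h x).2.2.2]
      exact mul_le_mul_of_nonneg_right ((min_le_right _ _).trans (hb₂ x)) (integral_nonneg fun y =>
        mul_nonneg (mul_nonneg (Real.rpow_nonneg (hu0 y).le p) (by positivity)) (by positivity))
  have of_v : (p * q ≤ 1 ∨ (1 < p * q ∧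
      ((n : ℝ) - α) * (p * q - 1) ≤ α * (p + 1) - (σ₂ + σ₁ * p))) → False := fun hc =>
    no_positive_supersolution hn1 hαn hσ₁0 hσ₁α hσ₂0 hσ₂α hp hq hc hd hu hv hu0 hv0
      (fun x => (h x).1) (fun x => (h x).2.1) hub hvb
  have of_u : (q * p ≤ 1 ∨ (1 < q * p ∧
      ((n : ℝ) - α) * (q * p - 1) ≤ α * (q + 1) - (σ₁ + σ₂ * q))) → False := fun hc =>
    no_positive_supersolution hn1 hαn hσ₂0 hσ₂α hσ₁0 hσ₁α hq hp hc hd hv hu hv0 hu0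
      (fun x => (h x).2.1) (fun x => (h x).1) hvb hub
  rcases hcond with hpq | ⟨hpq, hmax⟩
  · exact of_v (Or.inl hpq)
  · have hpos : 0 < p * q - 1 := by linarith
    rcases le_max_iff.mp hmax with hle | hle
    · rw [le_div_iff₀ hpos, mul_comm p q] at hle
      exact of_u (Or.inr ⟨by rwa [mul_comm q p], hle⟩)
    · rw [le_div_iff₀ hpos] at hle
      exact of_v (Or.inr ⟨hpq, hle⟩)
end
end

section
/- Let n ≥ 3, α ∈ (0,n), σ₁, σ₂ ∈ [0,α) and p, q > 0 with pq > 1, and assume max{ (α(q+1) − (σ₁ + σ₂q))/(pq−1) , (α(p+1) − (σ₂ + σ₁p))/(pq−1) } < n − α. Define θ₁, θ₂ by 2θ₁ = (α(1+q) − (σ₁ + σ₂q))/(pq−1) and 2θ₂ = (α(1+p) − (σ₂ + σ₁p))/(pq−1), and set u(x) = (1+|x|²)^{−θ₁} and v(x) = (1+|x|²)^{−θ₂}. Then there exists a constant C > 0 such that for every x ∈ ℝⁿ the integral ∫_{ℝⁿ} v(y)^q |x−y|^{α−n} |y|^{−σ₁} dy is finite and (1/C)·u(x) ≤ ∫_{ℝⁿ}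 v(y)^q |x−y|^{α−n} |y|^{−σ₁} dy ≤ C·u(x). -/
open MeasureTheory

noncomputable section

section RadialPower

variable {E : Type*} [NormedAddCommGroup E] [NormedSpace ℝ E] [FiniteDimensional ℝ E]
  [Nontrivial E] [MeasurableSpace E] (μ : Measure E) [μ.IsAddHaarMeasure]

open Module (finrank)

lemma finrank_mul_measureReal_ball_pos :
    0 < (finrank ℝ E : ℝ) * μ.real (Metric.ball (0 : E) 1) :=
  mul_pos (Nat.cast_pos.2 Module.finrank_pos)
    (ENNReal.toReal_pos (Metric.measure_ball_pos μ 0 one_pos).ne' measure_ball_lt_top.ne)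

lemma pow_smul_indicator_rpow_eqOn_Ioi (d : ℕ) (hd : 0 < d) (S : Set ℝ) (a : ℝ) :
    Set.EqOn (fun t : ℝ ↦ t ^ (d - 1) • S.indicator (fun t ↦ t ^ (-a)) t)
      (S.indicator fun t ↦ t ^ ((d : ℝ) - a - 1)) (Set.Ioi 0) := by
  intro t ht
  have ht' : (0 : ℝ) < t := ht
  by_cases hS : t ∈ S
  · simp only [Set.indicator_of_mem hS, smul_eq_mul]
    rw [← Real.rpow_natCast, ← Real.rpow_add ht', Nat.cast_pred hd]
    ring_nf
  · simp [Set.indicator_of_notMem hS]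

variable [BorelSpace E]

lemma integrable_indicator_norm_rpow {S : Set ℝ} (hS : MeasurableSet S) {a : ℝ}
    (h : IntegrableOn (fun t : ℝ ↦ t ^ ((finrank ℝ E : ℝ) - a - 1)) (S ∩ Set.Ioi 0)) :
    Integrable (fun y : E ↦ S.indicator (fun t : ℝ ↦ t ^ (-a)) ‖y‖) μ := by
  rw [integrable_fun_norm_addHaar μ (f := S.indicator fun t : ℝ ↦ t ^ (-a)),
    integrableOn_congr_fun
      (pow_smul_indicator_rpow_eqOn_Ioi _ Module.finrank_pos S a) measurableSet_Ioi,
    IntegrableOn, integrable_indicator_iff hS, IntegrableOn, Measure.restrict_restrict hS]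
  exact h

lemma integral_indicator_norm_rpow {S : Set ℝ} (hS : MeasurableSet S) (a : ℝ) :
    ∫ y : E, S.indicator (fun t : ℝ ↦ t ^ (-a)) ‖y‖ ∂μ =
      finrank ℝ E * μ.real (Metric.ball 0 1) *
        ∫ t in S ∩ Set.Ioi 0, t ^ ((finrank ℝ E : ℝ) - a - 1) := by
  rw [integral_fun_norm_addHaar μ (S.indicator fun t : ℝ ↦ t ^ (-a)),
    setIntegral_congr_fun measurableSet_Ioi
      (pow_smul_indicator_rpow_eqOn_Ioi _ Module.finrank_pos S a),
    integral_indicator hS, Measure.restrict_restrict hS, nsmul_eq_mul, smul_eq_mul, mul_assoc]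

/-- A power of the norm weaker than critical is integrable on closed balls about the origin,
with an integral that scales like a power of the radius. -/
lemma exists_integral_norm_rpow_Iic {a : ℝ} (ha : a < finrank ℝ E) :
    ∃ c : ℝ, 0 < c ∧ ∀ r : ℝ, 0 < r →
      Integrable (fun y : E ↦ (Set.Iic r).indicator (fun t : ℝ ↦ t ^ (-a)) ‖y‖) μ ∧
      ∫ y : E, (Set.Iic r).indicator (fun t : ℝ ↦ t ^ (-a)) ‖y‖ ∂μ =
        c * r ^ ((finrank ℝ E : ℝ) - a) := by
  have hpos : 0 < (finrank ℝ E : ℝ) - a := sub_pos.2 ha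
  refine ⟨finrank ℝ E * μ.real (Metric.ball 0 1) / ((finrank ℝ E : ℝ) - a),
    div_pos (finrank_mul_measureReal_ball_pos μ) hpos, fun r hr ↦ ?_⟩
  have hset : Set.Iic r ∩ Set.Ioi 0 = Set.Ioc 0 r := Set.Iic_inter_Ioi
  refine ⟨integrable_indicator_norm_rpow μ measurableSet_Iic ?_, ?_⟩
  · rw [hset, ← intervalIntegrable_iff_integrableOn_Ioc_of_le hr.le]
    exact intervalIntegral.intervalIntegrable_rpow' (by linarith)
  · rw [integral_indicator_norm_rpow μ measurableSet_Iic, hset,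
      ← intervalIntegral.integral_of_le hr.le, integral_rpow (Or.inl (by linarith)),
      sub_add_cancel, Real.zero_rpow hpos.ne']
    ring

/-- A power of the norm stronger than critical is integrable away from the origin, with an
integral that scales like a power of the radius. -/
lemma exists_integral_norm_rpow_Ioi {a : ℝ} (ha : finrank ℝ E < a) :
    ∃ c : ℝ, 0 < c ∧ ∀ r : ℝ, 0 < r →
      Integrable (fun y : E ↦ (Set.Ioi r).indicator (fun t : ℝ ↦ t ^ (-a)) ‖y‖) μ ∧
      ∫ y : E, (Set.Ioi r).indicator (fun t : ℝ ↦ t ^ (-a)) ‖y‖ ∂μ =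
        c * r ^ ((finrank ℝ E : ℝ) - a) := by
  have hpos : 0 < a - (finrank ℝ E : ℝ) := sub_pos.2 ha
  refine ⟨finrank ℝ E * μ.real (Metric.ball 0 1) / (a - (finrank ℝ E : ℝ)),
    div_pos (finrank_mul_measureReal_ball_pos μ) hpos, fun r hr ↦ ?_⟩
  have hset : Set.Ioi r ∩ Set.Ioi 0 = Set.Ioi r :=
    Set.inter_eq_left.2 (Set.Ioi_subset_Ioi hr.le)
  refine ⟨integrable_indicator_norm_rpow μ measurableSet_Ioi ?_, ?_⟩
  · rw [hset]
    exact integrableOn_Ioi_rpow_of_lt (by linarith) hr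
  · rw [integral_indicator_norm_rpow μ measurableSet_Ioi, hset,
      integral_Ioi_rpow_of_lt (by linarith) hr, sub_add_cancel,
      ← neg_sub a (finrank ℝ E : ℝ), neg_div_neg_eq]
    ring

end RadialPower

/-- The product of two negative powers is controlled by the power of combined order of the
smaller base. -/
lemma rpow_neg_mul_rpow_neg_le_add {a b k l : ℝ} (ha : 0 < a) (hb : 0 < b) (hk : 0 ≤ k)
    (hl : 0 ≤ l) : a ^ (-k) * b ^ (-l) ≤ a ^ (-(k + l)) + b ^ (-(k + l)) := by
  rw [neg_add, Real.rpow_add ha, Real.rpow_add hb]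
  have hak := Real.rpow_nonneg ha.le (-k)
  have hal := Real.rpow_nonneg ha.le (-l)
  have hbk := Real.rpow_nonneg hb.le (-k)
  have hbl := Real.rpow_nonneg hb.le (-l)
  rcases le_total a b with h | h
  · have := Real.rpow_le_rpow_of_nonpos ha h (neg_nonpos.2 hl)
    nlinarith [mul_le_mul_of_nonneg_left this hak, mul_nonneg hbk hbl]
  · have := Real.rpow_le_rpow_of_nonpos hb h (neg_nonpos.2 hk)
    nlinarith [mul_le_mul_of_nonneg_right this hbl, mul_nonneg hak hal]

lemma rpow_neg_half_one_add_sq_le {a s : ℝ} (ha : 0 < a) (hs : 0 ≤ s) :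
    (1 + a ^ 2) ^ (-(s / 2)) ≤ a ^ (-s) := by
  calc (1 + a ^ 2) ^ (-(s / 2)) ≤ (a ^ 2) ^ (-(s / 2)) :=
        Real.rpow_le_rpow_of_nonpos (by positivity) (by linarith) (by linarith)
    _ = a ^ (-s) := by
        rw [← Real.rpow_natCast, ← Real.rpow_mul ha.le]
        congr 1
        push_cast
        ring

/-- Pointwise majorant of the weighted Riesz kernel: `a`, `b`, `R` stand for `‖y‖`, `‖x - y‖`
and `√(1 + ‖x‖ ^ 2)`. -/
lemma weighted_kernel_le {a b X R s σ k : ℝ} (ha : 0 < a) (hb : 0 < b)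
    (hR : 1 ≤ R) (hXR : X ≤ R) (hRX : R ≤ 1 + X)
    (hXab : X ≤ a + b) (haXb : a ≤ X + b) (hs : 0 ≤ s) (hσ : 0 ≤ σ) (hk : 0 ≤ k) :
    (1 + a ^ 2) ^ (-(s / 2)) * b ^ (-k) * a ^ (-σ) ≤ (2 ^ s + 4 ^ k) *
      ((Set.Ioi (2 * R)).indicator (fun t : ℝ ↦ t ^ (-(s + σ + k))) a +
        R ^ (-k) * (Set.Iic (2 * R)).indicator (fun t : ℝ ↦ t ^ (-(s + σ))) a +
        R ^ (-s) * (Set.Iic (2 * R)).indicator (fun t : ℝ ↦ t ^ (-(σ + k))) a +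
        R ^ (-s) * (Set.Iic (2 * R)).indicator (fun t : ℝ ↦ t ^ (-(σ + k))) b) := by
  have hR0 : 0 < R := by linarith
  set C : ℝ := 2 ^ s + 4 ^ k
  have h2C : (2 : ℝ) ^ s ≤ C := le_add_of_nonneg_right (by positivity)
  have h4C : (4 : ℝ) ^ k ≤ C := le_add_of_nonneg_left (by positivity)
  have hC0 : 0 ≤ C := by positivity
  have hind : ∀ (S : Set ℝ) (e t : ℝ), 0 < t → 0 ≤ S.indicator (fun t : ℝ ↦ t ^ e) t :=
    fun S e t ht ↦ Set.indicator_apply_nonneg fun _ ↦ Real.rpow_nonneg ht.le _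
  have hscale : ∀ t : ℝ, 0 < t → (t / 4) ^ (-k) = 4 ^ k * t ^ (-k) := fun t ht ↦ by
    rw [Real.div_rpow ht.le (by norm_num), Real.rpow_neg (by norm_num : (0 : ℝ) ≤ 4),
      div_inv_eq_mul, mul_comm]
  have hw := rpow_neg_half_one_add_sq_le ha hs
  have n1 := hind (Set.Ioi (2 * R)) (-(s + σ + k)) a ha
  have n2 := mul_nonneg (Real.rpow_nonneg hR0.le (-k))
    (hind (Set.Iic (2 * R)) (-(s + σ)) a ha)
  have n3 := mul_nonneg (Real.rpow_nonneg hR0.le (-s))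
    (hind (Set.Iic (2 * R)) (-(σ + k)) a ha)
  have n4 := mul_nonneg (Real.rpow_nonneg hR0.le (-s))
    (hind (Set.Iic (2 * R)) (-(σ + k)) b hb)
  rcases lt_or_ge (2 * R) a with hfar | hnear
  · have hbk : b ^ (-k) ≤ 4 ^ k * a ^ (-k) := by
      rw [← hscale a ha]
      exact Real.rpow_le_rpow_of_nonpos (by positivity) (by linarith) (by linarith)
    calc (1 + a ^ 2) ^ (-(s / 2)) * b ^ (-k) * a ^ (-σ)
        ≤ a ^ (-s) * (C * a ^ (-k)) * a ^ (-σ) := by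
          gcongr
          exact hbk.trans (by gcongr)
      _ = C * (Set.Ioi (2 * R)).indicator (fun t : ℝ ↦ t ^ (-(s + σ + k))) a := by
          rw [Set.indicator_of_mem (Set.mem_Ioi.2 hfar),
            show -(s + σ + k) = -s + -σ + -k by ring, Real.rpow_add ha, Real.rpow_add ha]
          ring
      _ ≤ _ := mul_le_mul_of_nonneg_left (by linarith) hC0
  · rcases le_or_gt (R / 4) b with hb4 | hb4
    · have hbk : b ^ (-k) ≤ 4 ^ k * R ^ (-k) := by
        rw [← hscale R hR0]
        exact Real.rpow_le_rpow_of_nonpos (by positivity) hb4 (by linarith)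
      calc (1 + a ^ 2) ^ (-(s / 2)) * b ^ (-k) * a ^ (-σ)
          ≤ a ^ (-s) * (C * R ^ (-k)) * a ^ (-σ) := by
            gcongr
            exact hbk.trans (by gcongr)
        _ = C * (R ^ (-k) * (Set.Iic (2 * R)).indicator (fun t : ℝ ↦ t ^ (-(s + σ))) a) := by
            rw [Set.indicator_of_mem (Set.mem_Iic.2 hnear), neg_add, Real.rpow_add ha]
            ring
        _ ≤ _ := mul_le_mul_of_nonneg_left (by linarith) hC0
    · have hwR : (1 + a ^ 2) ^ (-(s / 2)) ≤ 2 ^ s * R ^ (-s) := by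
        have hsq : (R / 2) ^ 2 ≤ 1 + a ^ 2 := by
          nlinarith [sq_nonneg (1 - a)]
        calc (1 + a ^ 2) ^ (-(s / 2)) ≤ ((R / 2) ^ 2) ^ (-(s / 2)) :=
              Real.rpow_le_rpow_of_nonpos (by positivity) hsq (by linarith)
          _ = (R / 2) ^ (-s) := by
              rw [← Real.rpow_natCast, ← Real.rpow_mul (by positivity)]
              congr 1
              push_cast
              ring
          _ = 2 ^ s * R ^ (-s) := by
              rw [Real.div_rpow hR0.le (by norm_num), Real.rpow_neg (by norm_num : (0 : ℝ) ≤ 2),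
                div_inv_eq_mul, mul_comm]
      calc (1 + a ^ 2) ^ (-(s / 2)) * b ^ (-k) * a ^ (-σ)
          = (1 + a ^ 2) ^ (-(s / 2)) * (a ^ (-σ) * b ^ (-k)) := by ring
        _ ≤ (C * R ^ (-s)) * (a ^ (-(σ + k)) + b ^ (-(σ + k))) := by
            gcongr
            · exact hwR.trans (by gcongr)
            · exact rpow_neg_mul_rpow_neg_le_add ha hb hσ hk
        _ = C * (R ^ (-s) * (Set.Iic (2 * R)).indicator (fun t : ℝ ↦ t ^ (-(σ + k))) a +
              R ^ (-s) * (Set.Iic (2 * R)).indicator (fun t : ℝ ↦ t ^ (-(σ + k))) b) := by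
            rw [Set.indicator_of_mem (Set.mem_Iic.2 hnear),
              Set.indicator_of_mem (Set.mem_Iic.2 (by linarith : b ≤ 2 * R))]
            ring
        _ ≤ _ := mul_le_mul_of_nonneg_left (by linarith) hC0

/-- Pointwise minorant of the weighted Riesz kernel on the ball of radius `R`. -/
lemma le_weighted_kernel {a b X R s σ k : ℝ} (ha : 0 < a) (hb : 0 < b)
    (hR : 1 ≤ R) (hXR : X ≤ R) (hbXa : b ≤ X + a) (hs : 0 ≤ s) (hσ : 0 ≤ σ) (hk : 0 ≤ k) :
    2 ^ (-(s + k)) * R ^ (-(s + σ + k)) *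
        (Set.Iic R).indicator (fun t : ℝ ↦ t ^ (-(0 : ℝ))) a ≤
      (1 + a ^ 2) ^ (-(s / 2)) * b ^ (-k) * a ^ (-σ) := by
  have hR0 : 0 < R := by linarith
  by_cases haR : a ∈ Set.Iic R
  · have haR' : a ≤ R := haR
    rw [Set.indicator_of_mem haR, neg_zero, Real.rpow_zero, mul_one]
    have hw : (2 * R) ^ (-s) ≤ (1 + a ^ 2) ^ (-(s / 2)) := by
      calc (2 * R) ^ (-s) = ((2 * R) ^ 2) ^ (-(s / 2)) := by
            rw [← Real.rpow_natCast, ← Real.rpow_mul (by positivity)]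
            congr 1
            push_cast
            ring
        _ ≤ _ := Real.rpow_le_rpow_of_nonpos (by positivity) (by nlinarith) (by linarith)
    have hbk : (2 * R) ^ (-k) ≤ b ^ (-k) :=
      Real.rpow_le_rpow_of_nonpos hb (by linarith) (by linarith)
    have haσ : R ^ (-σ) ≤ a ^ (-σ) := Real.rpow_le_rpow_of_nonpos ha haR' (by linarith)
    calc 2 ^ (-(s + k)) * R ^ (-(s + σ + k)) = (2 * R) ^ (-s) * (2 * R) ^ (-k) * R ^ (-σ) := by
          rw [Real.mul_rpow (by norm_num) hR0.le, Real.mul_rpow (by norm_num) hR0.le, neg_add,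
            Real.rpow_add (by norm_num), show -(s + σ + k) = -s + -σ + -k by ring,
            Real.rpow_add hR0, Real.rpow_add hR0]
          ring
      _ ≤ _ := by gcongr
  · rw [Set.indicator_of_notMem haR, mul_zero]
    positivity

section WeightedRieszPotential

variable {E : Type*} [NormedAddCommGroup E] [NormedSpace ℝ E] [FiniteDimensional ℝ E]
  [Nontrivial E] [MeasurableSpace E] [BorelSpace E] (μ : Measure E) [μ.IsAddHaarMeasure]

open Module (finrank)

/-- The Riesz potential of order `finrank ℝ E - k` of the density
`(1 + ‖y‖ ^ 2) ^ (-(s / 2)) * ‖y‖ ^ (-σ)` has exact decay of order `s + σ + k - finrank ℝ E`. -/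
theorem exists_weighted_riesz_potential_bounds {s σ k : ℝ} (hs : 0 ≤ s) (hσ : 0 ≤ σ)
    (hk : 0 ≤ k) (hloc : s + σ < finrank ℝ E) (hsing : σ + k < finrank ℝ E)
    (hdecay : finrank ℝ E < s + σ + k) :
    ∃ C : ℝ, 0 < C ∧ ∀ x : E,
      Integrable (fun y ↦ (1 + ‖y‖ ^ 2) ^ (-(s / 2)) * ‖x - y‖ ^ (-k) * ‖y‖ ^ (-σ)) μ ∧
      1 / C * (1 + ‖x‖ ^ 2) ^ (-((s + σ + k - finrank ℝ E) / 2)) ≤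
        ∫ y, (1 + ‖y‖ ^ 2) ^ (-(s / 2)) * ‖x - y‖ ^ (-k) * ‖y‖ ^ (-σ) ∂μ ∧
      ∫ y, (1 + ‖y‖ ^ 2) ^ (-(s / 2)) * ‖x - y‖ ^ (-k) * ‖y‖ ^ (-σ) ∂μ ≤
        C * (1 + ‖x‖ ^ 2) ^ (-((s + σ + k - finrank ℝ E) / 2)) := by
  obtain ⟨c₀, hc₀, h₀⟩ := exists_integral_norm_rpow_Iic μ (E := E) (a := 0)
    (Nat.cast_pos.2 Module.finrank_pos)
  obtain ⟨c₁, hc₁, h₁⟩ := exists_integral_norm_rpow_Ioi μ hdecay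
  obtain ⟨c₂, hc₂, h₂⟩ := exists_integral_norm_rpow_Iic μ hloc
  obtain ⟨c₃, hc₃, h₃⟩ := exists_integral_norm_rpow_Iic μ hsing
  set d : ℝ := (finrank ℝ E : ℝ)
  set A : ℝ := (2 ^ s + 4 ^ k) * (c₁ * 2 ^ (d - (s + σ + k)) + c₂ * 2 ^ (d - (s + σ)) +
    2 * (c₃ * 2 ^ (d - (σ + k)))) with hA
  set B : ℝ := 2 ^ (-(s + k)) * c₀ with hB
  have hA0 : 0 < A := by positivity
  have hB0 : 0 < B := by positivity
  refine ⟨A + 1 / B, by positivity, fun x ↦ ?_⟩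
  set R : ℝ := √(1 + ‖x‖ ^ 2)
  have hRsq : R ^ 2 = 1 + ‖x‖ ^ 2 := Real.sq_sqrt (by positivity)
  have hRnn : 0 ≤ R := Real.sqrt_nonneg _
  have hx0 := norm_nonneg x
  have hR1 : 1 ≤ R := by nlinarith
  have hXR : ‖x‖ ≤ R := by nlinarith
  have hRX : R ≤ 1 + ‖x‖ := by nlinarith
  have hR0 : 0 < R := by linarith
  have hdec : (1 + ‖x‖ ^ 2) ^ (-((s + σ + k - d) / 2)) = R ^ (d - (s + σ + k)) := by
    rw [← hRsq, ← Real.rpow_natCast, ← Real.rpow_mul hRnn]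
    congr 1
    push_cast
    ring
  rw [hdec]
  set f : E → ℝ := fun y ↦ (1 + ‖y‖ ^ 2) ^ (-(s / 2)) * ‖x - y‖ ^ (-k) * ‖y‖ ^ (-σ)
  have hmeas : AEStronglyMeasurable f μ := by
    have : Measurable f := by fun_prop
    exact this.aestronglyMeasurable
  have hne : ∀ᵐ y ∂μ, 0 < ‖y‖ ∧ 0 < ‖x - y‖ := by
    filter_upwards [Measure.ae_ne μ 0, Measure.ae_ne μ x] with y hy hyx
    exact ⟨norm_pos_iff.2 hy, norm_pos_iff.2 (sub_ne_zero.2 hyx.symm)⟩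
  obtain ⟨i₁, e₁⟩ := h₁ (2 * R) (by positivity)
  obtain ⟨i₂, e₂⟩ := h₂ (2 * R) (by positivity)
  obtain ⟨i₃, e₃⟩ := h₃ (2 * R) (by positivity)
  have i₄ := i₃.comp_sub_left x
  have e₄ := (integral_sub_left_eq_self
    (fun y : E ↦ (Set.Iic (2 * R)).indicator (fun t : ℝ ↦ t ^ (-(σ + k))) ‖y‖) μ x).trans e₃
  have j₁₂ := i₁.add (i₂.const_mul (R ^ (-k)))
  have j₁₃ := j₁₂.add (i₃.const_mul (R ^ (-s)))
  have j₁₄ := (j₁₃.add (i₄.const_mul (R ^ (-s)))).const_mul (2 ^ s + 4 ^ k)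
  have hle := hne.mono fun y hy ↦ weighted_kernel_le hy.1 hy.2 hR1 hXR hRX
    (by simpa [add_comm] using norm_add_le (x - y) y)
    (by simpa using norm_sub_le x (x - y)) hs hσ hk
  have hf0 : ∀ y, 0 ≤ f y := fun y ↦ by positivity
  have hint : Integrable f μ := by
    refine j₁₄.mono' hmeas ?_
    filter_upwards [hle] with y hy
    rw [Real.norm_of_nonneg (hf0 y)]
    exact hy
  have hpow : ∀ e e' : ℝ, R ^ e * (2 * R) ^ e' = 2 ^ e' * R ^ (e + e') := fun e e' ↦ by
    rw [Real.mul_rpow (by norm_num) hRnn, Real.rpow_add hR0]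
    ring
  have hRτ : 0 < R ^ (d - (s + σ + k)) := by positivity
  refine ⟨hint, ?_, ?_⟩
  · obtain ⟨i₀, e₀⟩ := h₀ R hR0
    have hlow := integral_mono_ae (i₀.const_mul (2 ^ (-(s + k)) * R ^ (-(s + σ + k)))) hint
      (by
        filter_upwards [hne] with y hy
        exact le_weighted_kernel hy.1 hy.2 hR1 hXR (norm_sub_le x y) hs hσ hk)
    rw [integral_const_mul, e₀] at hlow
    calc 1 / (A + 1 / B) * R ^ (d - (s + σ + k)) ≤ B * R ^ (d - (s + σ + k)) := by
          gcongr
          rw [div_le_iff₀ (by positivity), mul_add, mul_one_div_cancel hB0.ne']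
          nlinarith
      _ = 2 ^ (-(s + k)) * R ^ (-(s + σ + k)) * (c₀ * R ^ (d - 0)) := by
          rw [hB, show d - (s + σ + k) = -(s + σ + k) + (d - 0) by ring, Real.rpow_add hR0]
          ring
      _ ≤ _ := hlow
  · calc ∫ y, f y ∂μ ≤ _ := integral_mono_ae hint j₁₄ hle
      _ = A * R ^ (d - (s + σ + k)) := by
          rw [integral_const_mul, integral_add' j₁₃ (i₄.const_mul (R ^ (-s))),
            integral_add' j₁₂ (i₃.const_mul (R ^ (-s))),
            integral_add' i₁ (i₂.const_mul (R ^ (-k))),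
            integral_const_mul, integral_const_mul, integral_const_mul, e₁, e₂, e₃, e₄]
          have p₁ := hpow 0 (d - (s + σ + k))
          have p₂ := hpow (-k) (d - (s + σ))
          have p₃ := hpow (-s) (d - (σ + k))
          rw [Real.rpow_zero, one_mul, zero_add] at p₁
          rw [show -k + (d - (s + σ)) = d - (s + σ + k) by ring] at p₂
          rw [show -s + (d - (σ + k)) = d - (s + σ + k) by ring] at p₃
          rw [hA, p₁, mul_left_comm (R ^ (-k)), p₂, mul_left_comm (R ^ (-s)), p₃]
          ring
      _ ≤ (A + 1 / B) * R ^ (d - (s + σ + k)) := by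
          gcongr
          linarith [one_div_pos.2 hB0]

end WeightedRieszPotential

theorem stmt_2 (n : ℕ) (hn : 3 ≤ n) (α σ₁ σ₂ p q θ₁ θ₂ : ℝ)
    (hα₀ : 0 < α) (hαn : α < n)
    (hσ₁0 : 0 ≤ σ₁) (hσ₁α : σ₁ < α) (hσ₂0 : 0 ≤ σ₂) (hσ₂α : σ₂ < α)
    (hp : 0 < p) (hq : 0 < q) (hpq : 1 < p * q)
    (hcrit : max ((α * (q + 1) - (σ₁ + σ₂ * q)) / (p * q - 1))
               ((α * (p + 1) - (σ₂ + σ₁ * p)) / (p * q - 1)) < (n : ℝ) - α)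
    (hθ₁ : 2 * θ₁ = (α * (1 + q) - (σ₁ + σ₂ * q)) / (p * q - 1))
    (hθ₂ : 2 * θ₂ = (α * (1 + p) - (σ₂ + σ₁ * p)) / (p * q - 1))
    (u v : EuclideanSpace ℝ (Fin n) → ℝ)
    (hu : ∀ x, u x = (1 + ‖x‖ ^ 2) ^ (-θ₁))
    (hv : ∀ x, v x = (1 + ‖x‖ ^ 2) ^ (-θ₂)) :
    ∃ C : ℝ, 0 < C ∧ ∀ x : EuclideanSpace ℝ (Fin n),
      Integrable (fun y => v y ^ q * ‖x - y‖ ^ (α - (n : ℝ)) * ‖y‖ ^ (-σ₁)) ∧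
      (1 / C) * u x ≤ (∫ y, v y ^ q * ‖x - y‖ ^ (α - (n : ℝ)) * ‖y‖ ^ (-σ₁)) ∧
      (∫ y, v y ^ q * ‖x - y‖ ^ (α - (n : ℝ)) * ‖y‖ ^ (-σ₁)) ≤ C * u x := by
  have hpq' : 0 < p * q - 1 := by linarith
  have hrel : 2 * θ₂ * q = 2 * θ₁ + (α - σ₁) := by
    rw [hθ₁, hθ₂]
    field_simp
    ring
  have hθ₁pos : 0 < 2 * θ₁ := by
    rw [hθ₁]
    refine div_pos ?_ hpq'
    nlinarith [mul_pos hq (sub_pos.2 hσ₂α)]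
  have hθ₁lt : 2 * θ₁ < n - α := by
    rw [hθ₁, add_comm 1 q]
    exact (le_max_left _ _).trans_lt hcrit
  have : Nonempty (Fin n) := ⟨⟨0, by omega⟩⟩
  have hdim : (Module.finrank ℝ (EuclideanSpace ℝ (Fin n)) : ℝ) = n := by simp
  have key := exists_weighted_riesz_potential_bounds
    (volume : Measure (EuclideanSpace ℝ (Fin n))) (s := 2 * θ₂ * q) (σ := σ₁) (k := n - α)
    (by linarith) hσ₁0 (by linarith) (by linarith) (by linarith) (by linarith)
  have hvq : ∀ y, v y ^ q = (1 + ‖y‖ ^ 2) ^ (-(2 * θ₂ * q / 2)) := fun y ↦ by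
    rw [hv, ← Real.rpow_mul (by positivity)]
    congr 1
    ring
  have hθ : (2 * θ₂ * q + σ₁ + (n - α) - n) / 2 = θ₁ := by linarith
  simpa only [hvq, hu, hdim, hθ, neg_sub] using key
end
end

section
/- Let n ≥ 3, α ∈ (0,n), σ ∈ [0,α) and p > 0 with p > (n−σ)/(n−α). Then there exist a double bounded function c on ℝⁿ and a positive continuous function u on ℝⁿ such that for every x ∈ ℝⁿ the integral ∫_{ℝⁿ} u(y)^p |x−y|^{α−n} |y|^{−σ} dy is finite and u(x) = c(x) ∫_{ℝⁿ} u(y)^p |x−y|^{α−n} |y|^{−σ} dy. -/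
open MeasureTheory

noncomputable section

theorem integrable_norm_rpow_mul_one_add_norm_rpow {E : Type*} [NormedAddCommGroup E]
    [NormedSpace ℝ E] [FiniteDimensional ℝ E] [Nontrivial E] [MeasurableSpace E] [BorelSpace E]
    (μ : Measure E) [μ.IsAddHaarMeasure] {a b : ℝ}
    (ha : a < Module.finrank ℝ E) (hab : Module.finrank ℝ E < a + b) :
    Integrable (fun w : E => ‖w‖ ^ (-a) * (1 + ‖w‖) ^ (-b)) μ := by
  rw [integrable_fun_norm_addHaar μ (f := fun t : ℝ => t ^ (-a) * (1 + t) ^ (-b))]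
  have hd : 0 < Module.finrank ℝ E := Module.finrank_pos
  have hcast : ((Module.finrank ℝ E - 1 : ℕ) : ℝ) = Module.finrank ℝ E - 1 := by
    rw [Nat.cast_sub hd]; simp
  rw [← Set.Ioc_union_Ioi_eq_Ioi (zero_le_one' ℝ)]
  have hmeas : Measurable
      (fun t : ℝ => t ^ (Module.finrank ℝ E - 1) • (t ^ (-a) * (1 + t) ^ (-b))) := by
    fun_prop
  apply IntegrableOn.union
  · have h : IntegrableOn (fun t : ℝ => t ^ ((Module.finrank ℝ E : ℝ) - 1 - a)) (Set.Ioc 0 1) := by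
      rw [← intervalIntegrable_iff_integrableOn_Ioc_of_le zero_le_one]
      exact intervalIntegral.intervalIntegrable_rpow' (by linarith)
    refine Integrable.mono' h hmeas.aestronglyMeasurable ?_
    filter_upwards [ae_restrict_mem measurableSet_Ioc] with t ht
    have ht0 := ht.1
    rw [Real.norm_of_nonneg (by positivity), sub_eq_add_neg _ a, Real.rpow_add ht0, ← hcast,
      Real.rpow_natCast, smul_eq_mul]
    have : (1 + t) ^ (-b) ≤ 1 := Real.rpow_le_one_of_one_le_of_nonpos (by linarith) (by linarith)
    gcongr
    exact mul_le_of_le_one_right (by positivity) this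
  · have h : IntegrableOn (fun t : ℝ => t ^ ((Module.finrank ℝ E : ℝ) - 1 + (-a + -b)))
        (Set.Ioi 1) := integrableOn_Ioi_rpow_of_lt (by linarith) one_pos
    refine Integrable.mono' h hmeas.aestronglyMeasurable ?_
    filter_upwards [ae_restrict_mem measurableSet_Ioi] with t ht
    have ht0 : 0 < t := one_pos.trans ht
    rw [Real.norm_of_nonneg (by positivity), Real.rpow_add ht0, Real.rpow_add ht0, ← hcast,
      Real.rpow_natCast, smul_eq_mul]
    have : (1 + t) ^ (-b) ≤ t ^ (-b) :=
      Real.rpow_le_rpow_of_nonpos ht0 (by linarith) (by linarith)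
    gcongr

/-- Pointwise control of the Riesz kernel `t ^ (-A)` against a decaying density; in the intended
use `s = ‖x‖`, `r = ‖y‖`, `t = ‖x - y‖`. -/
theorem kernel_mul_density_le {A σ m s r t : ℝ} (hA : 0 ≤ A) (hσ : 0 ≤ σ) (hm : 0 ≤ m)
    (hAm : A ≤ m + σ) (hs : 0 ≤ s) (hr : 0 < r) (ht : 0 < t) (hsr : s ≤ t + r)
    (hrs : r ≤ s + t) :
    (1 + r) ^ (-m) * t ^ (-A) * r ^ (-σ) ≤
      4 ^ (A + m + σ) * (1 + s) ^ (-A) *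
        (r ^ (-σ) * (1 + r) ^ (-m) + t ^ (-A) * (1 + t) ^ (-(m + σ - A)) +
          (r ^ (-(A + σ)) * (1 + r) ^ (-m) + t ^ (-(A + σ)) * (1 + t) ^ (-m))) := by
  have hs1 : 0 < 1 + s := by linarith
  have anti : ∀ {x y z : ℝ}, 0 < x → x ≤ y → 0 ≤ z → y ^ (-z) ≤ x ^ (-z) := fun hx hxy hz =>
    Real.rpow_le_rpow_of_nonpos hx hxy (by linarith)
  have four : ∀ {z : ℝ}, z ≤ A + m + σ → (4 : ℝ) ^ z ≤ 4 ^ (A + m + σ) := fun hz =>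
    Real.rpow_le_rpow_of_exponent_le (by norm_num) hz
  have quarter : ∀ z : ℝ, ((1 + s) / 4) ^ (-z) = 4 ^ z * (1 + s) ^ (-z) := fun z => by
    rw [Real.div_rpow hs1.le (by norm_num), Real.rpow_neg (by norm_num : (0 : ℝ) ≤ 4),
      div_inv_eq_mul, mul_comm]
  rcases le_or_gt ((1 + s) / 4) t with hfar | hnear
  · calc (1 + r) ^ (-m) * t ^ (-A) * r ^ (-σ)
        ≤ (1 + r) ^ (-m) * (4 ^ (A + m + σ) * (1 + s) ^ (-A)) * r ^ (-σ) := by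
          have h4 : (4 : ℝ) ^ A ≤ 4 ^ (A + m + σ) := four (by linarith)
          have h : t ^ (-A) ≤ 4 ^ (A + m + σ) * (1 + s) ^ (-A) := by
            refine (anti (by positivity) hfar hA).trans ?_
            rw [quarter]
            gcongr
          gcongr
      _ = 4 ^ (A + m + σ) * (1 + s) ^ (-A) * (r ^ (-σ) * (1 + r) ^ (-m)) := by ring
      _ ≤ _ := by
          gcongr
          rw [add_assoc]
          exact le_add_of_nonneg_right (by positivity)
  rcases le_or_gt 1 s with hlarge | hsmall
  · calc (1 + r) ^ (-m) * t ^ (-A) * r ^ (-σ)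
        ≤ ((1 + s) / 4) ^ (-m) * t ^ (-A) * ((1 + s) / 4) ^ (-σ) := by
          have h1 : (1 + r) ^ (-m) ≤ ((1 + s) / 4) ^ (-m) :=
            anti (by positivity) (by linarith) hm
          have h2 : r ^ (-σ) ≤ ((1 + s) / 4) ^ (-σ) := anti (by positivity) (by linarith) hσ
          gcongr
      _ = 4 ^ (m + σ) * (1 + s) ^ (-A) * (t ^ (-A) * (1 + s) ^ (-(m + σ - A))) := by
          have h : (1 + s) ^ (-m) * (1 + s) ^ (-σ) = (1 + s) ^ (-A) * (1 + s) ^ (-(m + σ - A)) := by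
            rw [← Real.rpow_add hs1, ← Real.rpow_add hs1]
            ring_nf
          rw [quarter, quarter, Real.rpow_add (by norm_num : (0 : ℝ) < 4)]
          linear_combination (4 ^ m * 4 ^ σ * t ^ (-A)) * h
      _ ≤ 4 ^ (A + m + σ) * (1 + s) ^ (-A) * (t ^ (-A) * (1 + t) ^ (-(m + σ - A))) := by
          have h4 : (4 : ℝ) ^ (m + σ) ≤ 4 ^ (A + m + σ) := four (by linarith)
          have h : (1 + s) ^ (-(m + σ - A)) ≤ (1 + t) ^ (-(m + σ - A)) :=
            anti (by positivity) (by linarith) (by linarith)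
          gcongr
      _ ≤ _ := by
          gcongr
          have h1 : 0 ≤ r ^ (-σ) * (1 + r) ^ (-m) := by positivity
          have h2 : 0 ≤ r ^ (-(A + σ)) * (1 + r) ^ (-m) + t ^ (-(A + σ)) * (1 + t) ^ (-m) := by
            positivity
          linarith
  · have one_le : ∀ {w z : ℝ}, 0 < w → w ≤ 4 → 0 ≤ z → 1 ≤ 4 ^ z * w ^ (-z) :=
      fun {w z} hw hw4 hz => by
        rw [Real.rpow_neg hw.le, ← div_eq_mul_inv, one_le_div (by positivity)]
        exact Real.rpow_le_rpow hw.le hw4 hz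
    have split : t ^ (-A) * r ^ (-σ) ≤ r ^ (-(A + σ)) + t ^ (-(A + σ)) := by
      rw [neg_add, Real.rpow_add hr, Real.rpow_add ht]
      rcases le_total r t with h | h
      · refine le_add_of_le_of_nonneg ?_ (by positivity)
        exact mul_le_mul_of_nonneg_right (anti hr h hA) (by positivity)
      · refine le_add_of_nonneg_of_le (by positivity) ?_
        exact mul_le_mul_of_nonneg_left (anti ht h hσ) (by positivity)
    calc (1 + r) ^ (-m) * t ^ (-A) * r ^ (-σ)
        ≤ 1 * (t ^ (-A) * r ^ (-σ)) := by
          rw [mul_assoc]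
          gcongr
          exact Real.rpow_le_one_of_one_le_of_nonpos (by linarith) (by linarith)
      _ ≤ (4 ^ A * (1 + s) ^ (-A)) * (r ^ (-(A + σ)) * (4 ^ m * (1 + r) ^ (-m)) +
            t ^ (-(A + σ)) * (4 ^ m * (1 + t) ^ (-m))) := by
          gcongr
          · exact one_le hs1 (by linarith) hA
          · refine split.trans (add_le_add ?_ ?_)
            · exact le_mul_of_one_le_right (by positivity) (one_le (by linarith) (by linarith) hm)
            · exact le_mul_of_one_le_right (by positivity) (one_le (by linarith) (by linarith) hm)
      _ = 4 ^ (A + m) * (1 + s) ^ (-A) *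
            (r ^ (-(A + σ)) * (1 + r) ^ (-m) + t ^ (-(A + σ)) * (1 + t) ^ (-m)) := by
          rw [Real.rpow_add (by norm_num : (0 : ℝ) < 4)]
          ring
      _ ≤ _ := by
          have h4 : (4 : ℝ) ^ (A + m) ≤ 4 ^ (A + m + σ) := four (by linarith)
          exact mul_le_mul (by gcongr) (le_add_of_nonneg_left (by positivity)) (by positivity)
            (by positivity)

theorem stmt_3 (n : ℕ) (hn : 3 ≤ n) (α σ p : ℝ)
    (hα₀ : 0 < α) (hαn : α < n) (hσ0 : 0 ≤ σ) (hσα : σ < α)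
    (hp0 : 0 < p) (hp : ((n : ℝ) - σ) / ((n : ℝ) - α) < p) :
    ∃ c u : EuclideanSpace ℝ (Fin n) → ℝ,
      DoubleBounded c ∧ Continuous u ∧ (∀ x, 0 < u x) ∧
      ∀ x : EuclideanSpace ℝ (Fin n),
        Integrable (fun y => u y ^ p * ‖x - y‖ ^ (α - (n : ℝ)) * ‖y‖ ^ (-σ)) ∧
        u x = c x * (∫ y, u y ^ p * ‖x - y‖ ^ (α - (n : ℝ)) * ‖y‖ ^ (-σ)) := by
  have : Nontrivial (Fin n) := Fin.nontrivial_iff_two_le.2 (by omega)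
  set A : ℝ := n - α with hAdef
  have hA : 0 < A := sub_pos.2 hαn
  set m : ℝ := A * p with hmdef
  have hm : n < m + σ := by
    have := (div_lt_iff₀ hA).1 hp
    linarith [mul_comm p A]
  have hm0 : 0 < m := mul_pos hA hp0
  have hdim : (Module.finrank ℝ (EuclideanSpace ℝ (Fin n)) : ℝ) = n := by simp
  have hG : ∀ {a b : ℝ}, a < n → n < a + b →
      Integrable (fun w : EuclideanSpace ℝ (Fin n) => ‖w‖ ^ (-a) * (1 + ‖w‖) ^ (-b)) :=
    fun ha hab => integrable_norm_rpow_mul_one_add_norm_rpow volume (by rwa [hdim]) (by rwa [hdim])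
  set G : ℝ → ℝ → EuclideanSpace ℝ (Fin n) → ℝ :=
    fun a b w => ‖w‖ ^ (-a) * (1 + ‖w‖) ^ (-b) with hGdef
  set u : EuclideanSpace ℝ (Fin n) → ℝ := fun x => (1 + ‖x‖) ^ (-A) with hudef
  set F : EuclideanSpace ℝ (Fin n) → EuclideanSpace ℝ (Fin n) → ℝ :=
    fun x y => u y ^ p * ‖x - y‖ ^ (α - (n : ℝ)) * ‖y‖ ^ (-σ) with hFdef
  have hu : ∀ x, 0 < u x := fun x => by positivity
  have hF : ∀ x y, F x y = (1 + ‖y‖) ^ (-m) * ‖x - y‖ ^ (-A) * ‖y‖ ^ (-σ) := fun x y => by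
    simp only [hFdef, hudef, hAdef, hmdef]
    rw [← Real.rpow_mul (by positivity), neg_sub, neg_mul_eq_neg_mul, neg_sub]
  have ae_ne : ∀ x : EuclideanSpace ℝ (Fin n), ∀ᵐ y, y ≠ x := fun x =>
    compl_mem_ae_iff.2 (measure_singleton x)
  have h₁ : Integrable (G σ m) := hG (hσα.trans hαn) (by linarith)
  have h₂ : Integrable (G A (m + σ - A)) := hG (by linarith) (by linarith)
  have h₃ : Integrable (G (A + σ) m) := hG (by linarith) (by linarith)
  have h₄ : Integrable (G σ (m + A)) := hG (hσα.trans hαn) (by linarith)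
  set M : EuclideanSpace ℝ (Fin n) → EuclideanSpace ℝ (Fin n) → ℝ := fun x y =>
    G σ m y + G A (m + σ - A) (x - y) + (G (A + σ) m y + G (A + σ) m (x - y)) with hMdef
  have hMint : ∀ x, Integrable (M x) := fun x =>
    (h₁.add (h₂.comp_sub_left x)).add (h₃.add (h₃.comp_sub_left x))
  set J : ℝ := (∫ y, G σ m y) + (∫ y, G A (m + σ - A) y) +
    ((∫ y, G (A + σ) m y) + ∫ y, G (A + σ) m y) with hJdef
  have hMJ : ∀ x, ∫ y, M x y = J := fun x => by
    simp only [hMdef]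
    have h₁₂ : Integrable fun y => G σ m y + G A (m + σ - A) (x - y) :=
      h₁.add (h₂.comp_sub_left x)
    have h₃₃ : Integrable fun y => G (A + σ) m y + G (A + σ) m (x - y) :=
      h₃.add (h₃.comp_sub_left x)
    rw [integral_add h₁₂ h₃₃,
      integral_add h₁ (h₂.comp_sub_left x), integral_add h₃ (h₃.comp_sub_left x),
      integral_sub_left_eq_self (G A (m + σ - A)) volume x,
      integral_sub_left_eq_self (G (A + σ) m) volume x]
  set K : ℝ := 4 ^ (A + m + σ) with hKdef
  have hF0 : ∀ x y, 0 ≤ F x y := fun x y => by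
    rw [hF]
    positivity
  have hupper : ∀ x, ∀ᵐ y, F x y ≤ K * u x * M x y := fun x => by
    filter_upwards [ae_ne 0, ae_ne x] with y hy0 hyx
    rw [hF]
    refine kernel_mul_density_le hA.le hσ0 hm0.le (by linarith) (norm_nonneg x)
      (norm_pos_iff.2 hy0) (norm_pos_iff.2 (sub_ne_zero.2 hyx.symm)) ?_ ?_
    · simpa using norm_add_le (x - y) y
    · simpa using norm_sub_le x (x - y)
  have hlower : ∀ x, ∀ᵐ y, u x * G σ (m + A) y ≤ F x y := fun x => by
    filter_upwards [ae_ne x] with y hyx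
    have hxy : 0 < ‖x - y‖ := norm_pos_iff.2 (sub_ne_zero.2 hyx.symm)
    have hk : (1 + ‖x‖) ^ (-A) * (1 + ‖y‖) ^ (-A) ≤ ‖x - y‖ ^ (-A) := by
      rw [← Real.mul_rpow (by positivity) (by positivity)]
      refine Real.rpow_le_rpow_of_nonpos hxy ?_ (by linarith)
      nlinarith [norm_sub_le x y, norm_nonneg x, norm_nonneg y,
        mul_nonneg (norm_nonneg x) (norm_nonneg y)]
    calc u x * G σ (m + A) y
        = (1 + ‖y‖) ^ (-m) * ((1 + ‖x‖) ^ (-A) * (1 + ‖y‖) ^ (-A)) * ‖y‖ ^ (-σ) := by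
          simp only [hudef, hGdef]
          rw [neg_add, Real.rpow_add (by positivity)]
          ring
      _ ≤ (1 + ‖y‖) ^ (-m) * ‖x - y‖ ^ (-A) * ‖y‖ ^ (-σ) := by gcongr
      _ = F x y := (hF x y).symm
  have hFint : ∀ x, Integrable (F x) := fun x => by
    refine ((hMint x).const_mul (K * u x)).mono' ?_ ?_
    · have : Measurable (F x) := by
        simp only [hFdef, hudef]
        fun_prop
      exact this.aestronglyMeasurable
    · filter_upwards [hupper x] with y hy
      rwa [Real.norm_of_nonneg (hF0 x y)]
  set L : ℝ := ∫ y, G σ (m + A) y with hLdef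
  have hL : 0 < L := by
    rw [hLdef, integral_pos_iff_support_of_nonneg (fun w => by positivity) h₄]
    refine lt_of_lt_of_le ?_ (measure_mono (s := {0}ᶜ) fun w hw => ?_)
    · exact (isOpen_compl_singleton).measure_pos volume (Set.nonempty_compl_of_nontrivial 0)
    · have : 0 < ‖w‖ := norm_pos_iff.2 hw
      have : 0 < G σ (m + A) w := by positivity
      exact this.ne'
  have hle : ∀ x, ∫ y, F x y ≤ K * u x * J := fun x => by
    rw [← hMJ x, ← integral_const_mul]
    exact integral_mono_ae (hFint x) ((hMint x).const_mul _) (hupper x)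
  have hge : ∀ x, u x * L ≤ ∫ y, F x y := fun x => by
    rw [hLdef, ← integral_const_mul]
    exact integral_mono_ae (h₄.const_mul _) (hFint x) (hlower x)
  have hIpos : ∀ x, 0 < ∫ y, F x y := fun x => (mul_pos (hu x) hL).trans_le (hge x)
  have hKJ : 0 < K * J := by
    have := (hIpos 0).trans_le (hle 0)
    rw [mul_right_comm] at this
    exact pos_of_mul_pos_left this (hu 0).le
  refine ⟨fun x => u x / ∫ y, F x y, u, ⟨max (K * J) (1 / L), lt_max_of_lt_left hKJ, fun x => ?_⟩,
    ?_, hu, fun x => ⟨hFint x, (div_mul_cancel₀ _ (hIpos x).ne').symm⟩⟩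
  · constructor
    · refine (one_div_le_one_div_of_le hKJ (le_max_left _ _)).trans ?_
      rw [div_le_div_iff₀ hKJ (hIpos x)]
      linarith [hle x]
    · refine le_trans ?_ (le_max_right _ _)
      rw [div_le_div_iff₀ (hIpos x) hL]
      linarith [hge x]
  · exact (continuous_const.add continuous_norm).rpow_const fun x =>
      Or.inl (add_pos_of_pos_of_nonneg one_pos (norm_nonneg x)).ne'
end
end

section
/- Let n ≥ 3, α ∈ (0,n), σ ∈ [0,α) and p > 0 with p ≤ (n−σ)/(n−α). Then for every double bounded function c on ℝⁿ there is no positive continuous function u on ℝⁿ such that for every x ∈ ℝⁿ the integral ∫_{ℝⁿ} u(y)^p |x−y|^{α−n} |y|^{−σ} dy is finite and u(x) = c(x) ∫_{ℝⁿ} u(y)^p |x−y|^{α−n} |y|^{−σ} dy. -/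
open MeasureTheory

noncomputable section

/-- A superlinear growth inequality on dyadic scales has no positive solution. -/
lemma not_superlinear_dyadic_growth {F : ℝ → ℝ} {k e p : ℝ} (hk : 0 < k) (he : 0 ≤ e)
    (hp : 1 < p) (hF : ∀ R, 0 < R → 0 < F R)
    (hgrow : ∀ R, 0 < R → F R + k * R ^ e * F (2 * R) ^ p ≤ F (2 * R)) : False := by
  have hgrow' : ∀ j : ℕ, F (2 ^ j) + k * F (2 ^ (j + 1)) ^ p ≤ F (2 ^ (j + 1)) := by
    intro j
    have h := hgrow (2 ^ j) (by positivity)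
    rw [← pow_succ'] at h
    have h1 : (1 : ℝ) ≤ ((2 : ℝ) ^ j) ^ e := Real.one_le_rpow (one_le_pow₀ (by norm_num)) he
    have h2 : 0 < F (2 ^ (j + 1)) ^ p := Real.rpow_pos_of_pos (hF _ (by positivity)) _
    nlinarith [mul_le_mul_of_nonneg_left h1 (mul_pos hk h2).le]
  have hmono : Monotone fun j : ℕ => F (2 ^ j) := by
    refine monotone_nat_of_le_succ fun j => ?_
    have h2 : 0 < F (2 ^ (j + 1)) ^ p := Real.rpow_pos_of_pos (hF _ (by positivity)) _
    nlinarith [hgrow' j, mul_pos hk h2]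
  set a := F (2 ^ 0) with ha
  have ha0 : 0 < a := hF _ (by positivity)
  have hlin : ∀ j : ℕ, a + j * (k * a ^ p) ≤ F (2 ^ j) := by
    intro j
    induction j with
    | zero => simp [ha]
    | succ j ih =>
      have h1 : a ^ p ≤ F (2 ^ (j + 1)) ^ p :=
        Real.rpow_le_rpow ha0.le (hmono (Nat.zero_le _)) (by linarith)
      have h2 := mul_le_mul_of_nonneg_left h1 hk.le
      push_cast
      linarith [hgrow' j]
  have hbdd : ∀ j : ℕ, F (2 ^ (j + 1)) ≤ k⁻¹ ^ (p - 1)⁻¹ := by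
    intro j
    have hpos := hF (2 ^ (j + 1)) (by positivity)
    have hsplit : F (2 ^ (j + 1)) ^ p = F (2 ^ (j + 1)) ^ (p - 1) * F (2 ^ (j + 1)) := by
      conv_rhs => rw [← Real.rpow_add_one hpos.ne', sub_add_cancel]
    have h := hgrow' j
    rw [hsplit, ← mul_assoc] at h
    have h1 : k * F (2 ^ (j + 1)) ^ (p - 1) ≤ 1 := by
      by_contra! hcon
      nlinarith [hF (2 ^ j) (by positivity)]
    rw [Real.le_rpow_inv_iff_of_pos hpos.le (by positivity) (by linarith)]
    rwa [← one_div, le_div_iff₀' hk]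
  have hd : 0 < k * a ^ p := mul_pos hk (Real.rpow_pos_of_pos ha0 _)
  obtain ⟨j, hj⟩ := exists_nat_gt (k⁻¹ ^ (p - 1)⁻¹ / (k * a ^ p))
  rw [div_lt_iff₀ hd] at hj
  have h1 := hlin (j + 1)
  push_cast at h1
  linarith [hbdd j]

/-- A sublinear lower growth rate is incompatible with a slower polynomial upper bound. -/
lemma not_sublinear_dyadic_growth {F : ℝ → ℝ} {k e p s M : ℝ} (hk : 0 < k)
    (hp : p ≤ 1) (hes : s * (1 - p) < e) (hF : ∀ R, 0 < R → 0 < F R)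
    (hgrow : ∀ R, 0 < R → k * R ^ e * F R ^ p ≤ F R)
    (hupper : ∀ R, 0 < R → F R ≤ M * R ^ s) : False := by
  have hM : 0 < M := by simpa using (hF 1 one_pos).trans_le (hupper 1 one_pos)
  have hbdd : ∀ R, 0 < R → R ^ (e - s * (1 - p)) ≤ M ^ (1 - p) / k := by
    intro R hR
    have hFR := hF R hR
    have hsplit : F R = F R ^ (1 - p) * F R ^ p := by
      rw [← Real.rpow_add hFR, sub_add_cancel, Real.rpow_one]
    have h1 : k * R ^ e ≤ F R ^ (1 - p) := by
      refine le_of_mul_le_mul_right ?_ (Real.rpow_pos_of_pos hFR p)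
      rw [← hsplit]
      exact hgrow R hR
    have h2 : F R ^ (1 - p) ≤ M ^ (1 - p) * R ^ (s * (1 - p)) := by
      refine (Real.rpow_le_rpow hFR.le (hupper R hR) (by linarith)).trans_eq ?_
      rw [Real.mul_rpow hM.le (by positivity), ← Real.rpow_mul hR.le]
    rw [Real.rpow_sub hR, div_le_div_iff₀ (by positivity) hk]
    linarith
  obtain ⟨R, hR, hR0⟩ := (((tendsto_rpow_atTop (sub_pos.2 hes)).eventually_gt_atTop
    (M ^ (1 - p) / k)).and (Filter.eventually_gt_atTop 0)).exists
  exact (hbdd R hR0).not_gt hR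

/-- Inside a ball of radius `R` the Riesz kernel is almost everywhere at least its value at
distance `2 * R`. -/
lemma ae_riesz_kernel_lower_bound {n : ℕ} [NeZero n] {β σ R : ℝ} (hβ : β ≤ 0)
    {f : EuclideanSpace ℝ (Fin n) → ℝ} (hf : ∀ y, 0 ≤ f y)
    {x : EuclideanSpace ℝ (Fin n)} (hx : x ∈ Metric.ball 0 R) :
    ∀ᵐ y ∂volume.restrict (Metric.ball 0 R),
      (2 * R) ^ β * (f y * ‖y‖ ^ (-σ)) ≤ f y * ‖x - y‖ ^ β * ‖y‖ ^ (-σ) := by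
  filter_upwards [ae_restrict_mem Metric.isOpen_ball.measurableSet,
    ae_restrict_of_ae (volume.ae_ne x)] with y hy hyx
  rw [mem_ball_zero_iff] at hx hy
  have h0 : 0 < ‖x - y‖ := norm_pos_iff.2 (sub_ne_zero.2 hyx.symm)
  have h1 : ‖x - y‖ ≤ 2 * R := (norm_sub_le x y).trans (by linarith)
  have h2 := Real.rpow_le_rpow_of_nonpos h0 h1 hβ
  have h3 : 0 ≤ f y * ‖y‖ ^ (-σ) := mul_nonneg (hf y) (by positivity)
  nlinarith [mul_le_mul_of_nonneg_right h2 h3]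

lemma measureReal_ball_diff_ball {n : ℕ} {R : ℝ} (hR : 0 < R) :
    volume.real (Metric.ball (0 : EuclideanSpace ℝ (Fin n)) (2 * R) \ Metric.ball 0 R) =
      (2 ^ n - 1) * volume.real (Metric.ball (0 : EuclideanSpace ℝ (Fin n)) 1) * R ^ (n : ℝ) := by
  rw [measureReal_sdiff (Metric.ball_subset_ball (by linarith)) Metric.isOpen_ball.measurableSet,
    Measure.real, Measure.real, Measure.addHaar_ball_of_pos _ _ (by positivity),
    Measure.addHaar_ball_of_pos _ _ hR]
  simp only [finrank_euclideanSpace_fin, ENNReal.toReal_mul, Real.rpow_natCast, Measure.real]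
  rw [ENNReal.toReal_ofReal (by positivity), ENNReal.toReal_ofReal (by positivity)]
  ring

theorem stmt_4 (n : ℕ) (hn : 3 ≤ n) (α σ p : ℝ)
    (hα₀ : 0 < α) (hαn : α < n) (hσ0 : 0 ≤ σ) (hσα : σ < α)
    (hp0 : 0 < p) (hp : p ≤ ((n : ℝ) - σ) / ((n : ℝ) - α))
    (c : EuclideanSpace ℝ (Fin n) → ℝ) (hc : DoubleBounded c) :
    ¬ ∃ u : EuclideanSpace ℝ (Fin n) → ℝ,
      Continuous u ∧ (∀ x, 0 < u x) ∧
      ∀ x : EuclideanSpace ℝ (Fin n),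
        Integrable (fun y => u y ^ p * ‖x - y‖ ^ (α - (n : ℝ)) * ‖y‖ ^ (-σ)) ∧
        u x = c x * (∫ y, u y ^ p * ‖x - y‖ ^ (α - (n : ℝ)) * ‖y‖ ^ (-σ)) := by
  rintro ⟨u, hu, hupos, hsol⟩
  obtain ⟨C, hC, hcC⟩ := hc
  have : NeZero n := ⟨by omega⟩
  have hup : ∀ y, 0 ≤ u y ^ p := fun y => (Real.rpow_pos_of_pos (hupos y) p).le
  have hβ : α - (n : ℝ) ≤ 0 := by linarith
  set w : EuclideanSpace ℝ (Fin n) → ℝ := fun y => u y ^ p * ‖y‖ ^ (-σ) with hw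
  have hw0 : ∀ y, 0 ≤ w y := fun y => mul_nonneg (hup y) (by positivity)
  have hwm : Measurable w := by
    have := hu.measurable
    fun_prop
  set F : ℝ → ℝ := fun R => ∫ y in Metric.ball 0 R, w y with hFdef
  have hwint : ∀ R, 0 < R → IntegrableOn w (Metric.ball 0 R) := by
    intro R hR
    have hint : IntegrableOn (fun y => (2 * R) ^ (α - (n : ℝ)) * w y) (Metric.ball 0 R) := by
      refine Integrable.mono' (hsol 0).1.integrableOn
        (hwm.const_mul _).aestronglyMeasurable ?_
      filter_upwards [ae_riesz_kernel_lower_bound (σ := σ) hβ hup (Metric.mem_ball_self hR)]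
        with y hy
      rwa [Real.norm_of_nonneg (mul_nonneg (by positivity) (hw0 y))]
    exact (integrable_const_mul_iff (isUnit_iff_ne_zero.2 (by positivity)) w).1 hint
  have hpot : ∀ R x, 0 < R → x ∈ Metric.ball 0 R → (2 * R) ^ (α - (n : ℝ)) * F R ≤
      ∫ y, u y ^ p * ‖x - y‖ ^ (α - (n : ℝ)) * ‖y‖ ^ (-σ) := by
    intro R x hR hx
    rw [hFdef, ← integral_const_mul]
    refine (integral_mono_ae ((hwint R hR).const_mul _) (hsol x).1.integrableOn
      (ae_riesz_kernel_lower_bound hβ hup hx)).trans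
      (setIntegral_le_integral (hsol x).1 (Filter.Eventually.of_forall fun y => ?_))
    exact mul_nonneg (mul_nonneg (hup y) (by positivity)) (by positivity)
  have hFpos : ∀ R, 0 < R → 0 < F R := by
    intro R hR
    rw [hFdef, setIntegral_pos_iff_support_of_nonneg_ae (Filter.Eventually.of_forall hw0)
      (hwint R hR)]
    have hsub : Metric.ball (0 : EuclideanSpace ℝ (Fin n)) R \ {0} ⊆
        Function.support w ∩ Metric.ball 0 R := by
      rintro y ⟨hy, hy0⟩
      have : 0 < ‖y‖ := norm_pos_iff.2 hy0
      exact ⟨(mul_pos (Real.rpow_pos_of_pos (hupos y) p) (by positivity)).ne', hy⟩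
    refine lt_of_lt_of_le ?_ (measure_mono hsub)
    rw [measure_sdiff_null (measure_singleton _)]
    exact Metric.measure_ball_pos _ _ hR
  have hulow : ∀ R x, 0 < R → x ∈ Metric.ball 0 R →
      C⁻¹ * ((2 * R) ^ (α - (n : ℝ)) * F R) ≤ u x := by
    intro R x hR hx
    have h1 : 0 ≤ (2 * R) ^ (α - (n : ℝ)) * F R := mul_nonneg (by positivity) (hFpos R hR).le
    rw [(hsol x).2]
    have h2 := (hcC x).1
    rw [one_div] at h2
    exact mul_le_mul h2 (hpot R x hR hx) h1 ((inv_pos.2 hC).le.trans h2)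
  set ω := volume.real (Metric.ball (0 : EuclideanSpace ℝ (Fin n)) 1) with hω
  have hω0 : 0 < ω := ENNReal.toReal_pos (Metric.measure_ball_pos _ _ one_pos).ne'
    measure_ball_lt_top.ne
  set k := (C⁻¹ * 4 ^ (α - (n : ℝ))) ^ p * 2 ^ (-σ) * ((2 ^ n - 1) * ω) with hkdef
  have h2n : (0 : ℝ) < 2 ^ n - 1 := sub_pos.2 (one_lt_pow₀ (by norm_num) (by omega))
  have hk : 0 < k := by positivity
  set e := (n : ℝ) - σ - p * (n - α) with hedef
  have hgrow : ∀ R, 0 < R → F R + k * R ^ e * F (2 * R) ^ p ≤ F (2 * R) := by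
    intro R hR
    have h2R : 0 < 2 * R := by positivity
    have hsub : Metric.ball (0 : EuclideanSpace ℝ (Fin n)) R ⊆ Metric.ball 0 (2 * R) :=
      Metric.ball_subset_ball (by linarith)
    have hdiff := setIntegral_sdiff (f := w) Metric.isOpen_ball.measurableSet
      (hwint _ h2R) hsub
    set m := (C⁻¹ * ((2 * (2 * R)) ^ (α - (n : ℝ)) * F (2 * R))) ^ p * (2 * R) ^ (-σ) with hm
    have hF2 := hFpos _ h2R
    have hlow : m * volume.real (Metric.ball (0 : EuclideanSpace ℝ (Fin n)) (2 * R) \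
        Metric.ball 0 R) ≤ ∫ y in Metric.ball 0 (2 * R) \ Metric.ball 0 R, w y := by
      refine setIntegral_ge_of_const_le_real
        (Metric.isOpen_ball.measurableSet.diff Metric.isOpen_ball.measurableSet)
        (measure_ne_top_of_subset Set.sdiff_subset measure_ball_lt_top.ne) ?_
        ((hwint _ h2R).mono_set Set.sdiff_subset)
      rintro y ⟨hy, hyR⟩
      have hy0 : 0 < ‖y‖ := hR.trans_le (by simpa using hyR)
      have hy2 : ‖y‖ ≤ 2 * R := (mem_ball_zero_iff.1 hy).le
      exact mul_le_mul (Real.rpow_le_rpow (by positivity) (hulow _ y h2R hy) hp0.le)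
        (Real.rpow_le_rpow_of_nonpos hy0 hy2 (by linarith)) (by positivity) (hup y)
    rw [measureReal_ball_diff_ball hR, ← hω] at hlow
    have hmeq : m * ((2 ^ n - 1) * ω * R ^ (n : ℝ)) = k * R ^ e * F (2 * R) ^ p := by
      have hRe : R ^ e = (R ^ (α - (n : ℝ))) ^ p * R ^ (-σ) * R ^ (n : ℝ) := by
        rw [← Real.rpow_mul hR.le, ← Real.rpow_add hR, ← Real.rpow_add hR]
        congr 1
        rw [hedef]
        ring
      have hm' : C⁻¹ * ((2 * (2 * R)) ^ (α - (n : ℝ)) * F (2 * R)) =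
          C⁻¹ * 4 ^ (α - (n : ℝ)) * R ^ (α - (n : ℝ)) * F (2 * R) := by
        rw [show 2 * (2 * R) = 4 * R by ring, Real.mul_rpow (by norm_num) hR.le]
        ring
      rw [hm, hm', hRe, hkdef, Real.mul_rpow (by positivity) hF2.le,
        Real.mul_rpow (by positivity) (by positivity), Real.mul_rpow (by norm_num) hR.le]
      ring
    rw [hmeq] at hlow
    simp only [hFdef] at hlow hdiff ⊢
    linarith
  rcases lt_or_ge 1 p with hp1 | hp1
  · refine not_superlinear_dyadic_growth hk ?_ hp1 hFpos hgrow
    rw [le_div_iff₀ (by linarith)] at hp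
    linarith
  · refine not_sublinear_dyadic_growth (F := fun R => F (2 * R)) (s := (n : ℝ) - α)
      (M := 4 ^ ((n : ℝ) - α) * ∫ y, u y ^ p * ‖0 - y‖ ^ (α - (n : ℝ)) * ‖y‖ ^ (-σ))
      hk hp1 (e := e) ?_ (fun R hR => hFpos _ (by positivity)) ?_ ?_
    · rw [hedef]
      linarith
    · intro R hR
      linarith [hgrow R hR, hFpos R hR]
    · intro R hR
      have h2R : 0 < 2 * R := by positivity
      have h := hpot (2 * R) 0 h2R (Metric.mem_ball_self h2R)
      rw [show 2 * (2 * R) = 4 * R by ring, ← neg_sub, Real.rpow_neg (by positivity),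
        inv_mul_le_iff₀ (by positivity), Real.mul_rpow (by norm_num) hR.le] at h
      rw [neg_sub] at h
      linarith
end
end

section
/- Let k ≥ 1 be an integer, n > 2k, σ ∈ [0,2k) and p > 1. Then the poly-harmonic equation (−Δ)^k u(x) = c(x) |x|^{−σ} u(x)^p on ℝⁿ∖{0} admits a positive solution u ∈ C^{2k}(ℝⁿ∖{0}) ∩ C(ℝⁿ) for some double bounded function c on ℝⁿ if and only if p > (n−σ)/(n−2k). -/
open MeasureTheory

noncomputable section

/-- The Laplacian of `u : ℝⁿ → ℝ`: the sum of the pure second partial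
derivatives along the coordinate directions. -/
def laplacian {n : ℕ} (u : EuclideanSpace ℝ (Fin n) → ℝ)
    (x : EuclideanSpace ℝ (Fin n)) : ℝ :=
  ∑ i : Fin n,
    iteratedFDeriv ℝ 2 u x ![EuclideanSpace.single i 1, EuclideanSpace.single i 1]

/-- `(-Δ)^k`, the k-th iterate of the negative Laplacian. -/
def negLapPow {n : ℕ} (k : ℕ) (u : EuclideanSpace ℝ (Fin n) → ℝ) :
    EuclideanSpace ℝ (Fin n) → ℝ :=
  (fun v x => -laplacian v x)^[k] u

open Set Filter Topology
open scoped ContDiff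

/-! ### Calculus of the Laplacian -/

lemma laplacian_congr {n : ℕ} {u v : EuclideanSpace ℝ (Fin n) → ℝ} {x : EuclideanSpace ℝ (Fin n)}
    (h : u =ᶠ[𝓝 x] v) : laplacian u x = laplacian v x := by
  simp only [laplacian, iteratedFDeriv_two_apply]
  rw [(h.fderiv (𝕜 := ℝ)).fderiv_eq]

lemma laplacian_eq_sum_fderiv {n : ℕ} {u : EuclideanSpace ℝ (Fin n) → ℝ}
    {x : EuclideanSpace ℝ (Fin n)} (h : ContDiffAt ℝ 2 u x) :
    laplacian u x = ∑ i : Fin n,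
      fderiv ℝ (fun y => fderiv ℝ u y (EuclideanSpace.single i 1)) x
        (EuclideanSpace.single i 1) := by
  have hd : DifferentiableAt ℝ (fderiv ℝ u) x :=
    (h.fderiv_right (m := 1) (by norm_num)).differentiableAt (by norm_num)
  simp only [laplacian, iteratedFDeriv_two_apply]
  refine Finset.sum_congr rfl fun i _ => ?_
  rw [fderiv_clm_apply hd (differentiableAt_const _)]
  simp

lemma laplacian_sub {n : ℕ} {u v : EuclideanSpace ℝ (Fin n) → ℝ} {x : EuclideanSpace ℝ (Fin n)}
    (hu : ContDiffAt ℝ 2 u x) (hv : ContDiffAt ℝ 2 v x) :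
    laplacian (fun y => u y - v y) x = laplacian u x - laplacian v x := by
  simp only [laplacian, ← Finset.sum_sub_distrib]
  refine Finset.sum_congr rfl fun i _ => ?_
  have := iteratedFDeriv_sub_apply (i := 2) hu hv
  rw [show (fun y => u y - v y) = u - v from rfl, this]
  rfl

lemma ContDiffOn.laplacian {n : ℕ} {u : EuclideanSpace ℝ (Fin n) → ℝ} {m : ℕ}
    {s : Set (EuclideanSpace ℝ (Fin n))} (hs : IsOpen s) (h : ContDiffOn ℝ (m + 2 : ℕ) u s) :
    ContDiffOn ℝ m (_root_.laplacian u) s := by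
  intro x hx
  refine ContDiffAt.contDiffWithinAt ?_
  have hi := (h.contDiffAt (hs.mem_nhds hx)).iteratedFDeriv_right (m := m) (i := 2) (by simp)
  unfold _root_.laplacian
  refine ContDiffAt.sum fun i _ => ?_
  exact ((ContinuousMultilinearMap.apply ℝ
    (fun _ : Fin 2 => EuclideanSpace ℝ (Fin n)) ℝ
      ![EuclideanSpace.single i 1, EuclideanSpace.single i 1]).contDiff.contDiffAt).comp x hi

lemma ContDiff.laplacian {n : ℕ} {u : EuclideanSpace ℝ (Fin n) → ℝ} (h : ContDiff ℝ ∞ u) :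
    ContDiff ℝ ∞ (_root_.laplacian u) := by
  rw [contDiff_infty]
  intro m
  rw [← contDiffOn_univ]
  exact (contDiff_infty.1 h (m + 2)).contDiffOn.laplacian isOpen_univ

lemma negLapPow_zero {n : ℕ} (u : EuclideanSpace ℝ (Fin n) → ℝ) : negLapPow 0 u = u := rfl

lemma negLapPow_succ {n : ℕ} (k : ℕ) (u : EuclideanSpace ℝ (Fin n) → ℝ) :
    negLapPow (k + 1) u = fun x => -laplacian (negLapPow k u) x :=
  Function.iterate_succ_apply' _ _ _

lemma negLapPow_succ' {n : ℕ} (k : ℕ) (u : EuclideanSpace ℝ (Fin n) → ℝ) :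
    negLapPow (k + 1) u = negLapPow k (fun x => -laplacian u x) := rfl

lemma negLapPow_congr {n : ℕ} (k : ℕ) {u v : EuclideanSpace ℝ (Fin n) → ℝ}
    {x : EuclideanSpace ℝ (Fin n)} (h : u =ᶠ[𝓝 x] v) :
    negLapPow k u =ᶠ[𝓝 x] negLapPow k v := by
  induction k with
  | zero => exact h
  | succ k ih =>
    simp only [negLapPow_succ]
    filter_upwards [ih.eventuallyEq_nhds] with y hy
    rw [laplacian_congr hy]

lemma ContDiffOn.negLapPow {n : ℕ} {m : ℕ} {s : Set (EuclideanSpace ℝ (Fin n))} (hs : IsOpen s)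
    (k : ℕ) {u : EuclideanSpace ℝ (Fin n) → ℝ} (h : ContDiffOn ℝ (m + 2 * k : ℕ) u s) :
    ContDiffOn ℝ m (_root_.negLapPow k u) s := by
  induction k generalizing m with
  | zero => simpa [negLapPow_zero] using h
  | succ k ih =>
    rw [negLapPow_succ]
    refine (ContDiffOn.laplacian hs (ih (m := m + 2) ?_)).neg
    convert h using 2
    ring

lemma ContDiff.negLapPow {n : ℕ} (k : ℕ) {u : EuclideanSpace ℝ (Fin n) → ℝ}
    (h : ContDiff ℝ ∞ u) : ContDiff ℝ ∞ (_root_.negLapPow k u) := by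
  induction k with
  | zero => exact h
  | succ k ih =>
    rw [negLapPow_succ]
    exact ih.laplacian.neg

lemma negLapPow_sub {n : ℕ} (k : ℕ) {u v : EuclideanSpace ℝ (Fin n) → ℝ}
    (hu : ContDiff ℝ ∞ u) (hv : ContDiff ℝ ∞ v) (x : EuclideanSpace ℝ (Fin n)) :
    negLapPow k (fun y => u y - v y) x = negLapPow k u x - negLapPow k v x := by
  induction k generalizing x with
  | zero => rfl
  | succ k ih =>
    simp only [negLapPow_succ]
    rw [funext ih, laplacian_sub]
    · ring
    · exact (contDiff_infty.1 (hu.negLapPow k) 2).contDiffAt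
    · exact (contDiff_infty.1 (hv.negLapPow k) 2).contDiffAt

lemma negLapPow_of_eventually_const {n : ℕ} {k : ℕ} (hk : 1 ≤ k)
    {u : EuclideanSpace ℝ (Fin n) → ℝ} {x : EuclideanSpace ℝ (Fin n)} {a : ℝ}
    (h : ∀ᶠ y in 𝓝 x, u y = a) : negLapPow k u x = 0 := by
  obtain ⟨k, rfl⟩ := Nat.exists_eq_add_of_le' hk
  rw [negLapPow_succ']
  have h0 : (fun y => -laplacian u y) =ᶠ[𝓝 x] fun _ => (0 : ℝ) := by
    filter_upwards [h.eventually_nhds] with y hy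
    have := laplacian_congr (v := fun _ => a) hy
    rw [this]
    simp [laplacian, iteratedFDeriv_two_apply]
  rw [(negLapPow_congr k h0).eq_of_nhds]
  clear h0 h
  have : ∀ k : ℕ, negLapPow k (fun _ : EuclideanSpace ℝ (Fin n) => (0 : ℝ)) = fun _ => 0 := by
    intro k
    induction k with
    | zero => rfl
    | succ k ih =>
      rw [negLapPow_succ, ih]
      simp [laplacian]
  rw [this]

lemma negLapPow_comp_smul {n : ℕ} (k : ℕ) {u : EuclideanSpace ℝ (Fin n) → ℝ}
    (hu : ContDiff ℝ ∞ u) (t : ℝ) (x : EuclideanSpace ℝ (Fin n)) :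
    negLapPow k (fun y => u (t • y)) x = t ^ (2 * k) * negLapPow k u (t • x) := by
  have key : ∀ w : EuclideanSpace ℝ (Fin n) → ℝ, ContDiff ℝ ∞ w →
      ∀ c : ℝ, ∀ y, laplacian (fun z => c * w (t • z)) y = c * t ^ 2 * laplacian w (t • y) := by
    intro w hw c y
    have hd : ∀ w : EuclideanSpace ℝ (Fin n) → ℝ, Differentiable ℝ w → ∀ c y v,
        fderiv ℝ (fun z => c * w (t • z)) y v = c * t * fderiv ℝ w (t • y) v := by
      intro w hw c y v
      have h1 : HasFDerivAt (fun z : EuclideanSpace ℝ (Fin n) => t • z)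
          (t • ContinuousLinearMap.id ℝ _) y := (hasFDerivAt_id y).const_smul t
      have h2 := (((hw (t • y)).hasFDerivAt.comp y h1).const_mul c).fderiv
      have h3 : (fun z => c * w (t • z)) = fun z => c * (w ∘ fun z => t • z) z := rfl
      rw [h3, h2]
      simp
      ring
    have hw1 : Differentiable ℝ w := hw.differentiable (by simp)
    have hw2 : ContDiff ℝ 2 w := contDiff_infty.1 hw 2
    rw [laplacian_eq_sum_fderiv (by fun_prop), laplacian_eq_sum_fderiv hw2.contDiffAt,
      Finset.mul_sum]
    refine Finset.sum_congr rfl fun i _ => ?_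
    simp only [hd w hw1]
    rw [hd (fun y => fderiv ℝ w y (EuclideanSpace.single i 1))]
    · ring
    · exact ((hw2.fderiv_right (m := 1) (by norm_num)).clm_apply contDiff_const).differentiable
        (by norm_num)
  induction k generalizing x with
  | zero => simp [negLapPow_zero]
  | succ k ih =>
    simp only [negLapPow_succ]
    rw [funext ih, key _ (hu.negLapPow k)]
    ring

lemma exists_laplacian_pow_mul_eq {n : ℕ} {η g : EuclideanSpace ℝ (Fin n) → ℝ}
    (hη : ContDiff ℝ ∞ η) (hg : ContDiff ℝ ∞ g) (m : ℕ) :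
    ∃ g' : EuclideanSpace ℝ (Fin n) → ℝ, ContDiff ℝ ∞ g' ∧
      laplacian (fun x => η x ^ (m + 2) * g x) = fun x => η x ^ m * g' x := by
  have key : ∀ (v : EuclideanSpace ℝ (Fin n)) (j : ℕ) (g : EuclideanSpace ℝ (Fin n) → ℝ),
      ContDiff ℝ ∞ g → ∃ g' : EuclideanSpace ℝ (Fin n) → ℝ, ContDiff ℝ ∞ g' ∧
        ∀ x, fderiv ℝ (fun x => η x ^ (j + 1) * g x) x v = η x ^ j * g' x := by
    intro v j g hg
    have hη1 : ContDiff ℝ ∞ (fun x => fderiv ℝ η x v) :=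
      (hη.fderiv_right (m := ∞) (by simp)).clm_apply contDiff_const
    have hg1 : ContDiff ℝ ∞ (fun x => fderiv ℝ g x v) :=
      (hg.fderiv_right (m := ∞) (by simp)).clm_apply contDiff_const
    refine ⟨fun x => (j + 1) * fderiv ℝ η x v * g x + η x * fderiv ℝ g x v, by fun_prop, ?_⟩
    intro x
    have e1 : HasFDerivAt η (fderiv ℝ η x) x := (hη.differentiable (by simp) x).hasFDerivAt
    have e2 : HasFDerivAt g (fderiv ℝ g x) x := (hg.differentiable (by simp) x).hasFDerivAt
    have e3 := ((e1.pow (j + 1)).mul e2).fderiv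
    have h3 : (fun x => η x ^ (j + 1) * g x) = (fun x => η x ^ (j + 1)) * g := rfl
    rw [h3, e3]
    simp
    ring
  choose D hD hD' using key
  refine ⟨fun x => ∑ i : Fin n, D (EuclideanSpace.single i 1) m
    (D (EuclideanSpace.single i 1) (m + 1) g hg) (hD _ _ _ _) x,
    ContDiff.sum fun i _ => hD _ _ _ _, ?_⟩
  funext x
  have hc : ContDiff ℝ 2 (fun x => η x ^ (m + 2) * g x) :=
    contDiff_infty.1 ((hη.pow _).mul hg) 2
  rw [laplacian_eq_sum_fderiv hc.contDiffAt, Finset.mul_sum]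
  refine Finset.sum_congr rfl fun i _ => ?_
  rw [← hD', funext (hD' (EuclideanSpace.single i 1) (m + 1) g hg)]

lemma exists_negLapPow_pow_eq {n : ℕ} {η : EuclideanSpace ℝ (Fin n) → ℝ}
    (hη : ContDiff ℝ ∞ η) (k m : ℕ) :
    ∃ g : EuclideanSpace ℝ (Fin n) → ℝ, ContDiff ℝ ∞ g ∧
      negLapPow k (fun x => η x ^ (m + 2 * k)) = fun x => η x ^ m * g x := by
  induction k generalizing m with
  | zero => exact ⟨fun _ => 1, contDiff_const, by simp [negLapPow_zero]⟩
  | succ k ih =>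
    obtain ⟨g, hg, hg'⟩ := ih (m + 2)
    obtain ⟨g', hg1, hg1'⟩ := exists_laplacian_pow_mul_eq hη hg m
    refine ⟨fun x => -g' x, hg1.neg, ?_⟩
    rw [negLapPow_succ, show m + 2 * (k + 1) = m + 2 + 2 * k by ring, hg', hg1']
    simp

/-! ### Integration by parts -/

lemma integrable_mul_of_tsupport_subset {n : ℕ} {s : Set (EuclideanSpace ℝ (Fin n))}
    (hs : IsOpen s) {f φ : EuclideanSpace ℝ (Fin n) → ℝ} (hf : ContinuousOn f s)
    (hφ : Continuous φ) (hc : HasCompactSupport φ) (hsub : tsupport φ ⊆ s) :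
    Integrable (fun x => f x * φ x) := by
  refine Continuous.integrable_of_hasCompactSupport ?_ (hc.mul_left (f := f))
  refine continuous_of_tsupport fun x hx => ?_
  have hx' : x ∈ tsupport φ := tsupport_mul_subset_right (f := f) (g := φ) hx
  exact (hf.continuousAt (hs.mem_nhds (hsub hx'))).mul hφ.continuousAt

lemma integral_fderiv_mul_eq {n : ℕ} {s : Set (EuclideanSpace ℝ (Fin n))}
    (hs : IsOpen s) {f φ : EuclideanSpace ℝ (Fin n) → ℝ} (hf : ContDiffOn ℝ 1 f s)
    (hφ : ContDiff ℝ 1 φ) (hc : HasCompactSupport φ) (hsub : tsupport φ ⊆ s)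
    (v : EuclideanSpace ℝ (Fin n)) :
    ∫ x, fderiv ℝ f x v * φ x = -∫ x, f x * fderiv ℝ φ x v := by
  have hf' : ContinuousOn (fun x => fderiv ℝ f x v) s :=
    (hf.continuousOn_fderiv_of_isOpen hs le_rfl).clm_apply continuousOn_const
  have hφ' : Continuous (fun x => fderiv ℝ φ x v) :=
    (hφ.continuous_fderiv (by norm_num)).clm_apply continuous_const
  rw [integral_mul_fderiv_eq_neg_fderiv_mul_of_integrable, neg_neg]
  · exact integrable_mul_of_tsupport_subset hs hf' hφ.continuous hc hsub
  · exact integrable_mul_of_tsupport_subset hs hf.continuousOn hφ' (hc.fderiv_apply (𝕜 := ℝ) v)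
      ((tsupport_fderiv_apply_subset ℝ v).trans hsub)
  · exact integrable_mul_of_tsupport_subset hs hf.continuousOn hφ.continuous hc hsub
  · exact fun x hx => (hf.contDiffAt (hs.mem_nhds (hsub hx))).differentiableAt (by norm_num)
  · exact fun x _ => hφ.differentiable (by norm_num) x

lemma tsupport_laplacian_subset {n : ℕ} (φ : EuclideanSpace ℝ (Fin n) → ℝ) :
    tsupport (fun x => -laplacian φ x) ⊆ tsupport φ := by
  refine closure_minimal (fun x hx => ?_) (isClosed_tsupport φ)
  by_contra hxs
  refine hx ?_
  have h0 : φ =ᶠ[𝓝 x] fun _ => (0 : ℝ) := notMem_tsupport_iff_eventuallyEq.1 hxs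
  simp only [laplacian_congr h0]
  simp [laplacian]

lemma integral_laplacian_mul_eq {n : ℕ} {s : Set (EuclideanSpace ℝ (Fin n))}
    (hs : IsOpen s) {f φ : EuclideanSpace ℝ (Fin n) → ℝ} (hf : ContDiffOn ℝ 2 f s)
    (hφ : ContDiff ℝ 2 φ) (hc : HasCompactSupport φ) (hsub : tsupport φ ⊆ s) :
    ∫ x, laplacian f x * φ x = ∫ x, f x * laplacian φ x := by
  have hf1 : ∀ v, ContDiffOn ℝ 1 (fun x => fderiv ℝ f x v) s := fun v =>
    (hf.fderiv_of_isOpen hs (by norm_num)).clm_apply contDiffOn_const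
  have hφ1 : ∀ v, ContDiff ℝ 1 (fun x => fderiv ℝ φ x v) := fun v =>
    (hφ.fderiv_right (by norm_num)).clm_apply contDiff_const
  have hf2 : ∀ v, ContinuousOn (fun x => fderiv ℝ (fun y => fderiv ℝ f y v) x v) s := fun v =>
    ((hf1 v).continuousOn_fderiv_of_isOpen hs le_rfl).clm_apply continuousOn_const
  have hφ2 : ∀ v, Continuous (fun x => fderiv ℝ (fun y => fderiv ℝ φ y v) x v) := fun v =>
    ((hφ1 v).continuous_fderiv (by norm_num)).clm_apply continuous_const
  have hc1 : ∀ v, HasCompactSupport (fun x => fderiv ℝ φ x v) := fun v =>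
    hc.fderiv_apply (𝕜 := ℝ) v
  have hsub1 : ∀ v, tsupport (fun x => fderiv ℝ φ x v) ⊆ s := fun v =>
    (tsupport_fderiv_apply_subset ℝ v).trans hsub
  have e1 : (fun x => laplacian f x * φ x) = fun x => ∑ i : Fin n,
      fderiv ℝ (fun y => fderiv ℝ f y (EuclideanSpace.single i 1)) x
        (EuclideanSpace.single i 1) * φ x := by
    funext x
    by_cases hx : x ∈ tsupport φ
    · rw [laplacian_eq_sum_fderiv (hf.contDiffAt (hs.mem_nhds (hsub hx))), Finset.sum_mul]
    · simp [image_eq_zero_of_notMem_tsupport hx]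
  have e2 : (fun x => f x * laplacian φ x) = fun x => ∑ i : Fin n,
      f x * fderiv ℝ (fun y => fderiv ℝ φ y (EuclideanSpace.single i 1)) x
        (EuclideanSpace.single i 1) := by
    funext x
    rw [laplacian_eq_sum_fderiv hφ.contDiffAt, Finset.mul_sum]
  rw [e1, e2, integral_finsetSum, integral_finsetSum]
  · refine Finset.sum_congr rfl fun i _ => ?_
    rw [integral_fderiv_mul_eq hs (hf1 _) (hφ.of_le (by norm_num)) hc hsub,
      integral_fderiv_mul_eq hs (hf.of_le (by norm_num)) (hφ1 _) (hc1 _) (hsub1 _), neg_neg]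
  · exact fun i _ => integrable_mul_of_tsupport_subset hs hf.continuousOn (hφ2 _)
      ((hc1 _).fderiv_apply (𝕜 := ℝ) _) ((tsupport_fderiv_apply_subset ℝ _).trans (hsub1 _))
  · exact fun i _ => integrable_mul_of_tsupport_subset hs (hf2 _) hφ.continuous hc hsub

lemma integral_negLapPow_mul_eq {n : ℕ} {s : Set (EuclideanSpace ℝ (Fin n))}
    (hs : IsOpen s) (k : ℕ) {u φ : EuclideanSpace ℝ (Fin n) → ℝ}
    (hu : ContDiffOn ℝ (2 * k : ℕ) u s)
    (hφ : ContDiff ℝ ∞ φ) (hc : HasCompactSupport φ) (hsub : tsupport φ ⊆ s) :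
    ∫ x, negLapPow k u x * φ x = ∫ x, u x * negLapPow k φ x := by
  induction k generalizing φ with
  | zero => rfl
  | succ k ih =>
    have h2 : ContDiffOn ℝ 2 (negLapPow k u) s :=
      ContDiffOn.negLapPow (m := 2) hs k (by convert hu using 2; ring)
    rw [negLapPow_succ, negLapPow_succ']
    rw [← ih (hu.of_le (by gcongr; norm_num)) hφ.laplacian.neg
      (hc.mono' ((subset_tsupport _).trans (tsupport_laplacian_subset φ)))
      ((tsupport_laplacian_subset φ).trans hsub)]
    simp only [neg_mul, mul_neg, integral_neg]
    rw [integral_laplacian_mul_eq hs h2 (contDiff_infty.1 hφ 2) hc hsub]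

/-! ### Test functions -/

lemma exists_testFunction (n k : ℕ) (hk : 1 ≤ k) (p : ℝ) (hp : 1 < p) :
    ∃ φ : EuclideanSpace ℝ (Fin n) → ℝ, ∃ M : ℝ, ContDiff ℝ ∞ φ ∧ 0 < M ∧
      (∀ x, 0 ≤ φ x) ∧ (∀ x, φ x ≤ 1) ∧ (∀ x, ‖x‖ ≤ 1 → φ x = 1) ∧ (∀ x, 2 ≤ ‖x‖ → φ x = 0) ∧
      (∀ x, |negLapPow k φ x| ≤ M * φ x ^ (1 / p)) ∧ (∀ x, ‖x‖ ≤ 1 → negLapPow k φ x = 0) := by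
  let η : ContDiffBump (0 : EuclideanSpace ℝ (Fin n)) := ⟨3 / 2, 2, by norm_num, by norm_num⟩
  obtain ⟨m, hm⟩ := exists_nat_ge (2 * k / (p - 1))
  have hm' : (m + 2 * k : ℝ) ≤ m * p := by
    rw [div_le_iff₀ (by linarith)] at hm
    linarith
  obtain ⟨g, hg, hg'⟩ := exists_negLapPow_pow_eq (n := n) (η := η) η.contDiff k m
  have h2k : m + 2 * k ≠ 0 := by omega
  have hη0 : ∀ x, 2 ≤ ‖x‖ → η x = 0 := fun x hx =>
    η.zero_of_le_dist (by simpa [η] using hx)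
  have hη1 : ∀ x, ‖x‖ ≤ 3 / 2 → η x = 1 := fun x hx =>
    η.one_of_mem_closedBall (by simpa [η] using hx)
  obtain ⟨M, hM⟩ := (isCompact_closedBall (0 : EuclideanSpace ℝ (Fin n))
    2).exists_bound_of_continuousOn hg.continuous.continuousOn
  refine ⟨fun x => η x ^ (m + 2 * k), max M 1, η.contDiff.pow _, by positivity,
    fun x => pow_nonneg η.nonneg _, fun x => pow_le_one₀ η.nonneg η.le_one,
    fun x hx => by simp only [hη1 x (by linarith), one_pow],
    fun x hx => by simp only [hη0 x hx, zero_pow h2k], fun x => ?_, fun x hx => ?_⟩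
  · rw [hg']
    beta_reduce
    rcases le_or_gt 2 ‖x‖ with hx | hx
    · rcases Nat.eq_zero_or_pos m with rfl | hm0
      · exfalso
        have : (1 : ℝ) ≤ k := by exact_mod_cast hk
        rw [Nat.cast_zero, zero_add, zero_mul] at hm'
        linarith
      · rw [hη0 x hx, zero_pow hm0.ne', zero_pow h2k, zero_mul, abs_zero]
        positivity
    · have h1 : |g x| ≤ max M 1 := (hM x (by simpa using hx.le)).trans (le_max_left _ _)
      have hle : η x ^ m ≤ (η x ^ (m + 2 * k)) ^ (1 / p) := by
        rw [← Real.rpow_natCast, ← Real.rpow_natCast, ← Real.rpow_mul η.nonneg]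
        refine Real.rpow_le_rpow_of_exponent_ge' η.nonneg η.le_one (by positivity) ?_
        rw [mul_one_div, div_le_iff₀ (by linarith)]
        push_cast
        linarith
      rw [abs_mul, abs_of_nonneg (pow_nonneg η.nonneg _), mul_comm]
      exact mul_le_mul h1 hle (pow_nonneg η.nonneg _) (by positivity)
  · refine negLapPow_of_eventually_const hk (a := 1) ?_
    have : Metric.ball (0 : EuclideanSpace ℝ (Fin n)) (3 / 2) ∈ 𝓝 x :=
      Metric.isOpen_ball.mem_nhds (by simp; linarith)
    filter_upwards [this] with y hy
    rw [hη1 y (by simpa using (mem_ball_zero_iff.1 hy).le), one_pow]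

/-! ### Nonexistence in the subcritical and critical range -/

lemma le_add_rpow_mul_rpow {p l s : ℝ} (hp : 1 < p) (hl : 0 < l) (hs : 0 ≤ s) :
    s ≤ l + l ^ (1 - p) * s ^ p := by
  rcases le_or_gt s l with h | h
  · have : 0 ≤ l ^ (1 - p) * s ^ p := by positivity
    linarith
  · have hs0 : 0 < s := hl.trans h
    have h1 : s ^ (1 - p) ≤ l ^ (1 - p) :=
      Real.rpow_le_rpow_of_nonpos hl h.le (by linarith)
    have h2 : s ^ (1 - p) * s ^ p = s := by
      rw [← Real.rpow_add hs0]
      simp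
    have h3 := mul_le_mul_of_nonneg_right h1 (by positivity : 0 ≤ s ^ p)
    linarith

lemma rpow_mul_le_add_of_le {N K σ p l R r u w : ℝ} (hp : 1 < p) (hσ : 0 ≤ σ)
    (hcrit : (N - K) * p ≤ N - σ) (hl : 0 < l) (hR : 1 ≤ R) (hr : 0 < r) (hrR : r ≤ 2 * R)
    (hu : 0 ≤ u) (hw : 0 ≤ w) :
    R ^ (-K) * (u * w ^ (1 / p)) ≤
      l * R ^ (-N) + l ^ (1 - p) * 2 ^ σ * (r ^ (-σ) * u ^ p * w) := by
  have hR0 : 0 < R := by linarith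
  have h := le_add_rpow_mul_rpow hp hl
    (by positivity : 0 ≤ R ^ (N - K) * (u * w ^ (1 / p)))
  have hp0 : p ≠ 0 := by linarith
  have e : (R ^ (N - K) * (u * w ^ (1 / p))) ^ p = R ^ ((N - K) * p) * (u ^ p * w) := by
    rw [Real.mul_rpow (by positivity) (by positivity), Real.mul_rpow hu (by positivity),
      ← Real.rpow_mul hR0.le, ← Real.rpow_mul hw, one_div_mul_cancel hp0, Real.rpow_one]
  rw [e] at h
  have h1 : R ^ (-N) * R ^ ((N - K) * p) ≤ 2 ^ σ * r ^ (-σ) := by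
    rw [← Real.rpow_add hR0]
    calc R ^ (-N + (N - K) * p) ≤ R ^ (-σ) :=
          Real.rpow_le_rpow_of_exponent_le hR (by linarith)
      _ = 2 ^ σ * (2 * R) ^ (-σ) := by
          rw [Real.mul_rpow (by norm_num) hR0.le, ← mul_assoc, ← Real.rpow_add (by norm_num)]
          simp
      _ ≤ 2 ^ σ * r ^ (-σ) := by
          gcongr ?_ * ?_
          exact Real.rpow_le_rpow_of_nonpos hr hrR (by linarith)
  have h2 : R ^ (-N) * R ^ (N - K) = R ^ (-K) := by
    rw [← Real.rpow_add hR0]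
    congr 1
    ring
  have h3 := mul_le_mul_of_nonneg_left h (by positivity : 0 ≤ R ^ (-N))
  have h4 := mul_le_mul_of_nonneg_right h1
    (by positivity : 0 ≤ l ^ (1 - p) * (u ^ p * w))
  rw [← mul_assoc, h2] at h3
  calc _ ≤ _ := h3
    _ = l * R ^ (-N) + R ^ (-N) * R ^ ((N - K) * p) * (l ^ (1 - p) * (u ^ p * w)) := by ring
    _ ≤ l * R ^ (-N) + 2 ^ σ * r ^ (-σ) * (l ^ (1 - p) * (u ^ p * w)) := by gcongr
    _ = _ := by ring

lemma false_of_annulus_estimate {p κ a b : ℝ} (hp : 1 < p) (hκ : 0 < κ) (ha : 0 < a) (hb : 0 < b)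
    {I A J : ℝ → ℝ} (hJI : ∀ R, 1 ≤ R → J R ≤ I R) (hAI : ∀ R, 1 ≤ R → A R ≤ I R)
    (hA0 : ∀ R, 1 ≤ R → 0 ≤ A R) (hAJ : ∀ R, 1 ≤ R → A R ≤ J (2 * R) - J R)
    (hκJ : ∀ R, 1 ≤ R → κ ≤ J R)
    (hI : ∀ R, 1 ≤ R → ∀ l, 0 < l → I R ≤ a * l + b * l ^ (1 - p) * A R + κ / 4) : False := by
  obtain ⟨l, hl, hl0⟩ : ∃ l : ℝ, b * l ^ (1 - p) ≤ 1 / 2 ∧ 0 < l := by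
    have h := (tendsto_rpow_neg_atTop (by linarith : 0 < p - 1)).const_mul b
    rw [mul_zero] at h
    obtain ⟨l, h1, h2⟩ := ((h.eventually_le_const (by norm_num : (0 : ℝ) < 1 / 2)).and
      (eventually_gt_atTop 0)).exists
    exact ⟨l, by rwa [neg_sub] at h1, h2⟩
  have hbound : ∀ R, 1 ≤ R → J R ≤ 2 * (a * l + κ / 4) := by
    intro R hR
    have h1 := hI R hR l hl0
    have h2 := mul_le_mul_of_nonneg_right hl (hA0 R hR)
    linarith [hJI R hR, hAI R hR]
  have hl1 : 0 < κ / (4 * a) := by positivity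
  set B := b * (κ / (4 * a)) ^ (1 - p) with hB
  have hB0 : 0 < B := by positivity
  have hlow : ∀ R, 1 ≤ R → κ / 2 / B ≤ A R := by
    intro R hR
    have h1 := hI R hR _ hl1
    have h2 : a * (κ / (4 * a)) = κ / 4 := by field_simp
    rw [div_le_iff₀ hB0]
    rw [h2, ← hB] at h1
    linarith [hJI R hR, hκJ R hR]
  have hgrow : ∀ j : ℕ, j * (κ / 2 / B) ≤ J (2 ^ j) := by
    intro j
    induction j with
    | zero =>
      have := hκJ 1 le_rfl
      simp
      linarith
    | succ j ih =>
      have h1 : (1 : ℝ) ≤ 2 ^ j := one_le_pow₀ (by norm_num)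
      have h2 := hAJ _ h1
      have h3 := hlow _ h1
      rw [pow_succ']
      push_cast
      linarith
  obtain ⟨j, hj⟩ := exists_nat_gt (2 * (a * l + κ / 4) / (κ / 2 / B))
  rw [div_lt_iff₀ (by positivity)] at hj
  linarith [hgrow j, hbound (2 ^ j) (one_le_pow₀ (by norm_num))]

lemma continuousOn_weight {n : ℕ} (σ p : ℝ) {u : EuclideanSpace ℝ (Fin n) → ℝ}
    (hu : Continuous u) (hpos : ∀ x, 0 < u x) :
    ContinuousOn (fun x => ‖x‖ ^ (-σ) * u x ^ p) {0}ᶜ := by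
  refine ContinuousOn.mul ?_ ?_
  · exact continuousOn_id.norm.rpow_const fun x hx => Or.inl (norm_ne_zero_iff.2 hx)
  · exact hu.continuousOn.rpow_const fun x _ => Or.inl (hpos x).ne'

lemma integrableOn_annulus {n : ℕ} {f : EuclideanSpace ℝ (Fin n) → ℝ}
    (hf : ContinuousOn f {0}ᶜ) {a b : ℝ} (ha : 0 < a) :
    IntegrableOn f {x | a ≤ ‖x‖ ∧ ‖x‖ ≤ b} := by
  refine ContinuousOn.integrableOn_compact ?_ (hf.mono fun x hx => ?_)
  · refine (isCompact_closedBall (0 : EuclideanSpace ℝ (Fin n)) b).of_isClosed_subset ?_ ?_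
    · exact (isClosed_le continuous_const continuous_norm).inter
        (isClosed_le continuous_norm continuous_const)
    · exact fun x hx => by simpa using hx.2
  · exact norm_ne_zero_iff.1 (ha.trans_le hx.1).ne'

lemma volume_real_closedBall_zero (n : ℕ) {r : ℝ} (hr : 0 ≤ r) :
    volume.real (Metric.closedBall (0 : EuclideanSpace ℝ (Fin n)) r) =
      r ^ n * volume.real (Metric.ball (0 : EuclideanSpace ℝ (Fin n)) 1) := by
  simpa using Measure.addHaar_real_closedBall volume (0 : EuclideanSpace ℝ (Fin n)) hr

lemma hasCompactSupport_comp_inv_smul {n : ℕ} {φ : EuclideanSpace ℝ (Fin n) → ℝ}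
    (hφ : ∀ x, 2 ≤ ‖x‖ → φ x = 0) {R : ℝ} (hR : 0 < R) :
    HasCompactSupport fun x => φ (R⁻¹ • x) := by
  refine HasCompactSupport.intro (isCompact_closedBall 0 (2 * R)) fun x hx => hφ _ ?_
  rw [norm_smul, norm_inv, Real.norm_of_nonneg hR.le, inv_mul_eq_div, le_div_iff₀ hR]
  simpa using (not_le.1 (mt mem_closedBall_zero_iff.2 hx)).le

lemma integral_mul_negLapPow_small {n k : ℕ} (hn : 2 * k < n) {p M U : ℝ} (hp : 1 < p)
    {u φ : EuclideanSpace ℝ (Fin n) → ℝ} (hM : 0 < M) (hφ : ContDiff ℝ ∞ φ)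
    (hφ0 : ∀ x, 0 ≤ φ x) (hφ1 : ∀ x, φ x ≤ 1) (hφ2 : ∀ x, 2 ≤ ‖x‖ → φ x = 0)
    (hφM : ∀ x, |negLapPow k φ x| ≤ M * φ x ^ (1 / p))
    (hU : ∀ x, ‖x‖ ≤ 2 → |u x| ≤ U) {ε : ℝ} (hε : 0 < ε) (hε1 : ε ≤ 1) :
    |∫ x, u x * negLapPow k (fun y => φ (ε⁻¹ • y)) x| ≤
      U * M * 2 ^ n * volume.real (Metric.ball (0 : EuclideanSpace ℝ (Fin n)) 1) * ε := by
  have hU0 : 0 ≤ U := (abs_nonneg _).trans (hU 0 (by simp))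
  have hp0 : (0 : ℝ) < 1 / p := by positivity
  have hz : ∀ x, x ∉ Metric.closedBall (0 : EuclideanSpace ℝ (Fin n)) (2 * ε) →
      u x * negLapPow k (fun y => φ (ε⁻¹ • y)) x = 0 := by
    intro x hx
    have hx' : 2 ≤ ‖ε⁻¹ • x‖ := by
      rw [norm_smul, norm_inv, Real.norm_of_nonneg hε.le, inv_mul_eq_div, le_div_iff₀ hε]
      simpa using (not_le.1 (mt mem_closedBall_zero_iff.2 hx)).le
    have h1 := hφM (ε⁻¹ • x)
    rw [hφ2 _ hx', Real.zero_rpow hp0.ne', mul_zero] at h1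
    rw [negLapPow_comp_smul k hφ, abs_nonpos_iff.1 h1, mul_zero, mul_zero]
  rw [← setIntegral_eq_integral_of_forall_compl_eq_zero hz, ← Real.norm_eq_abs]
  have hb : ∀ x ∈ Metric.closedBall (0 : EuclideanSpace ℝ (Fin n)) (2 * ε),
      ‖u x * negLapPow k (fun y => φ (ε⁻¹ • y)) x‖ ≤ U * (ε⁻¹ ^ (2 * k) * M) := by
    intro x hx
    rw [norm_mul, Real.norm_eq_abs, Real.norm_eq_abs, negLapPow_comp_smul k hφ, abs_mul,
      abs_of_nonneg (by positivity : 0 ≤ ε⁻¹ ^ (2 * k))]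
    have h1 : |negLapPow k φ (ε⁻¹ • x)| ≤ M :=
      (hφM _).trans (mul_le_of_le_one_right hM.le (Real.rpow_le_one (hφ0 _) (hφ1 _) hp0.le))
    have h2 : |u x| ≤ U := hU x ((mem_closedBall_zero_iff.1 hx).trans (by linarith))
    gcongr
  refine (norm_setIntegral_le_of_norm_le_const measure_closedBall_lt_top hb).trans ?_
  rw [volume_real_closedBall_zero n (by positivity), mul_pow]
  set V := volume.real (Metric.ball (0 : EuclideanSpace ℝ (Fin n)) 1)
  have hV : 0 ≤ V := measureReal_nonneg
  have hpow : ε⁻¹ ^ (2 * k) * ε ^ n ≤ ε := by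
    obtain ⟨j, rfl⟩ := Nat.exists_eq_add_of_lt hn
    rw [add_assoc, pow_add, ← mul_assoc, ← mul_pow, inv_mul_cancel₀ hε.ne', one_pow, one_mul]
    exact pow_le_of_le_one hε.le hε1 (by simp)
  calc U * (ε⁻¹ ^ (2 * k) * M) * (2 ^ n * ε ^ n * V)
      = U * M * 2 ^ n * V * (ε⁻¹ ^ (2 * k) * ε ^ n) := by ring
    _ ≤ _ := by gcongr

lemma integral_mul_negLapPow_large {n k : ℕ} {σ p M l R : ℝ} (hp : 1 < p)
    (hσ : 0 ≤ σ) (hcrit : ((n : ℝ) - 2 * k) * p ≤ n - σ) (hl : 0 < l) (hR : 1 ≤ R)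
    {u φ : EuclideanSpace ℝ (Fin n) → ℝ} (hu : Continuous u) (hpos : ∀ x, 0 < u x) (hM : 0 < M)
    (hφ : ContDiff ℝ ∞ φ) (hφ0 : ∀ x, 0 ≤ φ x) (hφ2 : ∀ x, 2 ≤ ‖x‖ → φ x = 0)
    (hφM : ∀ x, |negLapPow k φ x| ≤ M * φ x ^ (1 / p))
    (hφz : ∀ x, ‖x‖ ≤ 1 → negLapPow k φ x = 0) :
    ∫ x, u x * negLapPow k (fun y => φ (R⁻¹ • y)) x ≤
      M * (l * (2 ^ n * volume.real (Metric.ball (0 : EuclideanSpace ℝ (Fin n)) 1)) +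
        l ^ (1 - p) * 2 ^ σ *
          ∫ x in {x | R < ‖x‖ ∧ ‖x‖ ≤ 2 * R}, ‖x‖ ^ (-σ) * u x ^ p * φ (R⁻¹ • x)) := by
  have hR0 : 0 < R := by linarith
  have hp0 : (0 : ℝ) < 1 / p := by positivity
  set S : Set (EuclideanSpace ℝ (Fin n)) := {x | R < ‖x‖ ∧ ‖x‖ ≤ 2 * R} with hS
  have hSm : MeasurableSet S :=
    (measurableSet_lt measurable_const measurable_norm).inter
      (measurableSet_le measurable_norm measurable_const)
  have hnorm : ∀ x : EuclideanSpace ℝ (Fin n), ‖R⁻¹ • x‖ = ‖x‖ / R := fun x => by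
    rw [norm_smul, norm_inv, Real.norm_of_nonneg hR0.le, inv_mul_eq_div]
  have hz : ∀ x, x ∉ S → u x * negLapPow k (fun y => φ (R⁻¹ • y)) x = 0 := by
    intro x hx
    rw [negLapPow_comp_smul k hφ]
    rcases le_or_gt ‖x‖ R with h | h
    · rw [hφz _ (by rwa [hnorm, div_le_one hR0]), mul_zero, mul_zero]
    · have h2 : 2 * R < ‖x‖ := not_le.1 fun h' => hx ⟨h, h'⟩
      have h1 := hφM (R⁻¹ • x)
      rw [hφ2 _ (by rw [hnorm, le_div_iff₀ hR0]; exact h2.le), Real.zero_rpow hp0.ne',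
        mul_zero] at h1
      rw [abs_nonpos_iff.1 h1, mul_zero, mul_zero]
  have hsub : S ⊆ {x | R ≤ ‖x‖ ∧ ‖x‖ ≤ 2 * R} := fun x hx => ⟨hx.1.le, hx.2⟩
  have hφR : ContDiff ℝ ∞ fun y => φ (R⁻¹ • y) := by fun_prop
  have hint1 : IntegrableOn (fun x => u x * negLapPow k (fun y => φ (R⁻¹ • y)) x) S :=
    (integrableOn_annulus (hu.mul (hφR.negLapPow k).continuous).continuousOn hR0).mono_set hsub
  have hint2 : IntegrableOn (fun x => ‖x‖ ^ (-σ) * u x ^ p * φ (R⁻¹ • x)) S :=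
    (integrableOn_annulus ((continuousOn_weight σ p hu hpos).mul
      hφR.continuous.continuousOn) hR0).mono_set hsub
  have hSvol : volume S < ⊤ := (measure_mono (fun x hx => by
    simpa using hx.2 : S ⊆ Metric.closedBall 0 (2 * R))).trans_lt measure_closedBall_lt_top
  have hint3 : IntegrableOn (fun _ : EuclideanSpace ℝ (Fin n) => l * R ^ (-(n : ℝ))) S :=
    integrableOn_const hSvol.ne
  rw [← setIntegral_eq_integral_of_forall_compl_eq_zero hz]
  have hmono : ∫ x in S, u x * negLapPow k (fun y => φ (R⁻¹ • y)) x ≤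
      ∫ x in S, M * (l * R ^ (-(n : ℝ)) + l ^ (1 - p) * 2 ^ σ *
        (‖x‖ ^ (-σ) * u x ^ p * φ (R⁻¹ • x))) := by
    refine setIntegral_mono_on hint1
      (Integrable.const_mul (hint3.add (hint2.const_mul _)) _) hSm fun x hx => ?_
    have h1 := rpow_mul_le_add_of_le (N := n) (K := 2 * k) hp hσ hcrit hl hR
      (hR0.trans hx.1) hx.2 (hpos x).le (hφ0 (R⁻¹ • x))
    have h2 : R ^ (-(2 * (k : ℝ))) = R⁻¹ ^ (2 * k) := by
      rw [Real.rpow_neg hR0.le, inv_pow]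
      congr 1
      exact_mod_cast Real.rpow_natCast R (2 * k)
    rw [negLapPow_comp_smul k hφ]
    calc u x * (R⁻¹ ^ (2 * k) * negLapPow k φ (R⁻¹ • x))
        ≤ u x * (R⁻¹ ^ (2 * k) * (M * φ (R⁻¹ • x) ^ (1 / p))) := by
          gcongr
          · exact (hpos x).le
          · exact (le_abs_self _).trans (hφM _)
      _ = M * (R ^ (-(2 * (k : ℝ))) * (u x * φ (R⁻¹ • x) ^ (1 / p))) := by rw [h2]; ring
      _ ≤ _ := by gcongr
  refine hmono.trans ?_
  rw [integral_const_mul, integral_add hint3 (hint2.const_mul _),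
    integral_const_mul (l ^ (1 - p) * 2 ^ σ),
    setIntegral_const, smul_eq_mul]
  gcongr M * (?_ + _)
  have hv : volume.real S ≤ (2 * R) ^ n *
      volume.real (Metric.ball (0 : EuclideanSpace ℝ (Fin n)) 1) := by
    rw [← volume_real_closedBall_zero n (by positivity)]
    exact measureReal_mono (fun x hx => by simpa using hx.2) measure_closedBall_lt_top.ne
  have hRn : R ^ n * R ^ (-(n : ℝ)) = 1 := by
    rw [Real.rpow_neg hR0.le, Real.rpow_natCast]
    exact mul_inv_cancel₀ (by positivity)
  calc volume.real S * (l * R ^ (-(n : ℝ)))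
      ≤ (2 * R) ^ n * volume.real (Metric.ball (0 : EuclideanSpace ℝ (Fin n)) 1) *
        (l * R ^ (-(n : ℝ))) := by gcongr
    _ = l * (2 ^ n * volume.real (Metric.ball (0 : EuclideanSpace ℝ (Fin n)) 1)) *
        (R ^ n * R ^ (-(n : ℝ))) := by rw [mul_pow]; ring
    _ = _ := by rw [hRn, mul_one]

theorem lt_of_exists_positive_solution {n k : ℕ} (hk : 1 ≤ k) (hn : 2 * k < n) {σ p : ℝ}
    (hσ0 : 0 ≤ σ) (hp : 1 < p) {c u : EuclideanSpace ℝ (Fin n) → ℝ}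
    (hc : DoubleBounded c) (hpos : ∀ x, 0 < u x) (hu : Continuous u)
    (hu' : ContDiffOn ℝ (2 * k : ℕ) u {(0 : EuclideanSpace ℝ (Fin n))}ᶜ)
    (heq : ∀ x : EuclideanSpace ℝ (Fin n), x ≠ 0 →
      negLapPow k u x = c x * ‖x‖ ^ (-σ) * u x ^ p) :
    ((n : ℝ) - σ) / ((n : ℝ) - 2 * (k : ℝ)) < p := by
  by_contra hcon
  have hnk : (0 : ℝ) < n - 2 * k := by
    have : ((2 * k : ℕ) : ℝ) < n := by exact_mod_cast hn
    push_cast at this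
    linarith
  have hcrit : ((n : ℝ) - 2 * k) * p ≤ n - σ := by
    rw [not_lt, le_div_iff₀ hnk] at hcon
    linarith
  obtain ⟨C, hC, hcC⟩ := hc
  obtain ⟨φ, M, hφ, hM, hφ0, hφ1, hφ1', hφ2, hφM, hφz⟩ := exists_testFunction n k hk p hp
  obtain ⟨U, hU⟩ := (isCompact_closedBall (0 : EuclideanSpace ℝ (Fin n))
    2).exists_bound_of_continuousOn hu.continuousOn
  have hU' : ∀ x, ‖x‖ ≤ 2 → |u x| ≤ U := fun x hx => hU x (by simpa using hx)
  have hU0 : 0 ≤ U := (abs_nonneg _).trans (hU' 0 (by simp))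
  set V := volume.real (Metric.ball (0 : EuclideanSpace ℝ (Fin n)) 1) with hVdef
  have hV : 0 < V := ENNReal.toReal_pos (Metric.measure_ball_pos _ _ one_pos).ne' measure_ball_lt_top.ne
  set g : EuclideanSpace ℝ (Fin n) → ℝ := fun x => ‖x‖ ^ (-σ) * u x ^ p with hg
  have hgc : ContinuousOn g {0}ᶜ := continuousOn_weight σ p hu hpos
  have hg0 : ∀ x, 0 ≤ g x := fun x => by have := (hpos x).le; positivity
  have hgpos : ∀ x, x ≠ 0 → 0 < g x := fun x hx => by
    have := hpos x
    have := norm_pos_iff.2 hx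
    positivity
  set J : ℝ → ℝ := fun R => ∫ x in {x | 1 / 2 ≤ ‖x‖ ∧ ‖x‖ ≤ R}, g x with hJ
  have hJint : ∀ R, IntegrableOn g {x | 1 / 2 ≤ ‖x‖ ∧ ‖x‖ ≤ R} := fun R =>
    integrableOn_annulus hgc (by norm_num)
  have hκ : 0 < J 1 := by
    simp only [hJ]
    rw [setIntegral_pos_iff_support_of_nonneg_ae (Eventually.of_forall hg0) (hJint 1)]
    let W : Set (EuclideanSpace ℝ (Fin n)) := {x | 1 / 2 < ‖x‖ ∧ ‖x‖ < 1}
    have hW : IsOpen W := (isOpen_lt continuous_const continuous_norm).inter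
      (isOpen_lt continuous_norm continuous_const)
    have hWne : W.Nonempty := by
      refine ⟨EuclideanSpace.single (⟨0, by omega⟩ : Fin n) (3 / 4 : ℝ), ?_, ?_⟩ <;>
        · rw [PiLp.norm_single]
          norm_num
    refine (hW.measure_pos volume hWne).trans_le (measure_mono fun x hx => ⟨?_, hx.1.le, hx.2.le⟩)
    have hx1 : 1 / 2 < ‖x‖ := hx.1
    exact (hgpos x (norm_pos_iff.1 (by linarith))).ne'
  set κ := J 1 with hκdef
  obtain ⟨ε, hε, hε4, hεκ⟩ : ∃ ε : ℝ, 0 < ε ∧ ε ≤ 1 / 4 ∧ C * (U * M * 2 ^ n * V * ε) ≤ κ / 4 := by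
    set B := C * (U * M * 2 ^ n * V) with hB
    have hB0 : 0 ≤ B := by positivity
    refine ⟨min (1 / 4) (κ / 4 / (B + 1)), by positivity, min_le_left _ _, ?_⟩
    calc C * (U * M * 2 ^ n * V * min (1 / 4) (κ / 4 / (B + 1)))
        = B * min (1 / 4) (κ / 4 / (B + 1)) := by rw [hB]; ring
      _ ≤ (B + 1) * (κ / 4 / (B + 1)) := by
          gcongr
          · linarith
          · exact min_le_right _ _
      _ = κ / 4 := by field_simp
  have hε' := integral_mul_negLapPow_small hn hp hM hφ hφ0 hφ1 hφ2 hφM hU' hε (by linarith)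
  set Φ : ℝ → EuclideanSpace ℝ (Fin n) → ℝ := fun R x => φ (R⁻¹ • x) - φ (ε⁻¹ • x) with hΦ
  have hnorm : ∀ R : ℝ, 0 < R → ∀ x : EuclideanSpace ℝ (Fin n), ‖R⁻¹ • x‖ = ‖x‖ / R :=
    fun R hR0 x => by rw [norm_smul, norm_inv, Real.norm_of_nonneg hR0.le, inv_mul_eq_div]
  have hone : ∀ R : ℝ, 0 < R → ∀ x : EuclideanSpace ℝ (Fin n), ‖x‖ ≤ R → φ (R⁻¹ • x) = 1 :=
    fun R hR0 x hx => hφ1' _ (by rwa [hnorm R hR0, div_le_one hR0])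
  have hzero : ∀ x : EuclideanSpace ℝ (Fin n), 1 / 2 ≤ ‖x‖ → φ (ε⁻¹ • x) = 0 :=
    fun x hx => hφ2 _ (by rw [hnorm ε hε, le_div_iff₀ hε]; linarith)
  have hΦ0 : ∀ R, 1 ≤ R → ∀ x, 0 ≤ Φ R x := by
    intro R hR x
    simp only [hΦ]
    rcases le_or_gt ‖x‖ R with h | h
    · rw [hone R (by linarith) x h]
      linarith [hφ1 (ε⁻¹ • x)]
    · rw [hzero x (by linarith), sub_zero]
      exact hφ0 _
  have hΦs : ∀ R, ContDiff ℝ ∞ (Φ R) := fun R => by fun_prop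
  have hΦc : ∀ R, 1 ≤ R → HasCompactSupport (Φ R) := fun R hR =>
    (hasCompactSupport_comp_inv_smul hφ2 (by linarith : 0 < R)).sub
      (hasCompactSupport_comp_inv_smul hφ2 hε)
  have hΦsub : ∀ R, 1 ≤ R → tsupport (Φ R) ⊆ {0}ᶜ := by
    intro R hR x hx h0
    rw [mem_singleton_iff] at h0
    subst h0
    refine (notMem_tsupport_iff_eventuallyEq.2 ?_) hx
    filter_upwards [Metric.ball_mem_nhds (0 : EuclideanSpace ℝ (Fin n)) hε] with y hy
    have hy' : ‖y‖ < ε := by simpa using hy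
    simp only [hΦ, Pi.zero_apply]
    rw [hone R (by linarith) y (by linarith), hone ε hε y hy'.le, sub_self]
  have hopen : IsOpen ({0}ᶜ : Set (EuclideanSpace ℝ (Fin n))) := isOpen_compl_singleton
  have hgΦ : ∀ R, 1 ≤ R → Integrable fun x => g x * Φ R x := fun R hR =>
    integrable_mul_of_tsupport_subset hopen hgc (hΦs R).continuous (hΦc R hR) (hΦsub R hR)
  have hgΦ0 : ∀ R, 1 ≤ R → ∀ x, 0 ≤ g x * Φ R x := fun R hR x =>
    mul_nonneg (hg0 x) (hΦ0 R hR x)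
  set I : ℝ → ℝ := fun R => ∫ x, g x * Φ R x with hI
  set S : ℝ → Set (EuclideanSpace ℝ (Fin n)) := fun R => {x | R < ‖x‖ ∧ ‖x‖ ≤ 2 * R} with hS
  have hSm : ∀ R, MeasurableSet (S R) := fun R =>
    (measurableSet_lt measurable_const measurable_norm).inter
      (measurableSet_le measurable_norm measurable_const)
  have hSm' : ∀ R, MeasurableSet {x : EuclideanSpace ℝ (Fin n) | 1 / 2 ≤ ‖x‖ ∧ ‖x‖ ≤ R} :=
    fun R => (measurableSet_le measurable_const measurable_norm).inter
      (measurableSet_le measurable_norm measurable_const)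
  set A : ℝ → ℝ := fun R => ∫ x in S R, ‖x‖ ^ (-σ) * u x ^ p * φ (R⁻¹ • x) with hA
  have hAeq : ∀ R, 1 ≤ R → A R = ∫ x in S R, g x * Φ R x := by
    intro R hR
    refine setIntegral_congr_fun (hSm R) fun x hx => ?_
    have hx1 : R < ‖x‖ := hx.1
    simp only [hg, hΦ, hzero x (by linarith), sub_zero]
  refine false_of_annulus_estimate (a := C * (M * (2 ^ n * V))) (b := C * (M * 2 ^ σ)) (κ := κ)
    (I := I) (A := A) (J := J) hp hκ (by positivity) (by positivity) ?_ ?_ ?_ ?_ ?_ ?_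
  · intro R hR
    calc J R = ∫ x in {x | 1 / 2 ≤ ‖x‖ ∧ ‖x‖ ≤ R}, g x * Φ R x := by
          refine setIntegral_congr_fun (hSm' R) fun x hx => ?_
          simp only [hΦ]
          rw [hzero x hx.1, hone R (by linarith) x hx.2, sub_zero, mul_one]
      _ ≤ I R := setIntegral_le_integral (hgΦ R hR) (Eventually.of_forall (hgΦ0 R hR))
  · intro R hR
    rw [hAeq R hR]
    exact setIntegral_le_integral (hgΦ R hR) (Eventually.of_forall (hgΦ0 R hR))
  · intro R hR
    rw [hAeq R hR]
    exact integral_nonneg fun x => hgΦ0 R hR x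
  · intro R hR
    have hunion : {x : EuclideanSpace ℝ (Fin n) | 1 / 2 ≤ ‖x‖ ∧ ‖x‖ ≤ 2 * R} =
        {x | 1 / 2 ≤ ‖x‖ ∧ ‖x‖ ≤ R} ∪ S R := by
      ext x
      simp only [hS, mem_union, mem_ofPred_eq]
      constructor
      · rintro ⟨h1, h2⟩
        rcases le_or_gt ‖x‖ R with h | h
        · exact Or.inl ⟨h1, h⟩
        · exact Or.inr ⟨h, h2⟩
      · rintro (⟨h1, h2⟩ | ⟨h1, h2⟩)
        · exact ⟨h1, by linarith⟩
        · exact ⟨by linarith, h2⟩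
    have hdisj : Disjoint {x : EuclideanSpace ℝ (Fin n) | 1 / 2 ≤ ‖x‖ ∧ ‖x‖ ≤ R} (S R) :=
      Set.disjoint_left.2 fun x h1 h2 => absurd h2.1 (not_lt.2 h1.2)
    have hSint : IntegrableOn g (S R) := (hJint (2 * R)).mono_set (by
      rw [hunion]
      exact subset_union_right)
    have : J (2 * R) = J R + ∫ x in S R, g x := by
      simp only [hJ]
      rw [hunion, setIntegral_union hdisj (hSm R) (hJint R) hSint]
    rw [this, hAeq R hR, add_sub_cancel_left]
    refine setIntegral_mono_on (hgΦ R hR).integrableOn hSint (hSm R) fun x hx => ?_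
    refine mul_le_of_le_one_right (hg0 x) ?_
    simp only [hΦ]
    linarith [hφ1 (R⁻¹ • x), hφ0 (ε⁻¹ • x)]
  · intro R hR
    exact setIntegral_mono_set (hJint R) (Eventually.of_forall hg0)
      (Eventually.of_forall fun x hx => ⟨hx.1, hx.2.trans hR⟩)
  · intro R hR l hl
    have hlarge := integral_mul_negLapPow_large hp hσ0 hcrit hl hR hu hpos hM hφ hφ0 hφ2 hφM hφz
    have hparts := integral_negLapPow_mul_eq hopen k hu' (hΦs R) (hΦc R hR) (hΦsub R hR)
    have hsR : ∀ R : ℝ, ContDiff ℝ ∞ fun y : EuclideanSpace ℝ (Fin n) => φ (R⁻¹ • y) :=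
      fun R => by fun_prop
    have hintR : ∀ R : ℝ, 0 < R →
        Integrable fun x => u x * negLapPow k (fun y => φ (R⁻¹ • y)) x := by
      intro R hR0
      refine Continuous.integrable_of_hasCompactSupport
        (hu.mul ((hsR R).negLapPow k).continuous) (HasCompactSupport.mul_left ?_)
      refine HasCompactSupport.intro (isCompact_closedBall 0 (2 * R)) fun x hx => ?_
      rw [negLapPow_comp_smul k hφ]
      have h1 := hφM (R⁻¹ • x)
      rw [hφ2 _ (by
        rw [hnorm R hR0, le_div_iff₀ hR0]
        exact (not_le.1 (mt mem_closedBall_zero_iff.2 hx)).le),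
        Real.zero_rpow (by positivity), mul_zero] at h1
      rw [abs_nonpos_iff.1 h1, mul_zero]
    have hsplit : ∫ x, u x * negLapPow k (Φ R) x =
        (∫ x, u x * negLapPow k (fun y => φ (R⁻¹ • y)) x) -
          ∫ x, u x * negLapPow k (fun y => φ (ε⁻¹ • y)) x := by
      rw [← integral_sub (hintR R (by linarith)) (hintR ε hε)]
      refine integral_congr_ae (Eventually.of_forall fun x => ?_)
      simp only [hΦ]
      rw [negLapPow_sub k (hsR R) (hsR ε), mul_sub]
    have hlower : I R ≤ C * ∫ x, negLapPow k u x * Φ R x := by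
      rw [← integral_const_mul]
      have hcontL : ContinuousOn (negLapPow k u) {0}ᶜ :=
        (ContDiffOn.negLapPow (m := 0) hopen k (by simpa using hu')).continuousOn
      refine integral_mono (hgΦ R hR) ((integrable_mul_of_tsupport_subset hopen hcontL
        (hΦs R).continuous (hΦc R hR) (hΦsub R hR)).const_mul C) fun x => ?_
      rcases eq_or_ne x 0 with rfl | hx
      · have : Φ R 0 = 0 :=
          image_eq_zero_of_notMem_tsupport fun h => hΦsub R hR h rfl
        simp [this]
      · have h1 : 1 ≤ C * c x := by
          have := (hcC x).1
          rw [div_le_iff₀ hC] at this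
          linarith
        beta_reduce
        rw [heq x hx]
        calc g x * Φ R x ≤ C * c x * (g x * Φ R x) := le_mul_of_one_le_left (hgΦ0 R hR x) h1
          _ = _ := by simp only [hg]; ring
    rw [hparts, hsplit] at hlower
    have h1 := neg_abs_le (∫ x, u x * negLapPow k (fun y => φ (ε⁻¹ • y)) x)
    have h2 := mul_le_mul_of_nonneg_left
      (sub_le_sub hlarge (h1.trans' (neg_le_neg hε'))) hC.le
    refine hlower.trans (h2.trans ?_)
    rw [← hVdef]
    have e : C * (M * (l * (2 ^ n * V) + l ^ (1 - p) * 2 ^ σ * A R) - -(U * M * 2 ^ n * V * ε)) =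
      C * (M * (2 ^ n * V)) * l + C * (M * 2 ^ σ) * l ^ (1 - p) * A R +
        C * (U * M * 2 ^ n * V * ε) := by ring
    linarith

/-! ### Radial functions -/

lemma hasFDerivAt_comp_norm {n : ℕ} {g : ℝ → ℝ} {g' : ℝ} {x : EuclideanSpace ℝ (Fin n)}
    (hx : x ≠ 0) (hg : HasDerivAt g g' ‖x‖) :
    HasFDerivAt (fun y : EuclideanSpace ℝ (Fin n) => g ‖y‖)
      ((g' * ‖x‖⁻¹) • innerSL ℝ x) x := by
  have hx0 : 0 < ‖x‖ := norm_pos_iff.2 hx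
  have h1 : HasFDerivAt (fun y : EuclideanSpace ℝ (Fin n) => ‖y‖)
      (‖x‖⁻¹ • innerSL ℝ x) x := by
    have h2 := (hasStrictFDerivAt_norm_sq x).hasFDerivAt.sqrt (by positivity)
    simp only [Real.sqrt_sq (norm_nonneg _)] at h2
    have e : (1 / (2 * ‖x‖)) • (2 • innerSL ℝ x) = ‖x‖⁻¹ • innerSL ℝ x := by
      rw [← Nat.cast_smul_eq_nsmul ℝ 2, smul_smul]
      congr 1
      push_cast
      field_simp
    rwa [e] at h2
  have h2 := hg.comp_hasFDerivAt x h1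
  rwa [smul_smul] at h2

lemma laplacian_comp_norm {n : ℕ} {g g₁ g₂ : ℝ → ℝ} (hg : ContDiffOn ℝ 2 g (Ioi 0))
    (h₁ : ∀ r, 0 < r → HasDerivAt g (g₁ r) r) (h₂ : ∀ r, 0 < r → HasDerivAt g₁ (g₂ r) r)
    {x : EuclideanSpace ℝ (Fin n)} (hx : x ≠ 0) :
    laplacian (fun y => g ‖y‖) x = g₂ ‖x‖ + ((n : ℝ) - 1) / ‖x‖ * g₁ ‖x‖ := by
  have hx0 : 0 < ‖x‖ := norm_pos_iff.2 hx
  have hc : ContDiffAt ℝ 2 (fun y : EuclideanSpace ℝ (Fin n) => g ‖y‖) x :=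
    (hg.contDiffAt (Ioi_mem_nhds hx0)).comp x (contDiffAt_norm ℝ hx)
  rw [laplacian_eq_sum_fderiv hc]
  have hH : HasDerivAt (fun r => g₁ r * r⁻¹)
      (g₂ ‖x‖ * ‖x‖⁻¹ + g₁ ‖x‖ * (-(‖x‖ ^ 2)⁻¹)) ‖x‖ :=
    (h₂ _ hx0).mul (hasDerivAt_inv hx0.ne')
  have key : ∀ i : Fin n,
      fderiv ℝ (fun y => fderiv ℝ (fun y => g ‖y‖) y (EuclideanSpace.single i 1)) x
        (EuclideanSpace.single i 1) =
      (g₂ ‖x‖ * ‖x‖⁻¹ + g₁ ‖x‖ * (-(‖x‖ ^ 2)⁻¹)) * ‖x‖⁻¹ * x i ^ 2 + g₁ ‖x‖ * ‖x‖⁻¹ := by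
    intro i
    have e : (fun y : EuclideanSpace ℝ (Fin n) =>
        fderiv ℝ (fun y => g ‖y‖) y (EuclideanSpace.single i 1)) =ᶠ[𝓝 x]
        fun y => g₁ ‖y‖ * ‖y‖⁻¹ * EuclideanSpace.proj (𝕜 := ℝ) i y := by
      filter_upwards [isOpen_compl_singleton.mem_nhds hx] with y hy
      rw [(hasFDerivAt_comp_norm hy (h₁ _ (norm_pos_iff.2 hy))).fderiv]
      simp [EuclideanSpace.inner_single_right]
    have e' : (fun y : EuclideanSpace ℝ (Fin n) =>
        g₁ ‖y‖ * ‖y‖⁻¹ * EuclideanSpace.proj (𝕜 := ℝ) i y) =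
        (fun y => g₁ ‖y‖ * ‖y‖⁻¹) * ⇑(EuclideanSpace.proj (𝕜 := ℝ) i) := rfl
    rw [e.fderiv_eq, e', ((hasFDerivAt_comp_norm hx hH).mul
      (EuclideanSpace.proj (𝕜 := ℝ) i).hasFDerivAt).fderiv]
    simp [EuclideanSpace.inner_single_right]
    ring
  simp only [key]
  rw [Finset.sum_add_distrib, ← Finset.mul_sum, ← EuclideanSpace.real_norm_sq_eq]
  simp
  field_simp
  ring

lemma contDiffOn_of_hasDerivAt {g g' : ℝ → ℝ} (h : ∀ r, 0 < r → HasDerivAt g (g' r) r)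
    (hg' : ContDiffOn ℝ ∞ g' (Ioi 0)) : ContDiffOn ℝ ∞ g (Ioi 0) := by
  rw [contDiffOn_infty_iff_deriv_of_isOpen isOpen_Ioi]
  exact ⟨fun r hr => (h r hr).differentiableAt.differentiableWithinAt,
    hg'.congr fun r hr => (h r hr).deriv⟩

/-! ### Comparison of primitives on the half-line -/

lemma monotoneOn_Ioi_of_hasDerivAt {f f' : ℝ → ℝ} (hf : ∀ r, 0 < r → HasDerivAt f (f' r) r)
    (h : ∀ r, 0 < r → 0 ≤ f' r) : MonotoneOn f (Ioi 0) := by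
  refine monotoneOn_of_deriv_nonneg (convex_Ioi 0)
    (fun r hr => (hf r hr).continuousAt.continuousWithinAt) ?_ ?_
  · intro r hr
    rw [interior_Ioi] at hr
    exact (hf r hr).differentiableAt.differentiableWithinAt
  · intro r hr
    rw [interior_Ioi] at hr
    rw [(hf r hr).deriv]
    exact h r hr

lemma le_of_deriv_le_of_tendsto_zero {f f' g g' : ℝ → ℝ}
    (hf : ∀ r, 0 < r → HasDerivAt f (f' r) r) (hg : ∀ r, 0 < r → HasDerivAt g (g' r) r)
    (hle : ∀ r, 0 < r → f' r ≤ g' r) (hf0 : Tendsto f (𝓝[>] 0) (𝓝 0))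
    (hg0 : Tendsto g (𝓝[>] 0) (𝓝 0)) {r : ℝ} (hr : 0 < r) : f r ≤ g r := by
  have hm := monotoneOn_Ioi_of_hasDerivAt (fun r hr => (hg r hr).sub (hf r hr))
    fun r hr => sub_nonneg.2 (hle r hr)
  have ht : Tendsto (g - f) (𝓝[>] 0) (𝓝 0) := by
    have h0 := hg0.sub hf0
    rw [sub_zero] at h0
    exact h0
  have : (0 : ℝ) ≤ (g - f) r := by
    refine le_of_tendsto ht ?_
    filter_upwards [Ioo_mem_nhdsGT hr] with s hs
    exact hm hs.1 hr hs.2.le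
  exact sub_nonneg.1 this

lemma le_of_deriv_le_of_tendsto_atTop {f f' g g' : ℝ → ℝ}
    (hf : ∀ r, 0 < r → HasDerivAt f (f' r) r) (hg : ∀ r, 0 < r → HasDerivAt g (g' r) r)
    (hle : ∀ r, 0 < r → g' r ≤ f' r) (hf0 : Tendsto f atTop (𝓝 0))
    (hg0 : Tendsto g atTop (𝓝 0)) {r : ℝ} (hr : 0 < r) : f r ≤ g r := by
  have hm := monotoneOn_Ioi_of_hasDerivAt (fun r hr => (hf r hr).sub (hg r hr))
    fun r hr => sub_nonneg.2 (hle r hr)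
  have ht : Tendsto (f - g) atTop (𝓝 0) := by
    rw [← sub_zero (0 : ℝ)]
    exact hf0.sub hg0
  have : (f - g) r ≤ 0 := by
    refine ge_of_tendsto ht ?_
    filter_upwards [eventually_ge_atTop r] with s hs
    exact hm hr (hr.trans_le hs) hs
  exact sub_nonpos.1 this

lemma exists_primitive_tendsto_zero {h : ℝ → ℝ} (hc : ContinuousOn h (Ioi 0)) {B q : ℝ}
    (hq : -1 < q) (hB : ∀ r, 0 < r → |h r| ≤ B * r ^ q) :
    ∃ H : ℝ → ℝ, (∀ r, 0 < r → HasDerivAt H (h r) r) ∧ Tendsto H (𝓝[>] 0) (𝓝 0) := by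
  have hInt : ∀ r, 0 < r → IntervalIntegrable h volume 0 r := by
    intro r hr
    rw [intervalIntegrable_iff, uIoc_of_le hr.le]
    have h1 := (intervalIntegral.intervalIntegrable_rpow' (a := 0) (b := r) hq).const_mul B
    rw [intervalIntegrable_iff, uIoc_of_le hr.le] at h1
    refine Integrable.mono' h1 ((hc.mono Ioc_subset_Ioi_self).aestronglyMeasurable
      measurableSet_Ioc) ?_
    exact (ae_restrict_iff' measurableSet_Ioc).2 (Eventually.of_forall fun t ht => hB t ht.1)
  refine ⟨fun r => ∫ t in (0 : ℝ)..r, h t, fun r hr => ?_, ?_⟩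
  · exact intervalIntegral.integral_hasDerivAt_right (hInt r hr)
      (hc.stronglyMeasurableAtFilter isOpen_Ioi r hr) (hc.continuousAt (Ioi_mem_nhds hr))
  · have h1 := intervalIntegral.continuousOn_primitive_interval' (hInt 1 one_pos)
      (left_mem_uIcc)
    have h2 := (h1 0 left_mem_uIcc).tendsto
    rw [intervalIntegral.integral_same, uIcc_of_le zero_le_one] at h2
    refine h2.mono_left ?_
    rw [← nhdsWithin_Ioc_eq_nhdsGT (zero_lt_one' ℝ)]
    exact nhdsWithin_mono _ Ioc_subset_Icc_self

lemma exists_primitive_tendsto_atTop {h : ℝ → ℝ} (hc : ContinuousOn h (Ioi 0)) {B q : ℝ}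
    (hq : q < -1) (hB : ∀ r, 0 < r → |h r| ≤ B * r ^ q) :
    ∃ H : ℝ → ℝ, (∀ r, 0 < r → HasDerivAt H (h r) r) ∧ Tendsto H atTop (𝓝 0) := by
  have hInt : IntegrableOn h (Ioi 1) := by
    refine Integrable.mono' ((integrableOn_Ioi_rpow_of_lt hq one_pos).const_mul B)
      ((hc.mono (Ioi_subset_Ioi zero_le_one)).aestronglyMeasurable measurableSet_Ioi) ?_
    exact (ae_restrict_iff' measurableSet_Ioi).2
      (Eventually.of_forall fun t ht => hB t (one_pos.trans ht))
  refine ⟨fun r => (∫ t in (1 : ℝ)..r, h t) - ∫ t in Ioi 1, h t, fun r hr => ?_, ?_⟩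
  · refine (intervalIntegral.integral_hasDerivAt_right ?_
      (hc.stronglyMeasurableAtFilter isOpen_Ioi r hr)
      (hc.continuousAt (Ioi_mem_nhds hr))).sub_const _
    refine (hc.mono fun t ht => ?_).intervalIntegrable
    exact (lt_min one_pos hr).trans_le ht.1
  · simpa using (intervalIntegral_tendsto_integral_Ioi 1 hInt tendsto_id).sub_const
      (∫ t in Ioi 1, h t)

/-! ### Radial potentials -/

lemma hasDerivAt_one_add_sq_rpow (s r : ℝ) :
    HasDerivAt (fun r : ℝ => (1 + r ^ 2) ^ s) (2 * s * r * (1 + r ^ 2) ^ (s - 1)) r := by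
  have h1 : HasDerivAt (fun r : ℝ => 1 + r ^ 2) (2 * r) r := by
    simpa using (hasDerivAt_pow 2 r).const_add 1
  have h2 := h1.rpow_const (p := s) (Or.inl (by positivity))
  convert h2 using 1
  ring

lemma tendsto_one_add_sq_rpow_atTop {s : ℝ} (hs : s < 0) :
    Tendsto (fun r : ℝ => (1 + r ^ 2) ^ s) atTop (𝓝 0) := by
  have h1 : Tendsto (fun r : ℝ => 1 + r ^ 2) atTop atTop :=
    tendsto_atTop_add_const_left _ _ (tendsto_pow_atTop two_ne_zero)
  have h2 := (tendsto_rpow_neg_atTop (neg_pos.2 hs)).comp h1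
  simpa [Function.comp_def] using h2

lemma hasDerivAt_const_mul_rpow (K s : ℝ) {r : ℝ} (hr : 0 < r) :
    HasDerivAt (fun r : ℝ => K * r ^ s) (K * s * r ^ (s - 1)) r := by
  simpa [mul_assoc] using (Real.hasDerivAt_rpow_const (p := s) (Or.inl hr.ne')).const_mul K

lemma tendsto_const_mul_rpow_zero (K : ℝ) {s : ℝ} (hs : 0 < s) :
    Tendsto (fun r : ℝ => K * r ^ s) (𝓝[>] 0) (𝓝 0) := by
  have h1 := ((Real.continuousAt_rpow_const 0 s (Or.inr hs.le)).tendsto.const_mul K).mono_left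
    (nhdsWithin_le_nhds (s := Ioi 0))
  simpa [Real.zero_rpow hs.ne'] using h1

/-- Solution of `-Δ (g ∘ ‖·‖) = f ∘ ‖·‖` on the punctured space, vanishing at infinity. -/
lemma exists_radial_potential {N : ℕ} {f : ℝ → ℝ} (hf : ContDiffOn ℝ ∞ f (Ioi 0))
    {b c A : ℝ} (hb2 : 2 < b) (hbn : b < N + 1) (hc : 0 < c)
    (hlow : ∀ r, 0 < r → c * (1 + r ^ 2) ^ (-(b / 2)) ≤ f r)
    (hup : ∀ r, 0 < r → f r ≤ A * r ^ (-b)) :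
    ∃ g g₁ : ℝ → ℝ, ContDiffOn ℝ ∞ g (Ioi 0) ∧ (∀ r, 0 < r → HasDerivAt g (g₁ r) r) ∧
      (∀ r, 0 < r → g₁ r ≤ 0) ∧ Tendsto g atTop (𝓝 0) ∧
      (∀ r, 0 < r → c / ((N + 1) * (b - 2)) * (1 + r ^ 2) ^ (-((b - 2) / 2)) ≤ g r) ∧
      (∀ e B : ℝ, e < N + 1 → (∀ r, 0 < r → f r ≤ B * r ^ (-e)) →
        ∀ r, 0 < r → -(B / (N + 1 - e)) * r ^ (1 - e) ≤ g₁ r) ∧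
      ∀ x : EuclideanSpace ℝ (Fin (N + 1)), x ≠ 0 →
        -laplacian (fun y => g ‖y‖) x = f ‖x‖ := by
  have hf0 : ∀ r, 0 < r → 0 < f r := fun r hr => lt_of_lt_of_le (by positivity) (hlow r hr)
  have hpow : ∀ (r e : ℝ), 0 < r → r ^ N * r ^ (-e) = r ^ ((N : ℝ) - e) := by
    intro r e hr
    rw [← Real.rpow_natCast, ← Real.rpow_add hr]
    ring_nf
  obtain ⟨F, hF, hF0⟩ := exists_primitive_tendsto_zero (h := fun r => r ^ N * f r)
    (B := A) (q := (N : ℝ) - b) ((continuous_pow N).continuousOn.mul hf.continuousOn)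
    (by linarith) (by
      intro r hr
      have h1 := hf0 r hr
      rw [abs_of_pos (by positivity), ← hpow r b hr]
      nlinarith [hup r hr, pow_pos hr N])
  have hFup : ∀ e B : ℝ, e < N + 1 → (∀ r, 0 < r → f r ≤ B * r ^ (-e)) →
      ∀ r, 0 < r → F r ≤ B / (N + 1 - e) * r ^ ((N : ℝ) + 1 - e) := by
    intro e B he hB r hr
    refine le_of_deriv_le_of_tendsto_zero hF
      (fun r hr => hasDerivAt_const_mul_rpow (B / (N + 1 - e)) ((N : ℝ) + 1 - e) hr) ?_ hF0
      (tendsto_const_mul_rpow_zero _ (by linarith)) hr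
    intro r hr
    have h1 : (N : ℝ) + 1 - e ≠ 0 := by linarith
    rw [div_mul_cancel₀ _ h1, show (N : ℝ) + 1 - e - 1 = N - e by ring, ← hpow r e hr]
    nlinarith [hB r hr, pow_pos hr N]
  have hFlow : ∀ r, 0 < r → c / (N + 1) * r ^ (N + 1) * (1 + r ^ 2) ^ (-(b / 2)) ≤ F r := by
    intro r hr
    have hd : ∀ r : ℝ, HasDerivAt (fun r : ℝ => c / (N + 1) * r ^ (N + 1) *
        (1 + r ^ 2) ^ (-(b / 2))) (c * r ^ N * (1 + r ^ 2) ^ (-(b / 2)) +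
        c / (N + 1) * r ^ (N + 1) * (2 * (-(b / 2)) * r * (1 + r ^ 2) ^ (-(b / 2) - 1))) r := by
      intro r
      have h1 : HasDerivAt (fun r : ℝ => c / (N + 1) * r ^ (N + 1)) (c * r ^ N) r := by
        refine ((hasDerivAt_pow (N + 1) r).const_mul (c / ((N : ℝ) + 1))).congr_deriv ?_
        rw [Nat.add_sub_cancel]
        push_cast
        field_simp
      exact h1.mul (hasDerivAt_one_add_sq_rpow _ r)
    refine le_of_deriv_le_of_tendsto_zero (fun r _ => hd r) hF ?_ ?_ hF0 hr
    · intro r hr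
      have h1 : 0 ≤ c / (N + 1) * r ^ (N + 1) * (b * r * (1 + r ^ 2) ^ (-(b / 2) - 1)) := by
        have : 0 < b := by linarith
        positivity
      have h2 := mul_le_mul_of_nonneg_left (hlow r hr) (pow_pos hr N).le
      linarith
    · have h1 := (hd 0).continuousAt.tendsto.mono_left (nhdsWithin_le_nhds (s := Ioi 0))
      simpa using h1
  have hFpos : ∀ r, 0 < r → 0 < F r := fun r hr => lt_of_lt_of_le (by positivity) (hFlow r hr)
  have hFs : ContDiffOn ℝ ∞ F (Ioi 0) :=
    contDiffOn_of_hasDerivAt hF ((contDiff_id.pow N).contDiffOn.mul hf)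
  have hGs : ContDiffOn ℝ ∞ (fun r => -(F r / r ^ N)) (Ioi 0) :=
    (hFs.div (contDiff_id.pow N).contDiffOn fun r hr => (pow_pos hr N).ne').neg
  have hGlow : ∀ e B : ℝ, e < N + 1 → (∀ r, 0 < r → f r ≤ B * r ^ (-e)) →
      ∀ r, 0 < r → -(B / (N + 1 - e)) * r ^ (1 - e) ≤ -(F r / r ^ N) := by
    intro e B he hB r hr
    rw [neg_mul, neg_le_neg_iff, div_le_iff₀ (pow_pos hr N)]
    refine (hFup e B he hB r hr).trans_eq ?_
    rw [mul_assoc, ← Real.rpow_natCast, ← Real.rpow_add hr]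
    ring_nf
  obtain ⟨g, hg, hg0⟩ := exists_primitive_tendsto_atTop (h := fun r => -(F r / r ^ N))
    (B := A / (N + 1 - b)) (q := 1 - b) hGs.continuousOn (by linarith) (by
      intro r hr
      have h1 := hFpos r hr
      rw [abs_neg, abs_of_pos (by positivity)]
      linarith [hGlow b A hbn hup r hr])
  have hgs := contDiffOn_of_hasDerivAt hg hGs
  refine ⟨g, _, hgs, hg, ?_, hg0, ?_, hGlow, ?_⟩
  · intro r hr
    have h1 := hFpos r hr
    exact neg_nonpos.2 (by positivity)
  · intro r hr
    refine le_of_deriv_le_of_tendsto_atTop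
      (fun r _ => (hasDerivAt_one_add_sq_rpow (-((b - 2) / 2)) r).const_mul
        (c / ((N + 1) * (b - 2)))) hg ?_ ?_ hg0 hr
    · intro r hr
      have h1 : -((b - 2) / 2) - 1 = -(b / 2) := by ring
      have h2 : c / ((N + 1) * (b - 2)) * (2 * -((b - 2) / 2) * r * (1 + r ^ 2) ^ (-(b / 2))) =
          -(c / (N + 1) * r * (1 + r ^ 2) ^ (-(b / 2))) := by
        have : b - 2 ≠ 0 := by linarith
        field_simp
      rw [h1, h2, neg_le_neg_iff, le_div_iff₀ (pow_pos hr N)]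
      refine le_trans (le_of_eq ?_) (hFlow r hr)
      ring
    · simpa using (tendsto_one_add_sq_rpow_atTop
        (s := -((b - 2) / 2)) (by linarith)).const_mul (c / ((N + 1) * (b - 2)))
  · intro x hx
    have hx0 : 0 < ‖x‖ := norm_pos_iff.2 hx
    have h2 : ∀ r, 0 < r → HasDerivAt (fun r => -(F r / r ^ N))
        (-f r + N * (F r / r ^ N) / r) r := by
      intro r hr
      refine ((hF r hr).div (hasDerivAt_pow N r) (pow_pos hr N).ne').neg.congr_deriv ?_
      rcases N with _ | M
      · simp
      · rw [Nat.add_sub_cancel]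
        push_cast
        field_simp
        ring
    rw [laplacian_comp_norm (contDiffOn_infty.1 hgs 2) hg h2 hx]
    push_cast
    ring

lemma le_of_neg_rpow_le_deriv {g g₁ : ℝ → ℝ} (hg : ∀ r, 0 < r → HasDerivAt g (g₁ r) r)
    (hg0 : Tendsto g atTop (𝓝 0)) {K e : ℝ} (he : 2 < e)
    (hK : ∀ r, 0 < r → -K * r ^ (1 - e) ≤ g₁ r) {r : ℝ} (hr : 0 < r) :
    g r ≤ K / (e - 2) * r ^ (2 - e) := by
  refine le_of_deriv_le_of_tendsto_atTop hg
    (fun r hr => hasDerivAt_const_mul_rpow (K / (e - 2)) (2 - e) hr) ?_ hg0 ?_ hr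
  · intro r hr
    refine le_trans (le_of_eq ?_) (hK r hr)
    have : e - 2 ≠ 0 := by linarith
    rw [show 2 - e - 1 = 1 - e by ring]
    field_simp
    ring
  · have h1 := (tendsto_rpow_neg_atTop (y := e - 2) (by linarith)).const_mul (K / (e - 2))
    simpa using h1

/-! ### Radial solutions -/

/-- Smooth radial profiles squeezed between `(1 + r²)^(-b/2)` and `min (r^(-b)) (r^(-e))`. -/
def HasDecay (b e : ℝ) (f : ℝ → ℝ) : Prop :=
  ContDiffOn ℝ ∞ f (Ioi 0) ∧
    (∃ c, 0 < c ∧ ∀ r, 0 < r → c * (1 + r ^ 2) ^ (-(b / 2)) ≤ f r) ∧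
    (∃ A, ∀ r, 0 < r → f r ≤ A * r ^ (-b)) ∧ ∃ A, ∀ r, 0 < r → f r ≤ A * r ^ (-e)

lemma HasDecay.exists_potential {N : ℕ} {f : ℝ → ℝ} {b e : ℝ} (hf : HasDecay b e f)
    (hb2 : 2 < b) (hbn : b < N + 1) (he2 : 2 < e) (heb : e < b) :
    ∃ g : ℝ → ℝ, HasDecay (b - 2) (e - 2) g ∧
      ∀ x : EuclideanSpace ℝ (Fin (N + 1)), x ≠ 0 →
        -laplacian (fun y => g ‖y‖) x = f ‖x‖ := by
  obtain ⟨hs, ⟨c, hc, hlow⟩, ⟨A, hA⟩, ⟨B, hB⟩⟩ := hf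
  obtain ⟨g, g₁, hgs, hg, -, hg0, hglow, hg₁, hlap⟩ :=
    exists_radial_potential hs hb2 hbn hc hlow hA
  refine ⟨g, ⟨hgs, ⟨_, div_pos hc ?_, hglow⟩, ⟨A / (N + 1 - b) / (b - 2), ?_⟩,
    ⟨B / (N + 1 - e) / (e - 2), ?_⟩⟩, hlap⟩
  · exact mul_pos (by positivity) (by linarith)
  · intro r hr
    rw [neg_sub]
    exact le_of_neg_rpow_le_deriv hg hg0 hb2 (hg₁ b A hbn hA) hr
  · intro r hr
    rw [neg_sub]
    exact le_of_neg_rpow_le_deriv hg hg0 he2 (hg₁ e B (by linarith) hB) hr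

/-- Positive profiles, continuous up to the origin, comparable to `(1 + r²)^(-a/2)`. -/
def IsBubble (a : ℝ) (v : ℝ → ℝ) : Prop :=
  ContDiffOn ℝ ∞ v (Ioi 0) ∧ Tendsto v (𝓝[>] 0) (𝓝 (v 0)) ∧ 0 < v 0 ∧
    (∃ c, 0 < c ∧ ∀ r, 0 < r → c * (1 + r ^ 2) ^ (-(a / 2)) ≤ v r) ∧
    ∃ A, 0 < A ∧ ∀ r, 0 < r → v r ≤ A * (1 + r ^ 2) ^ (-(a / 2))

lemma le_one_add_sq_rpow {a M A r v : ℝ} (ha : 0 < a) (hM : 0 ≤ M) (hA : 0 ≤ A) (hr : 0 < r)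
    (h1 : r ≤ 1 → v ≤ M) (h2 : v ≤ A * r ^ (-a)) :
    v ≤ max M A * 2 ^ (a / 2) * (1 + r ^ 2) ^ (-(a / 2)) := by
  have hone : (2 : ℝ) ^ (a / 2) * 2 ^ (-(a / 2)) = 1 := by
    rw [← Real.rpow_add two_pos, add_neg_cancel, Real.rpow_zero]
  rw [mul_assoc]
  rcases le_total r 1 with hr1 | hr1
  · have h3 : (2 : ℝ) ^ (-(a / 2)) ≤ (1 + r ^ 2) ^ (-(a / 2)) :=
      Real.rpow_le_rpow_of_nonpos (by positivity) (by nlinarith) (by linarith)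
    have h4 : (1 : ℝ) ≤ 2 ^ (a / 2) * (1 + r ^ 2) ^ (-(a / 2)) := by
      refine hone.symm.le.trans ?_
      gcongr
    calc v ≤ M := h1 hr1
      _ ≤ M * (2 ^ (a / 2) * (1 + r ^ 2) ^ (-(a / 2))) := le_mul_of_one_le_right hM h4
      _ ≤ _ := by gcongr; exact le_max_left _ _
  · have h3 : (2 * r ^ 2 : ℝ) ^ (-(a / 2)) ≤ (1 + r ^ 2) ^ (-(a / 2)) :=
      Real.rpow_le_rpow_of_nonpos (by positivity) (by nlinarith) (by linarith)
    have h4 : r ^ (-a) ≤ 2 ^ (a / 2) * (1 + r ^ 2) ^ (-(a / 2)) := by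
      calc r ^ (-a) = 2 ^ (a / 2) * (2 * r ^ 2 : ℝ) ^ (-(a / 2)) := by
            rw [Real.mul_rpow two_pos.le (by positivity), ← mul_assoc, hone, one_mul,
              ← Real.rpow_natCast, ← Real.rpow_mul hr.le]
            congr 1
            push_cast
            ring
        _ ≤ _ := by gcongr
    calc v ≤ A * r ^ (-a) := h2
      _ ≤ A * (2 ^ (a / 2) * (1 + r ^ 2) ^ (-(a / 2))) := by gcongr
      _ ≤ _ := by gcongr; exact le_max_right _ _

lemma HasDecay.exists_isBubble_potential {N : ℕ} {f : ℝ → ℝ} {a ε : ℝ} (ha : 0 < a)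
    (hε : 0 < ε) (hf : HasDecay (a + 2) (2 - ε) f) (han : a + 2 < N + 1) :
    ∃ v : ℝ → ℝ, IsBubble a v ∧ ∀ x : EuclideanSpace ℝ (Fin (N + 1)), x ≠ 0 →
        -laplacian (fun y => v ‖y‖) x = f ‖x‖ := by
  obtain ⟨hs, ⟨c, hc, hlow⟩, ⟨A, hA⟩, ⟨B, hB⟩⟩ := hf
  obtain ⟨g, g₁, hgs, hg, hg₁', hg0, hglow, hg₁, hlap⟩ :=
    exists_radial_potential hs (by linarith) han hc hlow hA
  have hf1 : 0 < f 1 := lt_of_lt_of_le (by positivity) (hlow 1 one_pos)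
  have hA0 : 0 ≤ A := by simpa using hf1.le.trans (hA 1 one_pos)
  have hB0 : 0 ≤ B := by simpa using hf1.le.trans (hB 1 one_pos)
  rw [add_sub_cancel_right] at hglow
  have hgpos : ∀ r, 0 < r → 0 < g r := fun r hr => lt_of_lt_of_le (by positivity) (hglow r hr)
  have hup : ∀ r, 0 < r → g r ≤ A / (N + 1 - (a + 2)) / a * r ^ (-a) := by
    intro r hr
    have h1 := le_of_neg_rpow_le_deriv hg hg0 (by linarith) (hg₁ _ A han hA) hr
    rwa [add_sub_cancel_right, show 2 - (a + 2) = -a by ring] at h1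
  set K := B / ((N : ℝ) + 1 - (2 - ε))
  have hK0 : 0 ≤ K := div_nonneg hB0 (by linarith)
  have hmono : MonotoneOn (fun r => g r + K / ε * r ^ ε) (Ioi 0) := by
    refine monotoneOn_Ioi_of_hasDerivAt
      (fun r hr => (hg r hr).add (hasDerivAt_const_mul_rpow (K / ε) ε hr)) ?_
    intro r hr
    have h1 := hg₁ (2 - ε) B (by linarith) hB r hr
    rw [show 1 - (2 - ε) = ε - 1 by ring] at h1
    rw [div_mul_cancel₀ _ hε.ne']
    linarith
  have hbdd : ∀ r, 0 < r → r ≤ 1 → g r ≤ g 1 + K / ε := by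
    intro r hr hr1
    have h1 := hmono hr (one_pos : (0 : ℝ) < 1) hr1
    simp only [Real.one_rpow, mul_one] at h1
    have : 0 ≤ K / ε * r ^ ε := by positivity
    linarith
  have hanti : AntitoneOn g (Ioi 0) := by
    have h1 := monotoneOn_Ioi_of_hasDerivAt (fun r hr => (hg r hr).neg)
      fun r hr => neg_nonneg.2 (hg₁' r hr)
    intro r hr s hs hrs
    exact neg_le_neg_iff.1 (h1 hr hs hrs)
  have hlim : Tendsto g (𝓝[>] 0) (𝓝 (sSup (g '' Ioo 0 1))) := by
    refine (hanti.mono Ioo_subset_Ioi_self).tendsto_nhdsWithin_Ioo_right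
      (nonempty_Ioo.2 one_pos) ⟨g 1 + K / ε, ?_⟩
    rintro _ ⟨r, hr, rfl⟩
    exact hbdd r hr.1 hr.2.le
  set L := sSup (g '' Ioo 0 1)
  have hL : g 1 ≤ L := by
    refine ge_of_tendsto hlim ?_
    filter_upwards [Ioo_mem_nhdsGT (zero_lt_one' ℝ)] with s hs
    exact hanti hs.1 (mem_Ioi.2 one_pos) hs.2.le
  have hv : ∀ r, 0 < r → Function.update g 0 L r = g r := fun r hr =>
    Function.update_of_ne hr.ne' _ _
  refine ⟨Function.update g 0 L, ⟨hgs.congr fun r hr => hv r hr, ?_, ?_, ⟨c / ((N + 1) * a), ?_, ?_⟩,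
    ⟨max (g 1 + K / ε) (A / (N + 1 - (a + 2)) / a) * 2 ^ (a / 2), ?_, ?_⟩⟩, ?_⟩
  · rw [Function.update_self]
    exact hlim.congr' (eventually_nhdsWithin_of_forall fun r hr => (hv r hr).symm)
  · rw [Function.update_self]
    exact (hgpos 1 one_pos).trans_le hL
  · positivity
  · intro r hr
    rw [hv r hr]
    exact hglow r hr
  · have := hgpos 1 one_pos
    positivity
  · intro r hr
    rw [hv r hr]
    have := hgpos 1 one_pos
    exact le_one_add_sq_rpow ha (by positivity)
      (div_nonneg (div_nonneg hA0 (by linarith)) ha.le) hr (hbdd r hr) (hup r hr)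
  · intro x hx
    rw [← hlap x hx]
    congr 1
    refine laplacian_congr ?_
    filter_upwards [isOpen_compl_singleton.mem_nhds hx] with y hy
    exact hv _ (norm_pos_iff.2 hy)

lemma HasDecay.exists_isBubble_negLapPow {N : ℕ} {a ε : ℝ} (ha : 0 < a) (hε : 0 < ε)
    (hε1 : ε ≤ 1) (j : ℕ) : ∀ {f : ℝ → ℝ},
      HasDecay (a + 2 * (j + 1 : ℕ)) (2 * (j + 1 : ℕ) - ε) f → a + 2 * (j + 1 : ℕ) < N + 1 →
    ∃ v : ℝ → ℝ, IsBubble a v ∧ ∀ x : EuclideanSpace ℝ (Fin (N + 1)), x ≠ 0 →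
        negLapPow (j + 1) (fun y => v ‖y‖) x = f ‖x‖ := by
  induction j with
  | zero =>
    intro f hf han
    simp only [zero_add, Nat.cast_one, mul_one] at hf han
    exact hf.exists_isBubble_potential ha hε han
  | succ j ih =>
    intro f hf han
    have hj : (0 : ℝ) ≤ j := j.cast_nonneg
    push_cast at hf han
    obtain ⟨g, hg, hlap⟩ := hf.exists_potential (N := N) (by linarith) han (by linarith)
      (by linarith)
    obtain ⟨v, hv, hv'⟩ := ih (f := g) (by
      convert hg using 1 <;> push_cast <;> ring) (by push_cast; linarith)
    refine ⟨v, hv, fun x hx => ?_⟩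
    rw [← hlap x hx, negLapPow_succ]
    refine congrArg Neg.neg (laplacian_congr ?_)
    filter_upwards [isOpen_compl_singleton.mem_nhds hx] with y hy
    exact hv' y hy

/-! ### Existence -/

lemma one_add_sq_rpow_le {r s : ℝ} (hr : 0 < r) (hs : 0 ≤ s) :
    (1 + r ^ 2) ^ (-(s / 2)) ≤ r ^ (-s) := by
  calc (1 + r ^ 2) ^ (-(s / 2)) ≤ (r ^ 2) ^ (-(s / 2)) :=
        Real.rpow_le_rpow_of_nonpos (by positivity) (by linarith) (by linarith)
    _ = r ^ (-s) := by
        rw [← Real.rpow_natCast, ← Real.rpow_mul hr.le]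
        congr 1
        push_cast
        ring

lemma hasDecay_rpow_mul_one_add_sq_rpow {a m σ : ℝ} (ha : 0 < a) (hσ : 0 ≤ σ) (hm : σ < m) :
    HasDecay (a + m) (m - min (m - σ) 1)
      fun r => r ^ (-σ) * (1 + r ^ 2) ^ (-((a + m - σ) / 2)) := by
  have hup : ∀ r : ℝ, 0 < r →
      r ^ (-σ) * (1 + r ^ 2) ^ (-((a + m - σ) / 2)) ≤ r ^ (-(a + m)) := by
    intro r hr
    calc _ ≤ r ^ (-σ) * r ^ (-(a + m - σ)) := by
          gcongr
          exact one_add_sq_rpow_le hr (by linarith)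
      _ = r ^ (-(a + m)) := by
          rw [← Real.rpow_add hr]
          congr 1
          ring
  refine ⟨?_, ⟨1, one_pos, ?_⟩, ⟨1, fun r hr => by simpa using hup r hr⟩, ⟨1, ?_⟩⟩
  · refine ContDiffOn.mul ?_ ?_
    · exact fun r hr => (Real.contDiffAt_rpow_const_of_ne hr.ne').contDiffWithinAt
    · exact (ContDiff.rpow_const_of_ne (by fun_prop) fun r => by positivity).contDiffOn
  · intro r hr
    have h1 := one_add_sq_rpow_le hr hσ
    calc 1 * (1 + r ^ 2) ^ (-((a + m) / 2))
        = (1 + r ^ 2) ^ (-(σ / 2)) * (1 + r ^ 2) ^ (-((a + m - σ) / 2)) := by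
          rw [one_mul, ← Real.rpow_add (by positivity)]
          congr 1
          ring
      _ ≤ r ^ (-σ) * (1 + r ^ 2) ^ (-((a + m - σ) / 2)) := by gcongr
  · intro r hr
    rw [one_mul]
    rcases le_total r 1 with hr1 | hr1
    · calc r ^ (-σ) * (1 + r ^ 2) ^ (-((a + m - σ) / 2)) ≤ r ^ (-σ) * 1 := by
            gcongr
            exact Real.rpow_le_one_of_one_le_of_nonpos (by nlinarith) (by linarith)
        _ ≤ _ := by
            rw [mul_one]
            refine Real.rpow_le_rpow_of_exponent_ge hr hr1 ?_
            linarith [min_le_left (m - σ) 1]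
    · refine (hup r hr).trans (Real.rpow_le_rpow_of_exponent_le hr1 ?_)
      have : 0 < min (m - σ) 1 := lt_min (by linarith) one_pos
      linarith

lemma IsBubble.continuousOn {a : ℝ} {v : ℝ → ℝ} (hv : IsBubble a v) :
    ContinuousOn v (Ici 0) := by
  intro r hr
  rcases (mem_Ici.1 hr).eq_or_lt with rfl | hr
  · exact continuousWithinAt_Ioi_iff_Ici.1 hv.2.1
  · exact (hv.1.continuousOn.continuousAt (Ioi_mem_nhds hr)).continuousWithinAt

lemma IsBubble.pos {a : ℝ} {v : ℝ → ℝ} (hv : IsBubble a v) {r : ℝ} (hr : 0 ≤ r) : 0 < v r := by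
  obtain ⟨-, -, h0, ⟨c, hc, hlow⟩, -⟩ := hv
  rcases hr.eq_or_lt with rfl | hr
  · exact h0
  · exact lt_of_lt_of_le (by positivity) (hlow r hr)

lemma IsBubble.exists_bound {a p : ℝ} {v : ℝ → ℝ} (hv : IsBubble a v) (hp : 0 ≤ p) :
    ∃ C : ℝ, 1 ≤ C ∧ ∀ r, 0 < r → 1 / C ≤ (1 + r ^ 2) ^ (-(a * p / 2)) / v r ^ p ∧
      (1 + r ^ 2) ^ (-(a * p / 2)) / v r ^ p ≤ C := by
  obtain ⟨c, hc, hlow⟩ := hv.2.2.2.1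
  obtain ⟨A, hA, hup⟩ := hv.2.2.2.2
  refine ⟨max 1 (max (A ^ p) ((1 / c) ^ p)), le_max_left _ _, fun r hr => ?_⟩
  have hvr := hv.pos hr.le
  have hq : 0 < (1 + r ^ 2) ^ (-(a / 2)) := by positivity
  have e : (1 + r ^ 2) ^ (-(a * p / 2)) / v r ^ p = ((1 + r ^ 2) ^ (-(a / 2)) / v r) ^ p := by
    rw [Real.div_rpow hq.le hvr.le, ← Real.rpow_mul (by positivity)]
    congr 2
    ring
  rw [e]
  constructor
  · calc 1 / max 1 (max (A ^ p) ((1 / c) ^ p)) ≤ 1 / A ^ p := by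
          refine one_div_le_one_div_of_le (by positivity) ?_
          exact (le_max_left _ _).trans (le_max_right _ _)
      _ = (1 / A) ^ p := by rw [Real.div_rpow zero_le_one hA.le, Real.one_rpow]
      _ ≤ _ := by
          refine Real.rpow_le_rpow (by positivity) ?_ hp
          rw [div_le_div_iff₀ hA hvr]
          linarith [hup r hr]
  · calc ((1 + r ^ 2) ^ (-(a / 2)) / v r) ^ p ≤ (1 / c) ^ p := by
          refine Real.rpow_le_rpow (by positivity) ?_ hp
          rw [div_le_div_iff₀ hvr hc]
          linarith [hlow r hr]
      _ ≤ _ := (le_max_right _ _).trans (le_max_right _ _)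

theorem exists_positive_solution {n k : ℕ} (hk : 1 ≤ k) (hn : 2 * k < n) {σ p : ℝ}
    (hσ0 : 0 ≤ σ) (hσk : σ < 2 * (k : ℝ)) (hp : 1 < p)
    (h : ((n : ℝ) - σ) / ((n : ℝ) - 2 * (k : ℝ)) < p) :
    ∃ c u : EuclideanSpace ℝ (Fin n) → ℝ,
      DoubleBounded c ∧ (∀ x, 0 < u x) ∧ Continuous u ∧
      ContDiffOn ℝ ∞ u {(0 : EuclideanSpace ℝ (Fin n))}ᶜ ∧
      ∀ x : EuclideanSpace ℝ (Fin n), x ≠ 0 →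
        negLapPow k u x = c x * ‖x‖ ^ (-σ) * u x ^ p := by
  obtain ⟨N, rfl⟩ : ∃ N, n = N + 1 := ⟨n - 1, by omega⟩
  obtain ⟨j, rfl⟩ : ∃ j, k = j + 1 := ⟨k - 1, by omega⟩
  set m : ℝ := 2 * ((j + 1 : ℕ) : ℝ) with hm
  have hmn : m < ((N + 1 : ℕ) : ℝ) := by
    rw [hm]
    exact_mod_cast hn
  set a : ℝ := (m - σ) / (p - 1) with ha
  have hp1 : 0 < p - 1 := by linarith
  have ha0 : 0 < a := div_pos (by linarith) hp1
  have hap : a * p = a + m - σ := by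
    rw [ha]
    field_simp
    ring
  have han : a + m < N + 1 := by
    rw [div_lt_iff₀ (by linarith)] at h
    push_cast at h
    have : a < N + 1 - m := by
      rw [ha, div_lt_iff₀ hp1]
      linarith
    linarith
  obtain ⟨v, hv, hvf⟩ := (hasDecay_rpow_mul_one_add_sq_rpow ha0 hσ0 hσk).exists_isBubble_negLapPow
    (N := N) ha0 (lt_min (by linarith) one_pos) (min_le_right _ _) j han
  obtain ⟨C, hC1, hC⟩ := hv.exists_bound (p := p) (by linarith)
  refine ⟨fun x => if x = 0 then 1 else (1 + ‖x‖ ^ 2) ^ (-(a * p / 2)) / v ‖x‖ ^ p,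
    fun x => v ‖x‖, ⟨C, by linarith, fun x => ?_⟩, fun x => hv.pos (norm_nonneg x),
    hv.continuousOn.comp_continuous continuous_norm fun x => norm_nonneg x, ?_, ?_⟩
  · dsimp only
    split_ifs with hx
    · exact ⟨(div_le_one (by linarith)).2 hC1, hC1⟩
    · exact hC _ (norm_pos_iff.2 hx)
  · intro x hx
    exact ((hv.1.contDiffAt (Ioi_mem_nhds (norm_pos_iff.2 hx))).comp x
      (contDiffAt_norm ℝ hx)).contDiffWithinAt
  · intro x hx
    have h1 := (Real.rpow_pos_of_pos (hv.pos (norm_nonneg x)) p).ne'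
    rw [hvf x hx]
    dsimp only
    rw [if_neg hx, hap]
    field_simp

theorem stmt_5 (n k : ℕ) (hk : 1 ≤ k) (hn : 2 * k < n) (σ p : ℝ)
    (hσ0 : 0 ≤ σ) (hσk : σ < 2 * (k : ℝ)) (hp : 1 < p) :
    (∃ c u : EuclideanSpace ℝ (Fin n) → ℝ,
      DoubleBounded c ∧ (∀ x, 0 < u x) ∧ Continuous u ∧
      ContDiffOn ℝ (2 * k) u {(0 : EuclideanSpace ℝ (Fin n))}ᶜ ∧
      ∀ x : EuclideanSpace ℝ (Fin n), x ≠ 0 →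
        negLapPow k u x = c x * ‖x‖ ^ (-σ) * u x ^ p)
    ↔ ((n : ℝ) - σ) / ((n : ℝ) - 2 * (k : ℝ)) < p := by
  constructor
  · rintro ⟨c, u, hc, hpos, hu, hu', heq⟩
    exact lt_of_exists_positive_solution hk hn hσ0 hp hc hpos hu (by exact_mod_cast hu') heq
  · intro h
    obtain ⟨c, u, hc, hpos, hu, hu', heq⟩ := exists_positive_solution hk hn hσ0 hσk hp h
    exact ⟨c, u, hc, hpos, hu, by exact_mod_cast contDiffOn_infty.1 hu' (2 * k), heq⟩
end
end
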